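/- arXiv:2605.22397 — 2 statements merged into one kernel-verified Lean document; each statement's English description precedes it below -/
import Mathlib

section
/- For all positive integers m, t, s with m ≥ 2s ≥ 4 and every ε > 0 there exists n_0 such that for all n ≥ n_0 with n divisible by 3: ex_3(n, F_5^S(m,t,K_{s,s})) ≤ e(T_3(n,3)) + 6·ex_3^{bip}(n/3, n/3, K_{t,s,s}) + 3·ex_3(n/3, K_{t,s,s}) + ε·n^{3−1/s²}. -/
open Finset

/-- `H` (a 3-graph given by its edge set on vertex type `V`) contains a copy of the
3-graph `F` (given by its edge set on vertex type `W`). -/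
def HasCopy {V W : Type*} [DecidableEq V] [DecidableEq W]
    (H : Finset (Finset V)) (F : Finset (Finset W)) : Prop :=
  ∃ f : W ↪ V, ∀ e ∈ F, e.image f ∈ H

/-- The Turán number `ex_3(n, F)`: the maximum number of hyperedges of an `F`-free
3-uniform hypergraph on `n` vertices. -/
noncomputable def exThree {W : Type*} [DecidableEq W] (n : ℕ) (F : Finset (Finset W)) : ℕ :=
  sSup {k | ∃ H : Finset (Finset (Fin n)), (∀ e ∈ H, e.card = 3) ∧ ¬ HasCopy H F ∧ H.card = k}

/-- The `i`-th part of the balanced tripartition of `Fin n` (vertices with residue `i` mod 3);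
the parts have sizes `⌊n/3⌋` or `⌈n/3⌉`. -/
def turanPart (n : ℕ) (i : Fin 3) : Finset (Fin n) :=
  Finset.univ.filter (fun v => (v : ℕ) % 3 = (i : ℕ))

/-- The balanced complete tripartite 3-graph `T_3(n,3)`: hyperedges are exactly the triples
with one vertex in each part of the balanced tripartition. -/
def T3 (n : ℕ) : Finset (Finset (Fin n)) :=
  Finset.univ.filter (fun e => e.card = 3 ∧ ∀ i : Fin 3, (e ∩ turanPart n i).card = 1)

/-- The 3-graph `F_5` on `{f_1, …, f_5}` with hyperedges `f_1f_2f_3, f_1f_2f_4, f_3f_4f_5`. -/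
def F5 : Finset (Finset (Fin 5)) := {{0,1,2},{0,1,3},{2,3,4}}

/-- `F_5(f_5;t)`: `F_5` with the vertex `f_5` blown up to `t` copies.
Here `inl 0, inl 1, inl 2, inl 3` play the roles of `f_1,f_2,f_3,f_4` and the
vertices `inr j` are the `t` copies of `f_5`. -/
def F5b5 (t : ℕ) : Finset (Finset (Fin 4 ⊕ Fin t)) :=
  ({({Sum.inl 0, Sum.inl 1, Sum.inl 2} : Finset (Fin 4 ⊕ Fin t)),
    ({Sum.inl 0, Sum.inl 1, Sum.inl 3} : Finset (Fin 4 ⊕ Fin t))} :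
      Finset (Finset (Fin 4 ⊕ Fin t))) ∪
  Finset.univ.image (fun j : Fin t => ({Sum.inl 2, Sum.inl 3, Sum.inr j} : Finset (Fin 4 ⊕ Fin t)))

/-- `F_5(f_3;t)`: `F_5` with the vertex `f_3` blown up to `t` copies.
Here `inl 0, inl 1, inl 2, inl 3` play the roles of `f_1,f_2,f_4,f_5` and the
vertices `inr j` are the `t` copies of `f_3`. -/
def F5b3 (t : ℕ) : Finset (Finset (Fin 4 ⊕ Fin t)) :=
  ({({Sum.inl 0, Sum.inl 1, Sum.inl 2} : Finset (Fin 4 ⊕ Fin t))} :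
      Finset (Finset (Fin 4 ⊕ Fin t))) ∪
  Finset.univ.image (fun j : Fin t => ({Sum.inl 0, Sum.inl 1, Sum.inr j} : Finset (Fin 4 ⊕ Fin t))) ∪
  Finset.univ.image (fun j : Fin t => ({Sum.inr j, Sum.inl 2, Sum.inl 3} : Finset (Fin 4 ⊕ Fin t)))

/-- `S^t(N)` (the size of `D(N,3,t,2)`): the maximum number of hyperedges of a 3-graph on `N`
vertices in which every pair of vertices is contained in at most `t-1` hyperedges. -/
noncomputable def Dmax (N t : ℕ) : ℕ :=
  sSup {k | ∃ H : Finset (Finset (Fin N)), (∀ e ∈ H, e.card = 3) ∧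
    (∀ u v : Fin N, u ≠ v → (H.filter (fun e => u ∈ e ∧ v ∈ e)).card ≤ t - 1) ∧ H.card = k}

/-- `e(T_3(n,3)^{t+})`: the number of hyperedges of `T_3(n,3)` together with a maximum
3-graph inside each part in which every pair of vertices lies in at most `t-1` hyperedges. -/
noncomputable def eT3plus (n t : ℕ) : ℕ :=
  (T3 n).card + ∑ i : Fin 3, Dmax ((turanPart n i).card) t

/-- `F` is a subgraph of a blow-up of `F_5`: every edge is a triple, and there is a map
to `V(F_5)` that is injective on each edge and sends each edge to an edge of `F_5`. -/
def IsSubBlowupF5 {W : Type*} [DecidableEq W] (F : Finset (Finset W)) : Prop :=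
  (∀ e ∈ F, e.card = 3) ∧ ∃ φ : W → Fin 5, ∀ e ∈ F, (e.image φ).card = 3 ∧ e.image φ ∈ F5

/-- The complete tripartite 3-graph with parts `A`, `B`, `C`: all triples with exactly
one vertex in each of `A`, `B`, `C`. -/
def tripartiteEdges {n : ℕ} (A B C : Finset (Fin n)) : Finset (Finset (Fin n)) :=
  Finset.univ.filter (fun e =>
    (e ∩ A).card = 1 ∧ (e ∩ B).card = 1 ∧ (e ∩ C).card = 1 ∧ e.card = 3)

/-- The complete 3-partite 3-graph `K_{t,s,s}` with parts of sizes `t`, `s`, `s`. -/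
def Ktss (t s : ℕ) : Finset (Finset (Fin t ⊕ Fin s ⊕ Fin s)) :=
  Finset.univ.image (fun x : Fin t × Fin s × Fin s =>
    ({Sum.inl x.1, Sum.inr (Sum.inl x.2.1), Sum.inr (Sum.inr x.2.2)} :
      Finset (Fin t ⊕ Fin s ⊕ Fin s)))

/-- All hyperedges of `H` consist of one vertex of the `A`-side (`Fin mA`) and two
vertices of the `B`-side (`Fin nB`). -/
def BipShape (mA nB : ℕ) (H : Finset (Finset (Fin mA ⊕ Fin nB))) : Prop :=
  ∀ e ∈ H, ∃ a : Fin mA, ∃ b c : Fin nB, b ≠ c ∧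
    e = ({Sum.inl a, Sum.inr b, Sum.inr c} : Finset (Fin mA ⊕ Fin nB))

/-- `H` contains a copy of `K_{t,s,s}` whose `t`-vertex part lies on the `A`-side and whose
two `s`-vertex parts lie on the `B`-side. -/
def HasBipKtss (mA nB t s : ℕ) (H : Finset (Finset (Fin mA ⊕ Fin nB))) : Prop :=
  ∃ (T : Finset (Fin mA)) (S0 S1 : Finset (Fin nB)), T.card = t ∧
    S0.card = s ∧ S1.card = s ∧ Disjoint S0 S1 ∧
    ∀ a ∈ T, ∀ b ∈ S0, ∀ c ∈ S1,
      ({Sum.inl a, Sum.inr b, Sum.inr c} : Finset (Fin mA ⊕ Fin nB)) ∈ H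

/-- The bipartite Turán number `ex_3^{bip}(mA, nB, K_{t,s,s})`. -/
noncomputable def exBip (mA nB t s : ℕ) : ℕ :=
  sSup {k | ∃ H : Finset (Finset (Fin mA ⊕ Fin nB)),
    BipShape mA nB H ∧ ¬ HasBipKtss mA nB t s H ∧ H.card = k}

/-- The `s`-set `S_0` inside the residue-0 part of `T_3(3m,3)`. -/
def S0set (m s : ℕ) (h : 2*s ≤ m) : Finset (Fin (3*m)) :=
  Finset.univ.image (fun i : Fin s => (⟨3*i.val, by have := i.isLt; omega⟩ : Fin (3*m)))

/-- The `s`-set `S_1` inside the residue-0 part of `T_3(3m,3)`, disjoint from `S_0`. -/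
def S1set (m s : ℕ) (h : 2*s ≤ m) : Finset (Fin (3*m)) :=
  Finset.univ.image (fun i : Fin s => (⟨3*(s+i.val), by have := i.isLt; omega⟩ : Fin (3*m)))

/-- The 3-graph `F_5^S(m,t,K_{s,s})`: `T_3(3m,3)` (on the `inl` vertices) together with a set
`T` of `t` new vertices (the `inr` vertices) and all triples consisting of one vertex of `T`,
one vertex of `S_0` and one vertex of `S_1`. -/
def F5Stss (m t s : ℕ) (h : 2*s ≤ m) : Finset (Finset (Fin (3*m) ⊕ Fin t)) :=
  (T3 (3*m)).image (fun e => e.image Sum.inl) ∪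
  Finset.univ.biUnion (fun j : Fin t =>
    ((S0set m s h) ×ˢ (S1set m s h)).image (fun p =>
      ({Sum.inr j, Sum.inl p.1, Sum.inl p.2} : Finset (Fin (3*m) ⊕ Fin t))))

/-- `F_sim(t)`: the 3-graph with hyperedges `f_1f_2f_3, f_1f_2f_4, f_3f_4f_5, f_5f_6f_7,
f_6f_7f_8` in which `f_8` is blown up to `t` copies. Here `inl 0, …, inl 6` play the roles
of `f_1, …, f_7` and the vertices `inr j` are the `t` copies of `f_8`. -/
def Fsim (t : ℕ) : Finset (Finset (Fin 7 ⊕ Fin t)) :=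
  ({({Sum.inl 0, Sum.inl 1, Sum.inl 2} : Finset (Fin 7 ⊕ Fin t)),
    ({Sum.inl 0, Sum.inl 1, Sum.inl 3} : Finset (Fin 7 ⊕ Fin t)),
    ({Sum.inl 2, Sum.inl 3, Sum.inl 4} : Finset (Fin 7 ⊕ Fin t)),
    ({Sum.inl 4, Sum.inl 5, Sum.inl 6} : Finset (Fin 7 ⊕ Fin t))} :
      Finset (Finset (Fin 7 ⊕ Fin t))) ∪
  Finset.univ.image (fun j : Fin t => ({Sum.inl 5, Sum.inl 6, Sum.inr j} : Finset (Fin 7 ⊕ Fin t)))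

/-- The 3-graph with parts `A`, `B`, `C` and an extra clique `X`: its hyperedges are the
triples with one vertex in each of `A`, `B`, `C`, all 3-subsets of `X`, and the triples with
one vertex in `X` and two vertices in a common part among `A`, `B`, `C`. -/
def simConstr (n : ℕ) (A B C X : Finset (Fin n)) : Finset (Finset (Fin n)) :=
  Finset.univ.filter (fun e => e.card = 3 ∧
    (((e ∩ A).card = 1 ∧ (e ∩ B).card = 1 ∧ (e ∩ C).card = 1) ∨
     e ⊆ X ∨
     ((e ∩ X).card = 1 ∧ ((e ∩ A).card = 2 ∨ (e ∩ B).card = 2 ∨ (e ∩ C).card = 2))))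

/-- `F_5^S(m)`: `T_3(3m,3)` together with one new vertex `v = inr ()` and one hyperedge
consisting of `v` and two vertices (`0` and `3`) lying in one part of `T_3(3m,3)`. -/
def F5Sm (m : ℕ) (hm : 2 ≤ m) : Finset (Finset (Fin (3*m) ⊕ Unit)) :=
  (T3 (3*m)).image (fun e => e.image Sum.inl) ∪
  {({Sum.inr (), Sum.inl ⟨0, by omega⟩, Sum.inl ⟨3, by omega⟩} : Finset (Fin (3*m) ⊕ Unit))}

/-- The disjoint union of `k` vertex-disjoint copies of the 3-graph `F`. -/
def copies (k : ℕ) {W : Type*} [DecidableEq W] (F : Finset (Finset W)) :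
    Finset (Finset (Fin k × W)) :=
  Finset.univ.biUnion (fun j : Fin k => F.image (fun e => e.image (fun w => (j, w))))

/-- The 3-graph `G(t,m,n)` (it does not depend on `m`): the vertices `v < t` form the set
`T`, the remaining `n - t` vertices carry a copy of `T_3(n-t,3)` (parts by residue of
`v - t` mod 3), and the hyperedges are those of this `T_3(n-t,3)` together with all
3-sets of vertices intersecting `T`. -/
def Gtmn (t n : ℕ) : Finset (Finset (Fin n)) :=
  Finset.univ.filter (fun e => e.card = 3 ∧
    ((∃ v ∈ e, (v : ℕ) < t) ∨
     (∀ i : Fin 3, (e.filter (fun v : Fin n => t ≤ (v : ℕ) ∧ ((v : ℕ) - t) % 3 = (i : ℕ))).card = 1)))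

/-- The blow-up of `F_5` in which every vertex is replaced by `t` copies:
the vertex `(i, j)` is the `j`-th copy of `f_{i+1}`. -/
def F5blowAll (t : ℕ) : Finset (Finset (Fin 5 × Fin t)) :=
  Finset.univ.biUnion (fun x : Fin t × Fin t × Fin t =>
    ({ ({((0:Fin 5), x.1), ((1:Fin 5), x.2.1), ((2:Fin 5), x.2.2)} : Finset (Fin 5 × Fin t)),
       ({((0:Fin 5), x.1), ((1:Fin 5), x.2.1), ((3:Fin 5), x.2.2)} : Finset (Fin 5 × Fin t)),
       ({((2:Fin 5), x.1), ((3:Fin 5), x.2.1), ((4:Fin 5), x.2.2)} : Finset (Fin 5 × Fin t)) } :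
      Finset (Finset (Fin 5 × Fin t))))

/-- An enumeration of a finset of size `k` by `Fin k`. -/
theorem exists_enum {V : Type*} {S : Finset V} {k : ℕ} (h : S.card = k) :
    ∃ f : Fin k → V, Function.Injective f ∧ ∀ i, f i ∈ S :=
  ⟨fun i => (S.equivFinOfCardEq h).symm i,
    fun _ _ hij => (S.equivFinOfCardEq h).symm.injective (Subtype.ext hij), fun i =>
    ((S.equivFinOfCardEq h).symm i).2⟩

theorem pairwise_ne_of_card_three {V : Type*} [DecidableEq V] {x y z : V}
    (h : ({x, y, z} : Finset V).card = 3) : x ≠ y ∧ x ≠ z ∧ y ≠ z := by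
  refine ⟨?_, ?_, ?_⟩ <;> rintro rfl
  · have := card_le_two (a := x) (b := z)
    simp at h
    omega
  · have := card_le_two (a := y) (b := x)
    rw [insert_comm] at h
    simp at h
    omega
  · have := card_le_two (a := x) (b := y)
    simp at h
    omega

/-- The three parts of a tripartition of `Fin (3 * m)` written as functions on `Fin m`. -/
theorem exists_eq_of_mem_T3 {m : ℕ} {e : Finset (Fin (3 * m))} (he : e ∈ T3 (3 * m)) :
    ∃ i j k : Fin m, e = {⟨3 * i, by omega⟩, ⟨3 * j + 1, by omega⟩, ⟨3 * k + 2, by omega⟩} := by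
  simp only [T3, mem_filter, mem_univ, true_and] at he
  obtain ⟨hc, hp⟩ := he
  have key : ∀ r : Fin 3, ∃ v ∈ e, (v : ℕ) % 3 = r := by
    intro r
    obtain ⟨v, hv⟩ := card_eq_one.1 (hp r)
    have : v ∈ e ∩ turanPart (3 * m) r := by rw [hv]; exact mem_singleton_self _
    rw [mem_inter] at this
    refine ⟨v, this.1, ?_⟩
    simpa [turanPart] using this.2
  obtain ⟨u, hu, hu'⟩ := key 0
  obtain ⟨v, hv, hv'⟩ := key 1
  obtain ⟨w, hw, hw'⟩ := key 2
  simp only [Fin.val_zero, Fin.val_one, Fin.val_two] at hu' hv' hw'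
  refine ⟨⟨u / 3, by omega⟩, ⟨v / 3, by omega⟩, ⟨w / 3, by omega⟩, ?_⟩
  have e1 : (⟨3 * (u / 3), by omega⟩ : Fin (3 * m)) = u := by ext; simp; omega
  have e2 : (⟨3 * (v / 3) + 1, by omega⟩ : Fin (3 * m)) = v := by ext; simp; omega
  have e3 : (⟨3 * (w / 3) + 2, by omega⟩ : Fin (3 * m)) = w := by ext; simp; omega
  simp only [e1, e2, e3]
  symm
  apply eq_of_subset_of_card_le
  · intro x hx
    simp only [mem_insert, mem_singleton] at hx
    rcases hx with rfl | rfl | rfl <;> assumption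
  · rw [hc]
    have h1 : u ≠ v := by rintro rfl; omega
    have h2 : u ≠ w := by rintro rfl; omega
    have h3 : v ≠ w := by rintro rfl; omega
    rw [card_insert_of_notMem (by simp [h1, h2]), card_pair h3]

/-- A sufficient condition for containing a copy of `F_5^S(m,t,K_{s,s})`. -/
theorem hasCopy_F5Stss {V : Type*} [DecidableEq V] {H : Finset (Finset V)}
    (h3 : ∀ e ∈ H, e.card = 3) {m t s : ℕ} (ht : 1 ≤ t) (hs : 2 ≤ s) (hm : 2 * s ≤ m)
    {S0 S1 T A Q R : Finset V} (hS0 : S0.card = s) (hS1 : S1.card = s) (hT : T.card = t)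
    (hA : 2 * m + t ≤ A.card) (hQ : 2 * m + t ≤ Q.card) (hR : 2 * m + t ≤ R.card)
    (h0 : ∀ x ∈ S0, ∀ q ∈ Q, ∀ r ∈ R, ({x, q, r} : Finset V) ∈ H)
    (h1 : ∀ x ∈ S1, ∀ q ∈ Q, ∀ r ∈ R, ({x, q, r} : Finset V) ∈ H)
    (h2 : ∀ x ∈ A, ∀ q ∈ Q, ∀ r ∈ R, ({x, q, r} : Finset V) ∈ H)
    (hTS : ∀ τ ∈ T, ∀ x ∈ S0, ∀ y ∈ S1, ({τ, x, y} : Finset V) ∈ H) :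
    HasCopy H (F5Stss m t s hm) := by
  have hA' : m - 2 * s ≤ (A \ (S0 ∪ S1 ∪ T)).card := by
    have e1 := le_card_sdiff (S0 ∪ S1 ∪ T) A
    have e2 := card_union_le (S0 ∪ S1) T
    have e3 := card_union_le S0 S1
    omega
  have hQ' : m ≤ (Q \ T).card := by
    have e1 := le_card_sdiff T Q
    omega
  have hR' : m ≤ (R \ T).card := by
    have e1 := le_card_sdiff T R
    omega
  obtain ⟨A', hAs, hAc⟩ := exists_subset_card_eq hA'
  obtain ⟨Q', hQs, hQc⟩ := exists_subset_card_eq hQ'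
  obtain ⟨R', hRs, hRc⟩ := exists_subset_card_eq hR'
  obtain ⟨f0, i0, m0⟩ := exists_enum hS0
  obtain ⟨f1, i1, m1⟩ := exists_enum hS1
  obtain ⟨fT, iT, mT⟩ := exists_enum hT
  obtain ⟨fA, iA, mA⟩ := exists_enum hAc
  obtain ⟨fQ, iQ, mQ⟩ := exists_enum hQc
  obtain ⟨fR, iR, mR⟩ := exists_enum hRc
  have mA1 : ∀ i, fA i ∈ A ∧ fA i ∉ S0 ∧ fA i ∉ S1 ∧ fA i ∉ T := by
    intro i
    have := hAs (mA i)
    simp only [mem_sdiff, mem_union, not_or] at this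
    tauto
  have mQ1 : ∀ i, fQ i ∈ Q ∧ fQ i ∉ T := fun i => by simpa using hQs (mQ i)
  have mR1 : ∀ i, fR i ∈ R ∧ fR i ∉ T := fun i => by simpa using hRs (mR i)
  have ne3 := fun {x y z : V} (h : ({x, y, z} : Finset V) ∈ H) =>
    pairwise_ne_of_card_three (h3 _ h)
  let p : Fin m → V := fun i =>
    if h : i.1 < s then f0 ⟨i, h⟩
    else if h' : i.1 < 2 * s then f1 ⟨i - s, by omega⟩
    else fA ⟨i - 2 * s, by omega⟩
  have hp : ∀ i, (p i ∈ S0 ∨ p i ∈ S1 ∨ p i ∈ A) ∧ p i ∉ T := by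
    intro i
    have x0 := m0 ⟨0, by omega⟩
    have x1 := m1 ⟨0, by omega⟩
    simp only [p]
    split_ifs with c1 c2
    · refine ⟨Or.inl (m0 _), fun hh => ?_⟩
      exact (ne3 (hTS _ hh _ (m0 ⟨i, c1⟩) _ x1)).1 rfl
    · refine ⟨Or.inr (Or.inl (m1 _)), fun hh => ?_⟩
      exact (ne3 (hTS _ hh _ x0 _ (m1 ⟨i - s, by omega⟩))).2.1 rfl
    · exact ⟨Or.inr (Or.inr (mA1 _).1), (mA1 _).2.2.2⟩
  have hdisj : ∀ x ∈ S0, x ∉ S1 := by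
    intro x hx hx'
    exact (ne3 (hTS _ (mT ⟨0, by omega⟩) _ hx _ hx')).2.2 rfl
  have hpi : Function.Injective p := by
    intro i j hij
    simp only [p] at hij
    split_ifs at hij with c1 c2 c3 c4 c5 c6 c7 c8
    · have := i0 hij
      simp only [Fin.mk.injEq] at this
      exact Fin.ext this
    · exact absurd (m1 _) (hij ▸ hdisj _ (m0 ⟨i, c1⟩))
    · exact absurd (m0 _) (hij ▸ (mA1 _).2.1)
    · exact absurd (m1 _) (hij.symm ▸ hdisj _ (m0 ⟨j, by assumption⟩))
    · have := i1 hij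
      simp only [Fin.mk.injEq] at this
      exact Fin.ext (by omega)
    · exact absurd (m1 _) (hij ▸ (mA1 _).2.2.1)
    · exact absurd (m0 _) (hij ▸ (mA1 _).2.1)
    · exact absurd (m1 _) (hij ▸ (mA1 _).2.2.1)
    · have := iA hij
      simp only [Fin.mk.injEq] at this
      exact Fin.ext (by omega)
  have hpqr : ∀ i j k, ({p i, fQ j, fR k} : Finset V) ∈ H := by
    intro i j k
    rcases (hp i).1 with h | h | h
    · exact h0 _ h _ (mQ1 j).1 _ (mR1 k).1
    · exact h1 _ h _ (mQ1 j).1 _ (mR1 k).1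
    · exact h2 _ h _ (mQ1 j).1 _ (mR1 k).1
  let g : Fin (3 * m) → V := fun v =>
    if v.1 % 3 = 0 then p ⟨v / 3, by omega⟩
    else if v.1 % 3 = 1 then fQ ⟨v / 3, by omega⟩ else fR ⟨v / 3, by omega⟩
  have hgi : Function.Injective g := by
    intro u v huv
    have n1 := fun i j => (ne3 (hpqr i j ⟨u / 3, by omega⟩)).1
    have n2 := fun i k => (ne3 (hpqr i ⟨u / 3, by omega⟩ k)).2.1
    have n3 := fun j k => (ne3 (hpqr ⟨u / 3, by omega⟩ j k)).2.2
    simp only [g] at huv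
    split_ifs at huv with c1 c2 c3 c4 c5 c6 c7 c8
    · have := hpi huv
      simp only [Fin.mk.injEq] at this
      exact Fin.ext (by omega)
    · exact absurd huv (n1 _ _)
    · exact absurd huv (n2 _ _)
    · exact absurd huv.symm (n1 _ _)
    · have := iQ huv
      simp only [Fin.mk.injEq] at this
      exact Fin.ext (by omega)
    · exact absurd huv (n3 _ _)
    · exact absurd huv.symm (n2 _ _)
    · exact absurd huv.symm (n3 _ _)
    · have := iR huv
      simp only [Fin.mk.injEq] at this
      exact Fin.ext (by omega)
  have hgT : ∀ v, g v ∉ T := by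
    intro v
    simp only [g]
    split_ifs
    exacts [(hp _).2, (mQ1 _).2, (mR1 _).2]
  have hinj : Function.Injective (Sum.elim g fT) := by
    rintro (u | u) (v | v) huv
    · exact congrArg _ (hgi huv)
    · exact absurd (mT v) (by simp only [Sum.elim_inl, Sum.elim_inr] at huv; exact huv ▸ hgT u)
    · exact absurd (mT u) (by simp only [Sum.elim_inl, Sum.elim_inr] at huv; exact huv ▸ hgT v)
    · exact congrArg _ (iT huv)
  have hinj' : ∀ x, (⟨Sum.elim g fT, hinj⟩ : Fin (3 * m) ⊕ Fin t ↪ V) x = Sum.elim g fT x :=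
    fun _ => rfl
  refine ⟨⟨Sum.elim g fT, hinj⟩, ?_⟩
  · intro e he
    simp only [F5Stss, mem_union, mem_image, mem_biUnion, mem_univ, true_and, mem_product] at he
    rcases he with ⟨e', he', rfl⟩ | ⟨j, ⟨x, y⟩, ⟨hx, hy⟩, rfl⟩
    · obtain ⟨i, j, k, rfl⟩ := exists_eq_of_mem_T3 he'
      have := hpqr i j k
      have a1 : g ⟨3 * i, by omega⟩ = p i := by simp [g]
      have a2 : g ⟨3 * j + 1, by omega⟩ = fQ j := by
        have : (3 * (j : ℕ) + 1) / 3 = j := by omega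
        simp [g, Nat.add_mod, this]
      have a3 : g ⟨3 * k + 2, by omega⟩ = fR k := by
        have : (3 * (k : ℕ) + 2) / 3 = k := by omega
        simp [g, Nat.add_mod, this]
      simpa [image_insert, hinj', a1, a2, a3] using this
    · simp only [S0set, S1set, mem_image, mem_univ, true_and] at hx hy
      obtain ⟨a, rfl⟩ := hx
      obtain ⟨b, rfl⟩ := hy
      have ha := a.2
      have hb := b.2
      have a1 : g ⟨3 * a, by omega⟩ = f0 a := by simp [g, p]
      have a2 : g ⟨3 * (s + b), by omega⟩ = f1 b := by
        have : s + (b : ℕ) < 2 * s := by omega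
        simp [g, p, this]
      have := hTS _ (mT j) _ (m0 a) _ (m1 b)
      simpa [image_insert, hinj', a1, a2] using this

/-- One step of the Erdős box argument: a dense bipartite relation contains an `N`-set of left
vertices with a positive proportion of common right neighbours. -/
theorem exists_common_neighbors (N : ℕ) {δ : ℝ} (hδ : 0 < δ) :
    ∃ δ' : ℝ, 0 < δ' ∧ ∃ k0 : ℕ, ∀ {α β : Type} [DecidableEq α] [DecidableEq β] [Fintype β]
      (A : Finset α) (R : Finset (α × β)), (∀ p ∈ R, p.1 ∈ A) → k0 ≤ A.card →
      δ * A.card * Fintype.card β ≤ R.card →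
      ∃ T : Finset α, T.card = N ∧ ∃ R' : Finset β, δ' * Fintype.card β ≤ R'.card ∧
        ∀ a ∈ T, ∀ b ∈ R', (a, b) ∈ R := by
  refine ⟨(δ / 2) * (δ / 4) ^ N, by positivity, max N (⌈4 * N / δ⌉₊ + 1), ?_⟩
  intro α β _ _ _ A R hRA hA hR
  have hAN : N ≤ A.card := le_trans (le_max_left _ _) hA
  have hA4 : 4 * N / δ ≤ A.card := by
    have h1 : ⌈4 * N / δ⌉₊ ≤ A.card := by
      have := le_trans (le_max_right _ _) hA
      omega
    exact (Nat.le_ceil _).trans (by exact_mod_cast h1)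
  have hApos : (0 : ℝ) < A.card := by
    have : 1 ≤ A.card := by
      have := le_trans (le_max_right _ _) hA
      omega
    exact_mod_cast this
  have hN4 : (N : ℝ) ≤ δ / 4 * A.card := by
    rw [div_le_iff₀ hδ] at hA4
    linarith
  let nb : β → Finset α := fun b => A.filter (fun a => (a, b) ∈ R)
  let good : Finset β := univ.filter (fun b => δ / 2 * A.card ≤ ((nb b).card : ℝ))
  have hRsum : (R.card : ℝ) = ∑ b, ((nb b).card : ℝ) := by
    have h1 : R.card = ∑ b, (R.filter (fun p => p.2 = b)).card :=
      card_eq_sum_card_fiberwise (fun _ _ => mem_univ _)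
    rw [h1]
    push_cast
    refine sum_congr rfl fun b _ => ?_
    congr 1
    refine card_bij (fun p _ => p.1) ?_ ?_ ?_
    · rintro ⟨a, b'⟩ h
      simp only [mem_filter] at h
      obtain ⟨h, rfl⟩ := h
      simp only [nb, mem_filter]
      exact ⟨hRA _ h, h⟩
    · rintro ⟨a, b1⟩ h1 ⟨a', b2⟩ h2 h
      simp only [mem_filter] at h1 h2
      simp_all
    · intro a ha
      simp only [nb, mem_filter] at ha
      exact ⟨(a, b), by simp [ha.2], rfl⟩
  have hgood : δ / 2 * Fintype.card β ≤ (good.card : ℝ) := by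
    have h1 : ∑ b, ((nb b).card : ℝ) ≤
        ∑ b : β, ((if b ∈ good then (A.card : ℝ) else 0) + δ / 2 * A.card) := by
      refine sum_le_sum fun b _ => ?_
      by_cases hb : b ∈ good
      · have : ((nb b).card : ℝ) ≤ A.card := by exact_mod_cast card_filter_le _ _
        simp only [hb, if_true]
        have : 0 ≤ δ / 2 * (A.card : ℝ) := by positivity
        linarith
      · simp only [hb, if_false, zero_add]
        simp only [good, mem_filter, mem_univ, true_and, not_le] at hb
        exact hb.le
    rw [sum_add_distrib, sum_ite_mem, univ_inter, sum_const, sum_const, card_univ] at h1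
    simp only [nsmul_eq_mul] at h1
    rw [← hRsum] at h1
    have h2 : (δ / 2 * Fintype.card β) * A.card ≤ good.card * (A.card : ℝ) := by nlinarith
    exact le_of_mul_le_mul_right h2 hApos
  have hchoose : ∀ b ∈ good, (δ / 4) ^ N * (A.card.choose N : ℝ) ≤ ((nb b).card.choose N : ℝ) := by
    intro b hb
    simp only [good, mem_filter, mem_univ, true_and] at hb
    have h1 : (A.card.choose N : ℝ) ≤ (A.card : ℝ) ^ N / (N.factorial : ℝ) :=
      Nat.choose_le_pow_div N A.card
    have h2 : ((((nb b).card + 1 - N : ℕ) : ℝ) ^ N) / (N.factorial : ℝ) ≤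
      ((nb b).card.choose N : ℝ) := Nat.pow_le_choose N (nb b).card
    refine le_trans ?_ h2
    refine le_trans (mul_le_mul_of_nonneg_left h1 (by positivity)) ?_
    rw [← mul_div_assoc, ← mul_pow]
    gcongr
    have h3 : ((nb b).card : ℝ) + 1 ≤ (((nb b).card + 1 - N : ℕ) : ℝ) + N := by
      have : (nb b).card + 1 ≤ ((nb b).card + 1 - N) + N := by omega
      exact_mod_cast this
    linarith
  let com : Finset α → Finset β := fun T => univ.filter (fun b => T ⊆ nb b)
  have hdc : ∑ T ∈ A.powersetCard N, ((com T).card : ℝ) =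
      ∑ b, ((nb b).card.choose N : ℝ) := by
    have h1 : ∀ T, ((com T).card : ℝ) = ∑ b : β, if T ⊆ nb b then (1 : ℝ) else 0 := by
      intro T
      simp [com]
    simp_rw [h1]
    rw [sum_comm]
    refine sum_congr rfl fun b _ => ?_
    rw [sum_boole, ← card_powersetCard]
    congr 2
    ext T
    simp only [mem_filter, mem_powersetCard]
    constructor
    · rintro ⟨⟨_, h⟩, h'⟩
      exact ⟨h', h⟩
    · rintro ⟨h, h'⟩
      exact ⟨⟨h.trans (filter_subset _ _), h'⟩, h⟩
  have hlow : ∑ T ∈ A.powersetCard N, ((δ / 2) * (δ / 4) ^ N * Fintype.card β) ≤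
      ∑ T ∈ A.powersetCard N, ((com T).card : ℝ) := by
    rw [hdc, sum_const, card_powersetCard, nsmul_eq_mul]
    calc (A.card.choose N : ℝ) * ((δ / 2) * (δ / 4) ^ N * Fintype.card β)
        = (δ / 2 * Fintype.card β) * ((δ / 4) ^ N * (A.card.choose N : ℝ)) := by ring
      _ ≤ good.card * ((δ / 4) ^ N * (A.card.choose N : ℝ)) := by gcongr
      _ = ∑ b ∈ good, ((δ / 4) ^ N * (A.card.choose N : ℝ)) := by simp
      _ ≤ ∑ b ∈ good, ((nb b).card.choose N : ℝ) := sum_le_sum hchoose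
      _ ≤ ∑ b, ((nb b).card.choose N : ℝ) :=
        sum_le_sum_of_subset_of_nonneg (subset_univ _) (fun _ _ _ => by positivity)
  obtain ⟨T, hT, hT'⟩ := exists_le_of_sum_le (powersetCard_nonempty.2 hAN) hlow
  refine ⟨T, (mem_powersetCard.1 hT).2, com T, hT', ?_⟩
  intro a ha b hb
  simp only [com, mem_filter, mem_univ, true_and] at hb
  have := hb ha
  simp only [nb, mem_filter] at this
  exact this.2

theorem exists_box_two (N : ℕ) {δ : ℝ} (hδ : 0 < δ) :
    ∃ k0 : ℕ, ∀ {V : Type} [DecidableEq V] [Fintype V] (R : Finset (V × V)),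
      k0 ≤ Fintype.card V → δ * (Fintype.card V : ℝ) ^ 2 ≤ R.card →
      ∃ T1 T2 : Finset V, T1.card = N ∧ T2.card = N ∧
        ∀ a ∈ T1, ∀ b ∈ T2, (a, b) ∈ R := by
  obtain ⟨δ', hδ', k1, h1⟩ := exists_common_neighbors N hδ
  refine ⟨max k1 ⌈N / δ'⌉₊, ?_⟩
  intro V _ _ R hk hR
  obtain ⟨T, hT, R', hR', h⟩ := h1 (univ : Finset V) R (fun _ _ => mem_univ _)
    (le_trans (le_max_left _ _) hk) (by rw [card_univ]; linarith)
  have hN : N ≤ R'.card := by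
    have h2 : (N : ℝ) / δ' ≤ Fintype.card V :=
      (Nat.le_ceil _).trans (by exact_mod_cast le_trans (le_max_right _ _) hk)
    rw [div_le_iff₀ hδ'] at h2
    have : (N : ℝ) ≤ R'.card := by linarith
    exact_mod_cast this
  obtain ⟨T2, hT2, hc⟩ := exists_subset_card_eq hN
  exact ⟨T, T2, hT, hc, fun a ha b hb => h a ha b (hT2 hb)⟩

theorem exists_box_three (N : ℕ) {δ : ℝ} (hδ : 0 < δ) :
    ∃ k0 : ℕ, ∀ {V : Type} [DecidableEq V] [Fintype V] (R : Finset (V × V × V)),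
      k0 ≤ Fintype.card V → δ * (Fintype.card V : ℝ) ^ 3 ≤ R.card →
      ∃ T1 T2 T3 : Finset V, T1.card = N ∧ T2.card = N ∧ T3.card = N ∧
        ∀ a ∈ T1, ∀ b ∈ T2, ∀ c ∈ T3, (a, b, c) ∈ R := by
  obtain ⟨δ', hδ', k1, h1⟩ := exists_common_neighbors N hδ
  obtain ⟨k2, h2⟩ := exists_box_two N hδ'
  refine ⟨max k1 k2, ?_⟩
  intro V _ _ R hk hR
  obtain ⟨T, hT, R', hR', h⟩ := h1 (univ : Finset V) R (fun _ _ => mem_univ _)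
    (le_trans (le_max_left _ _) hk)
    (by rw [card_univ, Fintype.card_prod]; push_cast; linarith)
  obtain ⟨T1, T2, hT1, hT2, h'⟩ := h2 R' (le_trans (le_max_right _ _) hk)
    (by rw [Fintype.card_prod] at hR'; push_cast at hR'; linarith)
  exact ⟨T, T1, T2, hT, hT1, hT2, fun a ha b hb c hc => h a ha _ (h' b hb c hc)⟩

theorem exists_box_four (N : ℕ) {δ : ℝ} (hδ : 0 < δ) :
    ∃ k0 : ℕ, ∀ {V : Type} [DecidableEq V] [Fintype V] (R : Finset (V × V × V × V)),
      k0 ≤ Fintype.card V → δ * (Fintype.card V : ℝ) ^ 4 ≤ R.card →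
      ∃ T1 T2 T3 T4 : Finset V, T1.card = N ∧ T2.card = N ∧ T3.card = N ∧ T4.card = N ∧
        ∀ a ∈ T1, ∀ b ∈ T2, ∀ c ∈ T3, ∀ d ∈ T4, (a, b, c, d) ∈ R := by
  obtain ⟨δ', hδ', k1, h1⟩ := exists_common_neighbors N hδ
  obtain ⟨k2, h2⟩ := exists_box_three N hδ'
  refine ⟨max k1 k2, ?_⟩
  intro V _ _ R hk hR
  obtain ⟨T, hT, R', hR', h⟩ := h1 (univ : Finset V) R (fun _ _ => mem_univ _)
    (le_trans (le_max_left _ _) hk)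
    (by rw [card_univ, Fintype.card_prod, Fintype.card_prod]; push_cast; linarith)
  obtain ⟨T1, T2, T3, hT1, hT2, hT3, h'⟩ := h2 R' (le_trans (le_max_right _ _) hk)
    (by rw [Fintype.card_prod, Fintype.card_prod] at hR'; push_cast at hR'; linarith)
  exact ⟨T, T1, T2, T3, hT, hT1, hT2, hT3,
    fun a ha b hb c hc d hd => h a ha _ (h' b hb c hc d hd)⟩

/-- A box in a dense relation on `W × V⁴`, with sides of size `M` in `W` and `N` in `V`. -/
theorem exists_box_five (M N : ℕ) {δ : ℝ} (hδ : 0 < δ) :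
    ∃ k0 : ℕ, ∀ {V : Type} [DecidableEq V] [Fintype V] (W : Finset V)
      (R : Finset (V × V × V × V × V)), (∀ p ∈ R, p.1 ∈ W) → k0 ≤ W.card →
      δ * W.card * (Fintype.card V : ℝ) ^ 4 ≤ R.card →
      ∃ T0 T1 T2 T3 T4 : Finset V, T0.card = M ∧
        T1.card = N ∧ T2.card = N ∧ T3.card = N ∧ T4.card = N ∧
        ∀ v ∈ T0, ∀ a ∈ T1, ∀ b ∈ T2, ∀ c ∈ T3, ∀ d ∈ T4, (v, a, b, c, d) ∈ R := by
  obtain ⟨δ', hδ', k1, h1⟩ := exists_common_neighbors M hδ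
  obtain ⟨k2, h2⟩ := exists_box_four N hδ'
  refine ⟨max k1 k2, ?_⟩
  intro V _ _ W R hW hk hR
  obtain ⟨T, hT, R', hR', h⟩ := h1 W R hW (le_trans (le_max_left _ _) hk)
    (by
      rw [Fintype.card_prod, Fintype.card_prod, Fintype.card_prod]
      push_cast
      convert hR using 1
      ring)
  obtain ⟨T1, T2, T3, T4, hT1, hT2, hT3, hT4, h'⟩ := h2 R'
    ((le_trans (le_max_right _ _) hk).trans (card_le_univ _))
    (by
      rw [Fintype.card_prod, Fintype.card_prod, Fintype.card_prod] at hR'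
      push_cast at hR'
      convert hR' using 1
      ring)
  exact ⟨T, T1, T2, T3, T4, hT, hT1, hT2, hT3, hT4,
    fun v hv a ha b hb c hc d hd => h v hv _ (h' a ha b hb c hc d hd)⟩

theorem triple_rotate {V : Type*} [DecidableEq V] (a b c : V) :
    ({a, b, c} : Finset V) = {b, c, a} := by
  ext; simp only [mem_insert, mem_singleton]; tauto

theorem triple_swap {V : Type*} [DecidableEq V] (a b c : V) :
    ({a, b, c} : Finset V) = {a, c, b} := by
  rw [pair_comm]

/-- A 3-graph without `F_5^S(m,t,K_{s,s})` has few homomorphic copies of `F_5`. -/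
theorem card_homs_F5_lt {m t s : ℕ} (ht : 1 ≤ t) (hs : 2 ≤ s) (hm : 2 * s ≤ m)
    {δ : ℝ} (hδ : 0 < δ) :
    ∃ n0 : ℕ, ∀ {V : Type} [DecidableEq V] [Fintype V] (H : Finset (Finset V)),
      (∀ e ∈ H, e.card = 3) → ¬ HasCopy H (F5Stss m t s hm) → n0 ≤ Fintype.card V →
      (((univ : Finset (V × V × V × V × V)).filter (fun p =>
        ({p.1, p.2.1, p.2.2.1} : Finset V) ∈ H ∧ ({p.1, p.2.1, p.2.2.2.1} : Finset V) ∈ H ∧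
        ({p.2.2.1, p.2.2.2.1, p.2.2.2.2} : Finset V) ∈ H)).card : ℝ) <
          δ * (Fintype.card V : ℝ) ^ 5 := by
  obtain ⟨k0, hk⟩ := exists_box_five (2 * m + t) (2 * m + t) hδ
  refine ⟨k0, ?_⟩
  intro V _ _ H h3 hF hn
  by_contra hcon
  push Not at hcon
  obtain ⟨Q, R, U, U', Y, hQ, hR, hU, hU', hY, hall⟩ := hk (univ : Finset V) _
    (fun _ _ => mem_univ _) hn (by rw [card_univ]; exact (le_of_eq (by ring)).trans hcon)
  obtain ⟨S0, hS0, cS0⟩ := exists_subset_card_eq (show s ≤ U.card by omega)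
  obtain ⟨S1, hS1, cS1⟩ := exists_subset_card_eq (show s ≤ U'.card by omega)
  obtain ⟨T, hT, cT⟩ := exists_subset_card_eq (show t ≤ Y.card by omega)
  obtain ⟨q0, hq0⟩ : Q.Nonempty := card_pos.1 (by omega)
  obtain ⟨r0, hr0⟩ : R.Nonempty := card_pos.1 (by omega)
  obtain ⟨u0, hu0⟩ : U.Nonempty := card_pos.1 (by omega)
  obtain ⟨u1, hu1⟩ : U'.Nonempty := card_pos.1 (by omega)
  obtain ⟨y0, hy0⟩ : Y.Nonempty := card_pos.1 (by omega)
  simp only [mem_filter, mem_univ, true_and] at hall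
  refine hF (hasCopy_F5Stss h3 ht hs hm cS0 cS1 cT hU.ge hQ.ge hR.ge ?_ ?_ ?_ ?_)
  · intro x hx q hq r hr
    rw [triple_rotate]
    exact (hall q hq r hr x (hS0 hx) u1 hu1 y0 hy0).1
  · intro x hx q hq r hr
    rw [triple_rotate]
    exact (hall q hq r hr u0 hu0 x (hS1 hx) y0 hy0).2.1
  · intro x hx q hq r hr
    rw [triple_rotate]
    exact (hall q hq r hr x hx u1 hu1 y0 hy0).1
  · intro τ hτ x hx y hy
    rw [triple_rotate]
    exact (hall q0 hq0 r0 hr0 x (hS0 hx) y (hS1 hy) τ (hT hτ)).2.2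

/-- The homomorphic copies of `F_5` in which `v` plays the role of `f_5`. -/
def homsApex {V : Type*} [DecidableEq V] [Fintype V] (H : Finset (Finset V)) (v : V) :
    Finset (V × V × V × V) :=
  univ.filter (fun p => ({v, p.1, p.2.1} : Finset V) ∈ H ∧
    ({p.1, p.2.2.1, p.2.2.2} : Finset V) ∈ H ∧ ({p.2.1, p.2.2.1, p.2.2.2} : Finset V) ∈ H)

/-- The homomorphic copies of `F_5` in which `v` plays the role of `f_3`. -/
def homsBase {V : Type*} [DecidableEq V] [Fintype V] (H : Finset (Finset V)) (v : V) :
    Finset (V × V × V × V) :=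
  univ.filter (fun p => ({v, p.1, p.2.1} : Finset V) ∈ H ∧
    ({v, p.2.2.1, p.2.2.2} : Finset V) ∈ H ∧ ({p.1, p.2.1, p.2.2.1} : Finset V) ∈ H)

theorem exists_box_of_forall_dense (M N : ℕ) {δ : ℝ} (hδ : 0 < δ) :
    ∃ K0 : ℕ, ∀ {V : Type} [DecidableEq V] [Fintype V] (R : V → Finset (V × V × V × V)),
      K0 ≤ (univ.filter (fun v => δ * (Fintype.card V : ℝ) ^ 4 ≤ (R v).card)).card →
      ∃ T0 T1 T2 T3 T4 : Finset V, T0.card = M ∧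
        T1.card = N ∧ T2.card = N ∧ T3.card = N ∧ T4.card = N ∧
        ∀ v ∈ T0, ∀ a ∈ T1, ∀ b ∈ T2, ∀ c ∈ T3, ∀ d ∈ T4, (a, b, c, d) ∈ R v := by
  obtain ⟨k0, hk⟩ := exists_box_five M N hδ
  refine ⟨k0, ?_⟩
  intro V _ _ R hK
  set W := univ.filter (fun v => δ * (Fintype.card V : ℝ) ^ 4 ≤ (R v).card) with hW
  have hRc : ((W.sigma R).card : ℝ) = ∑ v ∈ W, ((R v).card : ℝ) := by
    rw [card_sigma]; push_cast; rfl
  let φ : (Σ _ : V, V × V × V × V) ↪ V × V × V × V × V :=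
    ⟨fun p => (p.1, p.2), by rintro ⟨a, b⟩ ⟨c, d⟩ h; simp_all⟩
  obtain ⟨T0, T1, T2, T3, T4, c0, c1, c2, c3, c4, hall⟩ := hk W ((W.sigma R).map φ) (by
      intro p hp
      rw [mem_map] at hp
      obtain ⟨q, hq, rfl⟩ := hp
      exact (mem_sigma.1 hq).1) hK (by
      rw [card_map, hRc]
      calc δ * W.card * (Fintype.card V : ℝ) ^ 4
          = ∑ v ∈ W, δ * (Fintype.card V : ℝ) ^ 4 := by
            rw [sum_const, nsmul_eq_mul]; ring
        _ ≤ _ := sum_le_sum fun v hv => by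
            rw [hW, mem_filter] at hv
            exact hv.2)
  refine ⟨T0, T1, T2, T3, T4, c0, c1, c2, c3, c4, ?_⟩
  intro v hv a ha b hb c hc d hd
  have := hall v hv a ha b hb c hc d hd
  rw [mem_map] at this
  obtain ⟨⟨q1, q2⟩, hq, h⟩ := this
  cases h
  exact (mem_sigma.1 hq).2

/-- Few vertices are the apex of many copies of `F_5`. -/
theorem card_homsApex_lt {m t s : ℕ} (ht : 1 ≤ t) (hs : 2 ≤ s) (hm : 2 * s ≤ m)
    {δ : ℝ} (hδ : 0 < δ) :
    ∃ K0 : ℕ, ∀ {V : Type} [DecidableEq V] [Fintype V] (H : Finset (Finset V)),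
      (∀ e ∈ H, e.card = 3) → ¬ HasCopy H (F5Stss m t s hm) →
      (univ.filter (fun v => δ * (Fintype.card V : ℝ) ^ 4 ≤ (homsApex H v).card)).card < K0 := by
  obtain ⟨k0, hk⟩ := exists_box_of_forall_dense t (2 * m + t) hδ
  refine ⟨k0, ?_⟩
  intro V _ _ H h3 hF
  by_contra hcon
  push Not at hcon
  obtain ⟨T, U, U', Q, R, hT, hU, hU', hQ, hR, hall⟩ := hk (homsApex H) hcon
  obtain ⟨S0, hS0, cS0⟩ := exists_subset_card_eq (show s ≤ U.card by omega)
  obtain ⟨S1, hS1, cS1⟩ := exists_subset_card_eq (show s ≤ U'.card by omega)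
  obtain ⟨τ0, hτ0⟩ : T.Nonempty := card_pos.1 (by omega)
  obtain ⟨q0, hq0⟩ : Q.Nonempty := card_pos.1 (by omega)
  obtain ⟨r0, hr0⟩ : R.Nonempty := card_pos.1 (by omega)
  obtain ⟨u0, hu0⟩ : U.Nonempty := card_pos.1 (by omega)
  obtain ⟨u1, hu1⟩ : U'.Nonempty := card_pos.1 (by omega)
  simp only [homsApex, mem_filter, mem_univ, true_and] at hall
  refine hF (hasCopy_F5Stss h3 ht hs hm cS0 cS1 hT hU.ge hQ.ge hR.ge ?_ ?_ ?_ ?_)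
  · exact fun x hx q hq r hr => (hall τ0 hτ0 x (hS0 hx) u1 hu1 q hq r hr).2.1
  · exact fun x hx q hq r hr => (hall τ0 hτ0 u0 hu0 x (hS1 hx) q hq r hr).2.2
  · exact fun x hx q hq r hr => (hall τ0 hτ0 x hx u1 hu1 q hq r hr).2.1
  · exact fun τ hτ x hx y hy => (hall τ hτ x (hS0 hx) y (hS1 hy) q0 hq0 r0 hr0).1

/-- Few vertices are a base vertex of many copies of `F_5`. -/
theorem card_homsBase_lt {m t s : ℕ} (ht : 1 ≤ t) (hs : 2 ≤ s) (hm : 2 * s ≤ m)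
    {δ : ℝ} (hδ : 0 < δ) :
    ∃ K0 : ℕ, ∀ {V : Type} [DecidableEq V] [Fintype V] (H : Finset (Finset V)),
      (∀ e ∈ H, e.card = 3) → ¬ HasCopy H (F5Stss m t s hm) →
      (univ.filter (fun v => δ * (Fintype.card V : ℝ) ^ 4 ≤ (homsBase H v).card)).card < K0 := by
  obtain ⟨k0, hk⟩ := exists_box_of_forall_dense s (2 * m + t) hδ
  refine ⟨k0, ?_⟩
  intro V _ _ H h3 hF
  by_contra hcon
  push Not at hcon
  obtain ⟨S0, Q, R, U, Y, cS0, hQ, hR, hU, hY, hall⟩ := hk (homsBase H) hcon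
  obtain ⟨S1, hS1, cS1⟩ := exists_subset_card_eq (show s ≤ U.card by omega)
  obtain ⟨T, hT, cT⟩ := exists_subset_card_eq (show t ≤ Y.card by omega)
  obtain ⟨x0, hx0⟩ : S0.Nonempty := card_pos.1 (by omega)
  obtain ⟨q0, hq0⟩ : Q.Nonempty := card_pos.1 (by omega)
  obtain ⟨r0, hr0⟩ : R.Nonempty := card_pos.1 (by omega)
  obtain ⟨u0, hu0⟩ : U.Nonempty := card_pos.1 (by omega)
  obtain ⟨y0, hy0⟩ : Y.Nonempty := card_pos.1 (by omega)
  simp only [homsBase, mem_filter, mem_univ, true_and] at hall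
  have hA : ∀ x ∈ U, ∀ q ∈ Q, ∀ r ∈ R, ({x, q, r} : Finset V) ∈ H := by
    intro x hx q hq r hr
    rw [triple_rotate]
    exact (hall x0 hx0 q hq r hr x hx y0 hy0).2.2
  refine hF (hasCopy_F5Stss h3 ht hs hm cS0 cS1 cT hU.ge hQ.ge hR.ge ?_ ?_ hA ?_)
  · exact fun x hx q hq r hr => (hall x hx q hq r hr u0 hu0 y0 hy0).1
  · exact fun x hx q hq r hr => hA x (hS1 hx) q hq r hr
  · intro τ hτ x hx y hy
    rw [triple_rotate]
    exact (hall x hx q0 hq0 r0 hr0 y (hS1 hy) τ (hT hτ)).2.1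

/-- The sides `S_0`, `S_1` of a `K_{t,s,s}` do not have a dense common transversal link. -/
theorem card_common_link_lt {m t s : ℕ} (ht : 1 ≤ t) (hs : 2 ≤ s) (hm : 2 * s ≤ m)
    {δ : ℝ} (hδ : 0 < δ) :
    ∃ n0 : ℕ, ∀ {V : Type} [DecidableEq V] [Fintype V] (H : Finset (Finset V)),
      (∀ e ∈ H, e.card = 3) → ¬ HasCopy H (F5Stss m t s hm) → n0 ≤ Fintype.card V →
      ∀ T S0 S1 : Finset V, T.card = t → S0.card = s → S1.card = s →
      (∀ τ ∈ T, ∀ x ∈ S0, ∀ y ∈ S1, ({τ, x, y} : Finset V) ∈ H) →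
      (((univ : Finset (V × V × V)).filter (fun p =>
        ({p.1, p.2.1, p.2.2} : Finset V) ∈ H ∧
        ∀ x ∈ S0 ∪ S1, ({x, p.2.1, p.2.2} : Finset V) ∈ H)).card : ℝ) <
          δ * (Fintype.card V : ℝ) ^ 3 := by
  obtain ⟨k0, hk⟩ := exists_box_three (2 * m + t) hδ
  refine ⟨k0, ?_⟩
  intro V _ _ H h3 hF hn T S0 S1 cT cS0 cS1 hTS
  by_contra hcon
  push Not at hcon
  obtain ⟨A, Q, R, hA, hQ, hR, hall⟩ := hk _ hn hcon
  obtain ⟨a0, ha0⟩ : A.Nonempty := card_pos.1 (by omega)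
  simp only [mem_filter, mem_univ, true_and] at hall
  refine hF (hasCopy_F5Stss h3 ht hs hm cS0 cS1 cT hA.ge hQ.ge hR.ge ?_ ?_ ?_ hTS)
  · exact fun x hx q hq r hr => (hall a0 ha0 q hq r hr).2 x (mem_union_left _ hx)
  · exact fun x hx q hq r hr => (hall a0 ha0 q hq r hr).2 x (mem_union_right _ hx)
  · exact fun x hx q hq r hr => (hall x hx q hq r hr).1

theorem pow_sum_le_card_pow_mul {ι : Type*} (S : Finset ι) (f : ι → ℝ) (hf : ∀ i ∈ S, 0 ≤ f i)
    (k : ℕ) : (∑ i ∈ S, f i) ^ (k + 1) ≤ (S.card : ℝ) ^ k * ∑ i ∈ S, f i ^ (k + 1) := by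
  rcases S.eq_empty_or_nonempty with rfl | hS
  · simp
  · have hc : (0 : ℝ) < (S.card : ℝ) ^ k := by
      have : (0 : ℝ) < S.card := by exact_mod_cast hS.card_pos
      positivity
    rw [← div_le_iff₀' hc]
    exact pow_sum_div_card_le_sum_pow hf k

theorem card_not_injective_le {V : Type*} [DecidableEq V] [Fintype V] (k : ℕ) :
    ((univ : Finset (Fin (k + 1) → V)).filter (fun g => ¬ Function.Injective g)).card ≤
      (k + 1) ^ 2 * Fintype.card V ^ k := by
  have hsub : (univ : Finset (Fin (k + 1) → V)).filter (fun g => ¬ Function.Injective g) ⊆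
      (univ : Finset (Fin (k + 1) × Fin (k + 1))).biUnion
        (fun p => univ.filter (fun g => p.1 ≠ p.2 ∧ g p.1 = g p.2)) := by
    intro g hg
    have hg' := (mem_filter.1 hg).2
    unfold Function.Injective at hg'
    push Not at hg'
    obtain ⟨i, j, hij, hne⟩ := hg'
    simp only [mem_biUnion, mem_univ, true_and, mem_filter]
    exact ⟨(i, j), hne, hij⟩
  refine (card_le_card hsub).trans (card_biUnion_le.trans ?_)
  have : ∀ p ∈ (univ : Finset (Fin (k + 1) × Fin (k + 1))),
      (univ.filter (fun g : Fin (k + 1) → V => p.1 ≠ p.2 ∧ g p.1 = g p.2)).card ≤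
        Fintype.card V ^ k := by
    rintro ⟨i, j⟩ -
    have h1 : (univ : Finset ({l : Fin (k + 1) // l ≠ j} → V)).card = Fintype.card V ^ k := by
      rw [card_univ, Fintype.card_fun]
      congr 1
      simp
    rw [← h1]
    apply card_le_card_of_injOn (fun g l => g l.1) (fun _ _ => mem_univ _)
    intro g hg g' hg' hgg
    replace hg := (mem_filter.1 (mem_coe.1 hg)).2
    replace hg' := (mem_filter.1 (mem_coe.1 hg')).2
    have hne : ∀ l, l ≠ j → g l = g' l := fun l hl => congrFun hgg ⟨l, hl⟩
    funext l
    by_cases hl : l = j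
    · subst hl
      rw [← hg.2, ← hg'.2]
      exact hne i hg.1
    · exact hne l hl
  refine (sum_le_sum this).trans ?_
  simp [sq]

/-- A Kővári–Sós–Turán type bound for tripartite relations. -/
theorem card_pow_le_of_no_box {V : Type*} [DecidableEq V] [Fintype V] (t k : ℕ)
    (R : Finset (V × V × V))
    (hR : ¬ ∃ T S0 S1 : Finset V, T.card = t ∧ S0.card = k + 1 ∧ S1.card = k + 1 ∧
      ∀ τ ∈ T, ∀ x ∈ S0, ∀ y ∈ S1, (τ, x, y) ∈ R) :
    (R.card : ℝ) ^ ((k + 1) ^ 2) ≤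
      (t + 2 * (k + 1) ^ 2) * (Fintype.card V : ℝ) ^ (3 * (k + 1) ^ 2 - 1) := by
  set n : ℝ := (Fintype.card V : ℝ) with hn
  have hn0 : 0 ≤ n := by positivity
  let r : V → V → V → ℝ := fun w x y => if (w, x, y) ∈ R then 1 else 0
  have hr0 : ∀ w x y, 0 ≤ r w x y := fun w x y => by simp only [r]; split_ifs <;> norm_num
  have hRc : (R.card : ℝ) = ∑ p : V × V, ∑ x, r p.1 x p.2 := by
    rw [Fintype.sum_prod_type]
    have : (R.card : ℝ) = ∑ p : V × V × V, if p ∈ R then (1 : ℝ) else 0 := by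
      rw [sum_boole]; simp
    rw [this, Fintype.sum_prod_type]
    refine sum_congr rfl fun w _ => ?_
    rw [Fintype.sum_prod_type, sum_comm]
  let c : V → (Fin (k + 1) → V) → ℝ := fun w g => ∑ y, ∏ i, r w (g i) y
  have hc0 : ∀ w g, 0 ≤ c w g := fun w g => sum_nonneg fun y _ => prod_nonneg fun i _ => hr0 _ _ _
  have h1 : (R.card : ℝ) ^ (k + 1) ≤ (n ^ 2) ^ k * ∑ p : V × (Fin (k + 1) → V), c p.1 p.2 := by
    rw [hRc]
    refine (pow_sum_le_card_pow_mul _ _ (fun p _ => sum_nonneg fun x _ => hr0 _ _ _) k).trans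
      (le_of_eq ?_)
    congr 1
    · rw [card_univ, Fintype.card_prod]; push_cast; rw [← hn]; ring
    · rw [Fintype.sum_prod_type, Fintype.sum_prod_type]
      refine sum_congr rfl fun w _ => ?_
      simp only [c]
      rw [sum_comm]
      exact sum_congr rfl fun y _ => Fintype.sum_pow _ _
  let cnt : (Fin (k + 1) → V) → (Fin (k + 1) → V) → ℝ := fun g g' =>
    ∑ w, ∏ j, ∏ i, r w (g i) (g' j)
  have h2 : (∑ p : V × (Fin (k + 1) → V), c p.1 p.2) ^ (k + 1) ≤
      (n ^ (k + 2)) ^ k * ∑ p : (Fin (k + 1) → V) × (Fin (k + 1) → V), cnt p.1 p.2 := by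
    refine (pow_sum_le_card_pow_mul _ _ (fun p _ => hc0 _ _) k).trans (le_of_eq ?_)
    congr 1
    · rw [card_univ, Fintype.card_prod, Fintype.card_fun, Fintype.card_fin]
      push_cast; rw [← hn]; ring
    · rw [Fintype.sum_prod_type, Fintype.sum_prod_type, sum_comm]
      refine sum_congr rfl fun g _ => ?_
      simp only [c, cnt]
      rw [sum_comm]
      exact sum_congr rfl fun w _ => Fintype.sum_pow _ _
  let ni : (Fin (k + 1) → V) → ℝ := fun g => if ¬ Function.Injective g then 1 else 0
  have hni : ∑ g, ni g ≤ (k + 1) ^ 2 * n ^ k := by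
    simp only [ni]
    rw [sum_boole, hn]
    exact_mod_cast card_not_injective_le (V := V) k
  have hni0 : ∀ g, 0 ≤ ni g := fun g => by simp only [ni]; split_ifs <;> norm_num
  have hcnt : ∀ g g', cnt g g' ≤ t + n * ni g + n * ni g' := by
    intro g g'
    have hle1 : ∀ w, ∏ j, ∏ i, r w (g i) (g' j) ≤ 1 := fun w =>
      prod_le_one (fun j _ => prod_nonneg fun i _ => hr0 _ _ _) fun j _ =>
        prod_le_one (fun i _ => hr0 _ _ _) fun i _ => by simp only [r]; split_ifs <;> norm_num
    have hcn : cnt g g' ≤ n := by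
      calc cnt g g' ≤ ∑ _w : V, (1 : ℝ) := sum_le_sum fun w _ => hle1 w
        _ = n := by simp [hn]
    have t0 : (0 : ℝ) ≤ t := by positivity
    by_cases hg : Function.Injective g
    · by_cases hg' : Function.Injective g'
      · have key : cnt g g' ≤ t := by
          have e1 : ∀ w, ∏ j, ∏ i, r w (g i) (g' j) ≤
              if ∀ i j, (w, g i, g' j) ∈ R then (1 : ℝ) else 0 := by
            intro w
            split_ifs with h
            · exact hle1 w
            · push Not at h
              obtain ⟨i, j, hij⟩ := h
              apply le_of_eq
              apply prod_eq_zero (mem_univ j)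
              apply prod_eq_zero (mem_univ i)
              simp [r, hij]
          refine (sum_le_sum fun w _ => e1 w).trans ?_
          rw [sum_boole]
          by_contra hcon
          push Not at hcon
          have hcon' : t ≤ (univ.filter (fun w => ∀ i j, (w, g i, g' j) ∈ R)).card := by
            exact_mod_cast hcon.le
          obtain ⟨T, hT, cT⟩ := exists_subset_card_eq hcon'
          refine hR ⟨T, univ.image g, univ.image g', cT, ?_, ?_, ?_⟩
          · rw [card_image_of_injective _ hg, card_univ, Fintype.card_fin]
          · rw [card_image_of_injective _ hg', card_univ, Fintype.card_fin]
          · intro τ hτ x hx y hy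
            obtain ⟨i, -, rfl⟩ := mem_image.1 hx
            obtain ⟨j, -, rfl⟩ := mem_image.1 hy
            exact (mem_filter.1 (hT hτ)).2 i j
        have := mul_nonneg hn0 (hni0 g)
        have := mul_nonneg hn0 (hni0 g')
        linarith
      · have := mul_nonneg hn0 (hni0 g)
        have e : ni g' = 1 := by simp [ni, hg']
        rw [e]; linarith
    · have := mul_nonneg hn0 (hni0 g')
      have e : ni g = 1 := by simp [ni, hg]
      rw [e]; linarith
  have h3 : ∑ p : (Fin (k + 1) → V) × (Fin (k + 1) → V), cnt p.1 p.2 ≤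
      (t + 2 * (k + 1) ^ 2) * n ^ (2 * (k + 1)) := by
    have cf : ∑ _g : Fin (k + 1) → V, (1 : ℝ) = n ^ (k + 1) := by simp [hn]
    calc ∑ p : (Fin (k + 1) → V) × (Fin (k + 1) → V), cnt p.1 p.2
        ≤ ∑ p : (Fin (k + 1) → V) × (Fin (k + 1) → V), (t * 1 + n * ni p.1 + n * ni p.2) :=
          sum_le_sum fun p _ => (hcnt p.1 p.2).trans (by rw [mul_one])
      _ = t * (n ^ (k + 1) * n ^ (k + 1)) + 2 * (n * n ^ (k + 1) * ∑ g, ni g) := by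
          rw [← cf, Fintype.sum_prod_type]
          simp only [sum_add_distrib, ← mul_sum, sum_const, nsmul_eq_mul, mul_one]
          ring
      _ ≤ t * (n ^ (k + 1) * n ^ (k + 1)) + 2 * (n * n ^ (k + 1) * ((k + 1) ^ 2 * n ^ k)) := by
          gcongr
      _ = _ := by ring
  have e0 : 3 * (k + 1) ^ 2 - 1 = 2 * k * (k + 1) + (k + 2) * k + 2 * (k + 1) := by
    have : 3 * (k + 1) ^ 2 = 2 * k * (k + 1) + (k + 2) * k + 2 * (k + 1) + 1 := by ring
    omega
  calc (R.card : ℝ) ^ ((k + 1) ^ 2) = ((R.card : ℝ) ^ (k + 1)) ^ (k + 1) := by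
        rw [← pow_mul, sq]
    _ ≤ ((n ^ 2) ^ k * ∑ p : V × (Fin (k + 1) → V), c p.1 p.2) ^ (k + 1) := by gcongr
    _ = ((n ^ 2) ^ k) ^ (k + 1) * (∑ p : V × (Fin (k + 1) → V), c p.1 p.2) ^ (k + 1) := mul_pow _ _ _
    _ ≤ ((n ^ 2) ^ k) ^ (k + 1) * ((n ^ (k + 2)) ^ k *
          ((t + 2 * (k + 1) ^ 2) * n ^ (2 * (k + 1)))) := by
        gcongr
        exact h2.trans (by gcongr)
    _ = _ := by rw [e0, pow_add, pow_add]; ring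

theorem exists_card_le_rpow_of_no_box (t : ℕ) {s : ℕ} (hs : 1 ≤ s) :
    ∃ C : ℝ, 0 < C ∧ ∀ {V : Type} [DecidableEq V] [Fintype V] (R : Finset (V × V × V)),
      (¬ ∃ T S0 S1 : Finset V, T.card = t ∧ S0.card = s ∧ S1.card = s ∧
        ∀ τ ∈ T, ∀ x ∈ S0, ∀ y ∈ S1, (τ, x, y) ∈ R) →
      (R.card : ℝ) ≤ C * (Fintype.card V : ℝ) ^ ((3 : ℝ) - 1 / (s : ℝ) ^ 2) := by
  obtain ⟨k, rfl⟩ : ∃ k, s = k + 1 := ⟨s - 1, by omega⟩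
  refine ⟨((t : ℝ) + 2 * (k + 1) ^ 2) ^ ((((k + 1) ^ 2 : ℕ) : ℝ)⁻¹), by positivity, ?_⟩
  intro V _ _ R hR
  have h := card_pow_le_of_no_box t k R hR
  have hk : (k + 1) ^ 2 ≠ 0 := by positivity
  have hn : (0 : ℝ) ≤ Fintype.card V := by positivity
  calc (R.card : ℝ) = ((R.card : ℝ) ^ ((k + 1) ^ 2)) ^ ((((k + 1) ^ 2 : ℕ) : ℝ)⁻¹) :=
        (Real.pow_rpow_inv_natCast (by positivity) hk).symm
    _ ≤ (((t : ℝ) + 2 * (k + 1) ^ 2) * (Fintype.card V : ℝ) ^ (3 * (k + 1) ^ 2 - 1)) ^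
          ((((k + 1) ^ 2 : ℕ) : ℝ)⁻¹) := Real.rpow_le_rpow (by positivity) h (by positivity)
    _ = _ := by
        rw [Real.mul_rpow (by positivity) (by positivity), ← Real.rpow_natCast_mul hn]
        congr 2
        have : 1 ≤ 3 * (k + 1) ^ 2 := by nlinarith
        push_cast [Nat.cast_sub this]
        field_simp

theorem amgm_degree {n D P s : ℝ} (hn : 0 < n) (hP : 0 ≤ P) (hPn : P ≤ n)
    (hDP : D ^ 2 ≤ P * s) (hs : 0 ≤ s) :
    2 * n ^ 2 * D ≤ n * (D * P) + 2 * n * s + 4 * n ^ 4 / 27 := by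
  rcases hP.eq_or_lt with rfl | hP
  · have : D = 0 := by nlinarith [sq_nonneg D]
    subst this
    have := mul_nonneg hn.le hs
    have : 0 < n ^ 4 := by positivity
    nlinarith
  · have h1 : D ^ 2 / P ≤ s := by rw [div_le_iff₀' hP]; exact hDP
    have h2 : 2 * n ^ 2 * D ≤ n * (D * P) + 2 * n * (D ^ 2 / P) + 4 * n ^ 4 / 27 := by
      rw [← sub_nonneg]
      have e : n * (D * P) + 2 * n * (D ^ 2 / P) + 4 * n ^ 4 / 27 - 2 * n ^ 2 * D =
          2 * n * (D - P * (n - P / 2) / 2) ^ 2 / P +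
            n / 8 * (P - 2 * n / 3) ^ 2 * (8 * n / 3 - P) := by
        field_simp
        ring
      have : 0 ≤ 8 * n / 3 - P := by linarith
      rw [e]
      positivity
    nlinarith [mul_le_mul_of_nonneg_left h1 hn.le]

theorem sum_rotate {V : Type*} [Fintype V] (F : V → V → V → ℝ) :
    ∑ x, ∑ y, ∑ z, F x y z = ∑ y, ∑ z, ∑ x, F x y z := by
  rw [sum_comm]
  exact sum_congr rfl fun y _ => sum_comm

/-- If few quadruples `a b c d` satisfy `abc, abd` with `cd` covered and the density of `w` is
almost `2/9`, then the codegree of an average edge is almost `1/3`. -/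
theorem mul_sum_sub_sum_sq_le {V : Type*} [Fintype V]
    (w : V → V → V → ℝ) (p : V → V → ℝ)
    (w01 : ∀ x y z, w x y z = 0 ∨ w x y z = 1) (wsymm : ∀ x y z, w x y z = w y x z)
    (wswap : ∀ x y z, w x y z = w x z y)
    (p1 : ∀ x y, p x y ≤ 1) (hwp : ∀ x y z, w x y z ≤ p x y)
    {n : ℝ} (hn : n = Fintype.card V) (hn0 : 0 < n) {θ κ : ℝ}
    (hF : ∑ a, ∑ b, ∑ c, ∑ d, w a b c * w a b d * p c d ≤ θ * n ^ 4)
    (hW : (2 / 9 - κ) * n ^ 3 ≤ ∑ a, ∑ b, ∑ c, w a b c) :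
    n * (∑ a, ∑ b, ∑ c, w a b c) - 3 * ∑ a, ∑ b, (∑ c, w a b c) ^ 2 ≤
      (2 * κ + 3 * θ) * n ^ 4 := by
  have w0 : ∀ x y z, 0 ≤ w x y z := fun x y z => by
    rcases w01 x y z with h | h <;> norm_num [h]
  have w1 : ∀ x y z, w x y z ≤ 1 := fun x y z => by
    rcases w01 x y z with h | h <;> norm_num [h]
  have p0 : ∀ x y, 0 ≤ p x y := fun x y => (w0 x y x).trans (hwp x y x)
  have wrot : ∀ x y z, w x y z = w y z x := fun x y z => by rw [wsymm, wswap]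
  have hone : ∑ _x : V, (1 : ℝ) = n := by simp [hn]
  set F := ∑ a, ∑ b, ∑ c, ∑ d, w a b c * w a b d * p c d with hFdef
  set W := ∑ a, ∑ b, ∑ c, w a b c with hWdef
  set d : V → V → ℝ := fun x y => ∑ z, w x y z with hd
  have d0 : ∀ x y, 0 ≤ d x y := fun x y => sum_nonneg fun z _ => w0 x y z
  set S := ∑ a, ∑ b, d a b ^ 2 with hSdef
  set D : V → ℝ := fun c => ∑ a, ∑ b, w a b c with hD
  set P : V → ℝ := fun c => ∑ x, p c x with hP
  set Q := ∑ c, D c * P c with hQdef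
  have hS : S = ∑ a, ∑ b, ∑ c, ∑ e, w a b c * w a b e := by
    refine sum_congr rfl fun a _ => sum_congr rfl fun b _ => ?_
    rw [sq, hd, sum_mul_sum]
  have hWD : W = ∑ c, D c := by
    rw [hWdef, sum_rotate, sum_rotate]
  have hQ : Q = ∑ a, ∑ b, ∑ c, ∑ e, w a b c * p c e := by
    have : ∑ a, ∑ b, ∑ c, ∑ e, w a b c * p c e = ∑ a, ∑ b, ∑ c, w a b c * P c := by
      simp only [hP, mul_sum]
    rw [this, sum_rotate, sum_rotate]
    refine sum_congr rfl fun c _ => ?_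
    simp only [hD, sum_mul]
  have hnW : ∑ a, ∑ b, ∑ c, ∑ _e : V, w a b c = n * W := by
    have : ∀ a b c, ∑ _e : V, w a b c = n * w a b c := fun a b c => by
      rw [← hone, sum_mul]; simp
    simp only [this, ← mul_sum]
    rfl
  have hSQ : S + Q ≤ n * W + F := by
    rw [hS, hQ, ← hnW, hFdef]
    simp only [← sum_add_distrib]
    refine sum_le_sum fun a _ => sum_le_sum fun b _ => sum_le_sum fun c _ =>
      sum_le_sum fun e _ => ?_
    have : 0 ≤ w a b c * ((1 - w a b e) * (1 - p c e)) :=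
      mul_nonneg (w0 _ _ _) (mul_nonneg (sub_nonneg.2 (w1 _ _ _)) (sub_nonneg.2 (p1 _ _)))
    nlinarith
  have hc : ∀ c, 2 * n ^ 2 * D c ≤ n * (D c * P c) + 2 * n * (∑ a, d c a ^ 2) +
      4 * n ^ 4 / 27 := by
    intro c
    refine amgm_degree hn0 (sum_nonneg fun x _ => p0 c x) ?_ ?_
      (sum_nonneg fun x _ => sq_nonneg _)
    · rw [← hone]; exact sum_le_sum fun x _ => p1 c x
    · have e1 : D c = ∑ a, d c a := by
        refine sum_congr rfl fun a _ => sum_congr rfl fun b _ => ?_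
        rw [wrot c a b]
      have e2 : D c ≤ ∑ a, p c a * d c a := by
        rw [e1]
        refine sum_le_sum fun a _ => ?_
        rw [hd, mul_sum]
        refine sum_le_sum fun b _ => ?_
        rcases w01 c a b with h | h
        · rw [h]; simp
        · have := hwp c a b
          rw [h] at this ⊢
          linarith
      have hD0 : 0 ≤ D c := e1 ▸ sum_nonneg fun a _ => d0 c a
      calc D c ^ 2 ≤ (∑ a, p c a * d c a) ^ 2 := by gcongr
        _ ≤ (∑ a, p c a ^ 2) * ∑ a, d c a ^ 2 := sum_mul_sq_le_sq_mul_sq _ _ _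
        _ ≤ P c * ∑ a, d c a ^ 2 := by
          refine mul_le_mul_of_nonneg_right ?_ (sum_nonneg fun x _ => sq_nonneg _)
          refine sum_le_sum fun a _ => ?_
          nlinarith [p0 c a, p1 c a]
  have hsum : 2 * n ^ 2 * W ≤ n * Q + 2 * n * S + 4 * n ^ 5 / 27 := by
    rw [hWD, hQdef, hSdef, mul_sum, mul_sum, mul_sum]
    calc _ ≤ ∑ c, (n * (D c * P c) + 2 * n * (∑ a, d c a ^ 2) + 4 * n ^ 4 / 27) :=
          sum_le_sum fun c _ => hc c
      _ = _ := by
          rw [sum_add_distrib, sum_add_distrib, sum_const, card_univ, nsmul_eq_mul, ← hn]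
          ring
  have h1 : n * (n * W) ≤ n * (S + 4 * n ^ 4 / 27 + θ * n ^ 4) := by
    nlinarith [mul_le_mul_of_nonneg_left hSQ hn0.le, mul_le_mul_of_nonneg_left hF hn0.le]
  have h2 := le_of_mul_le_mul_left h1 hn0
  nlinarith [mul_le_mul_of_nonneg_left hW hn0.le]

theorem color_indicator_le {α β γ α' β' γ' ω π : ℝ} (hα : α = 0 ∨ α = 1) (hβ : β = 0 ∨ β = 1)
    (hγ : γ = 0 ∨ γ = 1) (hα' : α' = 0 ∨ α' = 1) (hβ' : β' = 0 ∨ β' = 1)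
    (hγ' : γ' = 0 ∨ γ' = 1) (h0 : 0 ≤ ω) (h1 : ω ≤ 1) (hπ : ω ≤ π) :
    ω * (if (if β = 1 then (0 : Fin 3) else if γ = 1 then 1 else 2) =
      (if β' = 1 then 0 else if γ' = 1 then 1 else 2) then 1 else 0) ≤
      α * α' * π + β * β' * π + γ * γ' * π +
        (1 - (α + β + γ) + α * β + β * γ + γ * α) +
        (1 - (α' + β' + γ') + α' * β' + β' * γ' + γ' * α') := by
  have c20 : ¬ (2 : Fin 3) = 0 := by decide
  have c21 : ¬ (2 : Fin 3) = 1 := by decide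
  have c02 : ¬ (0 : Fin 3) = 2 := by decide
  have c12 : ¬ (1 : Fin 3) = 2 := by decide
  rcases hα with rfl | rfl <;> rcases hβ with rfl | rfl <;> rcases hγ with rfl | rfl <;>
    rcases hα' with rfl | rfl <;> rcases hβ' with rfl | rfl <;> rcases hγ' with rfl | rfl <;>
    norm_num [c20, c21, c02, c12] <;> linarith

/-- Under the same hypotheses as `mul_sum_sub_sum_sq_le`, the links of an average edge define
a colouring with three colours with few edges `uvz` such that `u`, `v` have the same colour. -/
theorem exists_coloring_of_few_F5 {V : Type*} [Fintype V]
    (w : V → V → V → ℝ) (p : V → V → ℝ)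
    (w01 : ∀ x y z, w x y z = 0 ∨ w x y z = 1) (wsymm : ∀ x y z, w x y z = w y x z)
    (wswap : ∀ x y z, w x y z = w x z y)
    (p1 : ∀ x y, p x y ≤ 1) (hwp : ∀ x y z, w x y z ≤ p x y)
    {n : ℝ} (hn : n = Fintype.card V) (hn0 : 0 < n) {θ κ : ℝ} (hθ : 0 < θ) (hκ : 0 < κ)
    (hκ' : κ ≤ 1 / 9)
    (hF : ∑ a, ∑ b, ∑ c, ∑ d, w a b c * w a b d * p c d ≤ θ * n ^ 4)
    (hW : (2 / 9 - κ) * n ^ 3 ≤ ∑ a, ∑ b, ∑ c, w a b c) :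
    ∃ col : V → Fin 3, ∑ u, ∑ v, ∑ z, w u v z * (if col u = col v then 1 else 0) ≤
      20 * (2 * κ + 9 * θ) * n ^ 3 := by
  classical
  have w0 : ∀ x y z, 0 ≤ w x y z := fun x y z => by
    rcases w01 x y z with h | h <;> norm_num [h]
  have w1 : ∀ x y z, w x y z ≤ 1 := fun x y z => by
    rcases w01 x y z with h | h <;> norm_num [h]
  have p0 : ∀ x y, 0 ≤ p x y := fun x y => (w0 x y x).trans (hwp x y x)
  have wrot : ∀ x y z, w x y z = w y z x := fun x y z => by rw [wsymm, wswap]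
  have hone : ∑ _x : V, (1 : ℝ) = n := by simp [hn]
  have hlow := mul_sum_sub_sum_sq_le w p w01 wsymm wswap p1 hwp hn hn0 hF hW
  set F := ∑ a, ∑ b, ∑ c, ∑ d, w a b c * w a b d * p c d with hFdef
  set W := ∑ a, ∑ b, ∑ c, w a b c with hWdef
  set d : V → V → ℝ := fun x y => ∑ z, w x y z with hd
  set S := ∑ a, ∑ b, d a b ^ 2 with hSdef
  let I : V → V → ℝ := fun x y => ∑ u, ∑ v, w x y u * w x y v * p u v
  let N : V → V → V → V → ℝ := fun x y z v =>
    1 - (w x y v + w y z v + w x z v) + w x y v * w y z v + w y z v * w x z v + w x z v * w x y v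
  have N0 : ∀ x y z v, 0 ≤ N x y z v := by
    intro x y z v
    simp only [N]
    rcases w01 x y v with h1 | h1 <;> rcases w01 y z v with h2 | h2 <;>
      rcases w01 x z v with h3 | h3 <;> norm_num [h1, h2, h3]
  -- sums over edges of functions of a pair
  have pair2 : ∀ φ : V → V → ℝ, ∑ x, ∑ y, ∑ z, w x y z * φ y z =
      ∑ x, ∑ y, ∑ z, w x y z * φ x y := by
    intro φ
    rw [sum_rotate]
    refine sum_congr rfl fun a _ => sum_congr rfl fun b _ => sum_congr rfl fun c _ => ?_
    rw [wrot c a b]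
  have pair3 : ∀ φ : V → V → ℝ, ∑ x, ∑ y, ∑ z, w x y z * φ x z =
      ∑ x, ∑ y, ∑ z, w x y z * φ x y := by
    intro φ
    refine sum_congr rfl fun a _ => ?_
    rw [sum_comm]
    refine sum_congr rfl fun b _ => sum_congr rfl fun c _ => ?_
    rw [wswap a c b]
  have hSd : ∑ x, ∑ y, ∑ z, w x y z * d x y = S := by
    refine sum_congr rfl fun a _ => sum_congr rfl fun b _ => ?_
    rw [← sum_mul, sq]
  have hId : ∑ x, ∑ y, ∑ z, w x y z * I x y ≤ n * F := by
    have : n * F = ∑ x, ∑ y, n * I x y := by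
      rw [hFdef, mul_sum]
      exact sum_congr rfl fun x _ => by rw [mul_sum]
    rw [this]
    refine sum_le_sum fun x _ => sum_le_sum fun y _ => ?_
    rw [← sum_mul]
    refine mul_le_mul_of_nonneg_right ?_ (sum_nonneg fun u _ => sum_nonneg fun v _ =>
      mul_nonneg (mul_nonneg (w0 _ _ _) (w0 _ _ _)) (p0 _ _))
    rw [← hone]
    exact sum_le_sum fun z _ => w1 x y z
  have hJ1 : ∑ x, ∑ y, ∑ z, ∑ v, w x y z * (w x y v * w y z v) ≤ F := by
    refine sum_le_sum fun x _ => sum_le_sum fun y _ => sum_le_sum fun z _ =>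
      sum_le_sum fun v _ => ?_
    rw [← mul_assoc]
    refine mul_le_mul_of_nonneg_left ?_ (mul_nonneg (w0 _ _ _) (w0 _ _ _))
    rw [wrot y z v]; exact hwp z v y
  have hJ3 : ∑ x, ∑ y, ∑ z, ∑ v, w x y z * (w x z v * w x y v) ≤ F := by
    refine sum_le_sum fun x _ => sum_le_sum fun y _ => sum_le_sum fun z _ =>
      sum_le_sum fun v _ => ?_
    rw [mul_comm (w x z v), ← mul_assoc]
    refine mul_le_mul_of_nonneg_left ?_ (mul_nonneg (w0 _ _ _) (w0 _ _ _))
    rw [wrot x z v]; exact hwp z v x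
  have hJ2 : ∑ x, ∑ y, ∑ z, ∑ v, w x y z * (w y z v * w x z v) ≤ F := by
    refine sum_le_sum fun x _ => ?_
    rw [sum_comm]
    refine sum_le_sum fun y _ => sum_le_sum fun z _ => sum_le_sum fun v _ => ?_
    rw [mul_comm (w z y v), ← mul_assoc, wswap x z y]
    refine mul_le_mul_of_nonneg_left ?_ (mul_nonneg (w0 _ _ _) (w0 _ _ _))
    rw [wswap z y v]; exact hwp z v y
  let g : V → V → V → ℝ := fun x y z => n * ∑ v, N x y z v + (I x y + I y z + I x z)
  have hg : ∑ x, ∑ y, ∑ z, w x y z * g x y z ≤ (2 * κ + 9 * θ) * n ^ 5 := by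
    have e1 : ∀ x y z, w x y z * g x y z = n * (n * w x y z - (w x y z * d x y + w x y z * d y z +
        w x y z * d x z) + ∑ v, w x y z * (w x y v * w y z v) +
        ∑ v, w x y z * (w y z v * w x z v) + ∑ v, w x y z * (w x z v * w x y v)) +
        (w x y z * I x y + w x y z * I y z + w x y z * I x z) := by
      intro x y z
      simp only [g, N, hd, sum_add_distrib, sum_sub_distrib, hone, ← mul_sum]
      ring
    have e2 : ∑ x, ∑ y, ∑ z, w x y z * g x y z = n * (n * W - 3 * S +
        ∑ x, ∑ y, ∑ z, ∑ v, w x y z * (w x y v * w y z v) +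
        ∑ x, ∑ y, ∑ z, ∑ v, w x y z * (w y z v * w x z v) +
        ∑ x, ∑ y, ∑ z, ∑ v, w x y z * (w x z v * w x y v)) +
        3 * ∑ x, ∑ y, ∑ z, w x y z * I x y := by
      simp only [e1, sum_add_distrib, sum_sub_distrib, ← mul_sum, pair2, pair3]
      rw [hSd, ← hWdef]
      ring
    rw [e2]
    nlinarith
  have hWn : n ^ 3 / 9 ≤ W := by
    have : 0 < n ^ 3 := by positivity
    nlinarith
  obtain ⟨x, y, z, hxyz, hgxyz⟩ : ∃ x y z, w x y z = 1 ∧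
      g x y z ≤ 10 * (2 * κ + 9 * θ) * n ^ 2 := by
    by_contra hcon
    push Not at hcon
    have : 10 * (2 * κ + 9 * θ) * n ^ 2 * W ≤ (2 * κ + 9 * θ) * n ^ 5 := by
      refine le_trans ?_ hg
      simp only [hWdef, mul_sum]
      refine sum_le_sum fun x _ => sum_le_sum fun y _ => sum_le_sum fun z _ => ?_
      rcases w01 x y z with h | h
      · rw [h]; simp
      · rw [h, mul_one, one_mul]; exact (hcon x y z h).le
    have h2 : 0 < (2 * κ + 9 * θ) * n ^ 5 := by positivity
    have h3 : 0 ≤ 10 * (2 * κ + 9 * θ) * n ^ 2 := by positivity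
    nlinarith [mul_le_mul_of_nonneg_left hWn h3]
  refine ⟨fun v => if w y z v = 1 then 0 else if w x z v = 1 then 1 else 2, ?_⟩
  have key : ∀ u v z', w u v z' * (if (if w y z u = 1 then (0 : Fin 3) else
      if w x z u = 1 then 1 else 2) = (if w y z v = 1 then 0 else if w x z v = 1 then 1 else 2)
      then 1 else 0) ≤ w x y u * w x y v * p u v + w y z u * w y z v * p u v +
        w x z u * w x z v * p u v + N x y z u + N x y z v := by
    intro u v z'
    exact color_indicator_le (w01 _ _ _) (w01 _ _ _) (w01 _ _ _) (w01 _ _ _) (w01 _ _ _)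
      (w01 _ _ _) (w0 u v z') (w1 u v z') (hwp u v z')
  calc _ ≤ ∑ u, ∑ v, ∑ _z' : V, (w x y u * w x y v * p u v + w y z u * w y z v * p u v +
        w x z u * w x z v * p u v + N x y z u + N x y z v) :=
        sum_le_sum fun u _ => sum_le_sum fun v _ => sum_le_sum fun z' _ => key u v z'
    _ = n * (I x y + I y z + I x z) + 2 * n ^ 2 * ∑ v, N x y z v := by
        simp only [sum_const, card_univ, nsmul_eq_mul, ← hn, sum_add_distrib, ← mul_sum, I]
        ring
    _ ≤ 2 * n * g x y z := by
        have : 0 ≤ I x y + I y z + I x z := by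
          have hI : ∀ x y, 0 ≤ I x y := fun x y => sum_nonneg fun u _ => sum_nonneg fun v _ =>
            mul_nonneg (mul_nonneg (w0 _ _ _) (w0 _ _ _)) (p0 _ _)
          linarith [hI x y, hI y z, hI x z]
        simp only [g]
        nlinarith
    _ ≤ _ := by nlinarith

/-- Every 3-set has six orderings. -/
theorem card_ordered_triples {V : Type*} [DecidableEq V] [Fintype V] (H : Finset (Finset V))
    (h3 : ∀ e ∈ H, e.card = 3) :
    ((univ : Finset (V × V × V)).filter (fun p => ({p.1, p.2.1, p.2.2} : Finset V) ∈ H)).card =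
      6 * H.card := by
  rw [card_eq_sum_card_fiberwise (f := fun p => ({p.1, p.2.1, p.2.2} : Finset V)) (t := H)
    (by intro p hp; simpa using hp)]
  rw [sum_congr rfl (g := fun _ => 6), sum_const, smul_eq_mul, mul_comm]
  intro e he
  obtain ⟨a, b, c, hab, hac, hbc, rfl⟩ := card_eq_three.1 (h3 e he)
  have : ((univ : Finset (V × V × V)).filter
      (fun p => ({p.1, p.2.1, p.2.2} : Finset V) ∈ H)).filter
      (fun p => ({p.1, p.2.1, p.2.2} : Finset V) = {a, b, c}) =
      {(a, b, c), (a, c, b), (b, a, c), (b, c, a), (c, a, b), (c, b, a)} := by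
    ext ⟨x, y, z⟩
    simp only [mem_filter, mem_univ, true_and, mem_insert, mem_singleton, Prod.mk.injEq]
    constructor
    · rintro ⟨-, h⟩
      have hx : x ∈ ({a, b, c} : Finset V) := by rw [← h]; simp
      have hy : y ∈ ({a, b, c} : Finset V) := by rw [← h]; simp
      have hz : z ∈ ({a, b, c} : Finset V) := by rw [← h]; simp
      obtain ⟨hxy, hxz, hyz⟩ := pairwise_ne_of_card_three (by rw [h]; exact h3 _ he)
      simp only [mem_insert, mem_singleton] at hx hy hz
      grind
    · have h : ({x, y, z} : Finset V) = {a, b, c} → ({x, y, z} : Finset V) ∈ H ∧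
          ({x, y, z} : Finset V) = {a, b, c} := fun h => ⟨h ▸ he, h⟩
      intro hh
      apply h
      rcases hh with ⟨rfl, rfl, rfl⟩ | ⟨rfl, rfl, rfl⟩ | ⟨rfl, rfl, rfl⟩ | ⟨rfl, rfl, rfl⟩ |
        ⟨rfl, rfl, rfl⟩ | ⟨rfl, rfl, rfl⟩ <;> ext <;> simp only [mem_insert, mem_singleton] <;> tauto
  rw [this]
  have hba := hab.symm
  have hca := hac.symm
  have hcb := hbc.symm
  repeat rw [card_insert_of_notMem (by simp [*])]
  simp

/-- Deleting few edges from a 3-graph, every covered pair gets a large codegree. -/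
theorem exists_clean_subgraph {V : Type*} [DecidableEq V] [Fintype V] (H : Finset (Finset V))
    (h3 : ∀ e ∈ H, e.card = 3) {k : ℝ} (hk : 0 ≤ k) :
    ∃ H' ⊆ H, (H.card : ℝ) ≤ H'.card + k * (Fintype.card V : ℝ) ^ 2 ∧
      ∀ x y z, ({x, y, z} : Finset V) ∈ H' →
        k ≤ (univ.filter (fun z' => ({x, y, z'} : Finset V) ∈ H')).card := by
  let sh : Finset (Finset V) → Finset (V × V) := fun G =>
    univ.filter (fun p => ∃ z, ({p.1, p.2, z} : Finset V) ∈ G)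
  obtain ⟨H', hH', hmax⟩ := exists_max_image H.powerset
    (fun G => (G.card : ℝ) - k * (sh G).card) ⟨H, mem_powerset_self H⟩
  rw [mem_powerset] at hH'
  refine ⟨H', hH', ?_, ?_⟩
  · have h1 := hmax H (mem_powerset_self H)
    have h2 : ((sh H).card : ℝ) ≤ (Fintype.card V : ℝ) ^ 2 := by
      have := card_le_univ (sh H)
      rw [Fintype.card_prod, ← sq] at this
      exact_mod_cast this
    have h3 := mul_le_mul_of_nonneg_left h2 hk
    have h4 : 0 ≤ k * (sh H').card := by positivity
    linarith
  · intro x y z hxyz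
    by_contra hcon
    push Not at hcon
    have hlt := hmax (H'.filter (fun e => ¬ (x ∈ e ∧ y ∈ e)))
      (mem_powerset.2 ((filter_subset _ _).trans hH'))
    have hrem : (H'.filter (fun e => x ∈ e ∧ y ∈ e)).card ≤
        (univ.filter (fun z' => ({x, y, z'} : Finset V) ∈ H')).card := by
      refine (card_le_card (t := (univ.filter (fun z' => ({x, y, z'} : Finset V) ∈ H')).image
        (fun z' => {x, y, z'})) ?_).trans card_image_le
      intro e he
      obtain ⟨heH, hx, hy⟩ := mem_filter.1 he
      have hxy := (pairwise_ne_of_card_three (h3 _ (hH' hxyz))).1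
      have hsub : ({x, y} : Finset V) ⊆ e := by
        intro u hu
        rcases mem_insert.1 hu with rfl | hu
        · exact hx
        · rw [mem_singleton.1 hu]; exact hy
      have hc : (e \ {x, y}).card = 1 := by
        rw [card_sdiff_of_subset hsub, h3 e (hH' heH), card_pair hxy]
      obtain ⟨w, hw⟩ := card_eq_one.1 hc
      have hew : ({x, y, w} : Finset V) = e := by
        rw [← union_sdiff_of_subset hsub, hw]
        ext; simp only [mem_insert, mem_singleton, mem_union]; tauto
      rw [mem_image]
      exact ⟨w, mem_filter.2 ⟨mem_univ _, hew ▸ heH⟩, hew⟩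
    have hsh : (sh (H'.filter (fun e => ¬ (x ∈ e ∧ y ∈ e)))).card + 1 ≤ (sh H').card := by
      rw [Nat.succ_le_iff]
      apply card_lt_card
      refine ⟨?_, fun hsub => ?_⟩
      · intro p hp
        obtain ⟨-, w, hw⟩ := mem_filter.1 hp
        exact mem_filter.2 ⟨mem_univ _, w, (mem_filter.1 hw).1⟩
      · have hm : (x, y) ∈ sh H' := mem_filter.2 ⟨mem_univ _, z, hxyz⟩
        obtain ⟨-, w, hw⟩ := mem_filter.1 (hsub hm)
        exact (mem_filter.1 hw).2 (by simp)
    have hsplit := card_filter_add_card_filter_not (s := H') (fun e => x ∈ e ∧ y ∈ e)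
    have e1 : (H'.card : ℝ) = (H'.filter (fun e => x ∈ e ∧ y ∈ e)).card +
        (H'.filter (fun e => ¬ (x ∈ e ∧ y ∈ e))).card := by exact_mod_cast hsplit.symm
    have e2 : ((H'.filter (fun e => x ∈ e ∧ y ∈ e)).card : ℝ) ≤
        (univ.filter (fun z' => ({x, y, z'} : Finset V) ∈ H')).card := by exact_mod_cast hrem
    have e3 : ((sh (H'.filter (fun e => ¬ (x ∈ e ∧ y ∈ e)))).card : ℝ) + 1 ≤ (sh H').card := by
      exact_mod_cast hsh
    have e4 := mul_le_mul_of_nonneg_left e3 hk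
    linarith

/-- Stability: a dense `F_5^S(m,t,K_{s,s})`-free 3-graph is almost 3-partite. -/
theorem exists_coloring {m t s : ℕ} (ht : 1 ≤ t) (hs : 2 ≤ s) (hm : 2 * s ≤ m)
    {γ : ℝ} (hγ : 0 < γ) :
    ∃ n0 : ℕ, ∀ {V : Type} [DecidableEq V] [Fintype V] (H : Finset (Finset V)),
      (∀ e ∈ H, e.card = 3) → ¬ HasCopy H (F5Stss m t s hm) → n0 ≤ Fintype.card V →
      (Fintype.card V : ℝ) ^ 3 / 27 ≤ H.card →
      ∃ col : V → Fin 3, (((univ : Finset (V × V × V)).filter (fun p =>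
        ({p.1, p.2.1, p.2.2} : Finset V) ∈ H ∧ col p.1 = col p.2.1)).card : ℝ) ≤
          γ * (Fintype.card V : ℝ) ^ 3 := by
  obtain ⟨η, hη, hη1, hη2⟩ : ∃ η : ℝ, 0 < η ∧ η ≤ γ / 500 ∧ η ≤ 1 / 54 :=
    ⟨min (γ / 500) (1 / 54), by positivity, min_le_left _ _, min_le_right _ _⟩
  obtain ⟨n0, hn0⟩ := card_homs_F5_lt ht hs hm (show 0 < η * η by positivity)
  refine ⟨max n0 1, ?_⟩
  intro V _ _ H h3 hF hn hH
  have hhom := hn0 H h3 hF ((le_max_left _ _).trans hn)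
  have hn1 : (0 : ℝ) < Fintype.card V := by
    have := (le_max_right n0 1).trans hn
    exact_mod_cast this
  set n : ℝ := (Fintype.card V : ℝ) with hndef
  obtain ⟨H', hH', hcard, hcod⟩ := exists_clean_subgraph H h3 (show 0 ≤ η * n by positivity)
  rw [← hndef] at hcard
  let w : V → V → V → ℝ := fun x y z => if ({x, y, z} : Finset V) ∈ H' then 1 else 0
  let p : V → V → ℝ := fun x y => if ∃ z, ({x, y, z} : Finset V) ∈ H' then 1 else 0
  have w01 : ∀ x y z, w x y z = 0 ∨ w x y z = 1 := fun x y z => by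
    simp only [w]; split_ifs <;> simp
  have wc : ∀ x y, ∑ z, w x y z = (univ.filter (fun z => ({x, y, z} : Finset V) ∈ H')).card :=
    fun x y => by simp only [w]; rw [sum_boole]
  have hpw : ∀ x y, η * n * p x y ≤ ∑ z, w x y z := by
    intro x y
    rw [wc]
    simp only [p]
    split_ifs with h
    · obtain ⟨z, hz⟩ := h
      rw [mul_one]; exact hcod x y z hz
    · rw [mul_zero]; positivity
  have hFw : ∑ a, ∑ b, ∑ c, ∑ d, ∑ e, w a b c * w a b d * w c d e ≤ η * η * n ^ 5 := by
    have : ∑ a, ∑ b, ∑ c, ∑ d, ∑ e, w a b c * w a b d * w c d e =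
        ∑ q : V × V × V × V × V, if ({q.1, q.2.1, q.2.2.1} : Finset V) ∈ H' ∧
          ({q.1, q.2.1, q.2.2.2.1} : Finset V) ∈ H' ∧
          ({q.2.2.1, q.2.2.2.1, q.2.2.2.2} : Finset V) ∈ H' then (1 : ℝ) else 0 := by
      simp only [Fintype.sum_prod_type, w, ite_and, mul_ite, mul_one, mul_zero]
      refine sum_congr rfl fun a _ => sum_congr rfl fun b _ => sum_congr rfl fun c _ =>
        sum_congr rfl fun d _ => sum_congr rfl fun e _ => ?_
      split_ifs <;> rfl
    rw [this, sum_boole]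
    refine le_trans ?_ hhom.le
    rw [Nat.cast_le]
    apply card_le_card
    intro q hq
    simp only [mem_filter, mem_univ, true_and] at hq ⊢
    exact ⟨hH' hq.1, hH' hq.2.1, hH' hq.2.2⟩
  have hFp : ∑ a, ∑ b, ∑ c, ∑ d, w a b c * w a b d * p c d ≤ η * n ^ 4 := by
    have h1 : η * n * ∑ a, ∑ b, ∑ c, ∑ d, w a b c * w a b d * p c d ≤ η * n * (η * n ^ 4) := by
      refine le_trans ?_ (hFw.trans (le_of_eq (by ring)))
      simp only [mul_sum]
      refine sum_le_sum fun a _ => sum_le_sum fun b _ => sum_le_sum fun c _ =>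
        sum_le_sum fun d _ => ?_
      have h0 : 0 ≤ w a b c * w a b d := by
        rcases w01 a b c with h | h <;> rcases w01 a b d with h' | h' <;> norm_num [h, h']
      rw [← mul_sum]
      have := mul_le_mul_of_nonneg_left (hpw c d) h0
      linarith
    exact le_of_mul_le_mul_left h1 (by positivity)
  have hWc : ∑ a, ∑ b, ∑ c, w a b c = 6 * H'.card := by
    have h := card_ordered_triples H' (fun e he => h3 e (hH' he))
    have : ∑ a, ∑ b, ∑ c, w a b c = ∑ q : V × V × V,
        if ({q.1, q.2.1, q.2.2} : Finset V) ∈ H' then (1 : ℝ) else 0 := by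
      simp only [Fintype.sum_prod_type, w]
    rw [this, sum_boole, h]
    push_cast; rfl
  have n3 : 0 < n ^ 3 := by positivity
  obtain ⟨col, hcol⟩ := exists_coloring_of_few_F5 w p w01
    (fun x y z => by simp only [w]; rw [insert_comm])
    (fun x y z => by simp only [w]; rw [pair_comm])
    (fun x y => by simp only [p]; split_ifs <;> norm_num)
    (fun x y z => by
      simp only [w, p]
      split_ifs with h1 h2
      · rfl
      · exact absurd ⟨z, h1⟩ h2
      · norm_num
      · rfl)
    hndef hn1 hη (show 0 < 6 * η by positivity) (by linarith) hFp
    (by rw [hWc]; nlinarith)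
  refine ⟨col, ?_⟩
  have hsub : (univ : Finset (V × V × V)).filter (fun p =>
        ({p.1, p.2.1, p.2.2} : Finset V) ∈ H ∧ col p.1 = col p.2.1) ⊆
      (univ : Finset (V × V × V)).filter (fun p =>
        ({p.1, p.2.1, p.2.2} : Finset V) ∈ H' ∧ col p.1 = col p.2.1) ∪
      (univ : Finset (V × V × V)).filter (fun p => ({p.1, p.2.1, p.2.2} : Finset V) ∈ H \ H') := by
    intro q hq
    simp only [mem_filter, mem_univ, true_and, mem_union, mem_sdiff] at hq ⊢
    tauto
  have hc := (card_le_card hsub).trans (card_union_le _ _)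
  rw [card_ordered_triples (H \ H') (fun e he => h3 e (mem_sdiff.1 he).1)] at hc
  have hsd : ((H \ H').card : ℝ) = H.card - H'.card := by
    rw [card_sdiff_of_subset hH', Nat.cast_sub (card_le_card hH')]
  have hc' : (((univ : Finset (V × V × V)).filter (fun p =>
        ({p.1, p.2.1, p.2.2} : Finset V) ∈ H ∧ col p.1 = col p.2.1)).card : ℝ) ≤
      ((univ : Finset (V × V × V)).filter (fun p =>
        ({p.1, p.2.1, p.2.2} : Finset V) ∈ H' ∧ col p.1 = col p.2.1)).card +
        6 * ((H \ H').card : ℝ) := by exact_mod_cast hc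
  have hcw : (((univ : Finset (V × V × V)).filter (fun p =>
        ({p.1, p.2.1, p.2.2} : Finset V) ∈ H' ∧ col p.1 = col p.2.1)).card : ℝ) =
      ∑ u, ∑ v, ∑ z, w u v z * (if col u = col v then 1 else 0) := by
    rw [← sum_boole]
    simp only [Fintype.sum_prod_type, w]
    refine sum_congr rfl fun a _ => sum_congr rfl fun b _ => sum_congr rfl fun c _ => ?_
    simp only [ite_and, mul_ite, mul_one, mul_zero]
    split_ifs <;> rfl
  rw [hcw, hsd] at hc'
  nlinarith

/-- `G` has no `K_{t,s,s}` whose two `s`-vertex parts have all the same colour. -/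
def MonoBoxFree {V : Type*} [DecidableEq V] (G : Finset (Finset V)) (col : V → Fin 3)
    (t s : ℕ) : Prop :=
  ∀ (T S0 S1 : Finset V) (i : Fin 3), T.card = t → S0.card = s → S1.card = s →
    (∀ x ∈ S0, col x = i) → (∀ y ∈ S1, col y = i) →
    ¬ ∀ τ ∈ T, ∀ x ∈ S0, ∀ y ∈ S1, ({τ, x, y} : Finset V) ∈ G

/-- A triple that is not rainbow has two vertices of the same colour. -/
theorem exists_eq_triple_of_not_rainbow {V : Type*} [DecidableEq V] {e : Finset V}
    {col : V → Fin 3} (h3 : e.card = 3) (hr : (e.image col).card ≠ 3) :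
    ∃ x y z, e = {x, y, z} ∧ col y = col z := by
  have hni : ¬ Set.InjOn col e := fun h => hr ((card_image_of_injOn h).trans h3)
  unfold Set.InjOn at hni
  push Not at hni
  obtain ⟨y, hy, z, hz, hyz, hne⟩ := hni
  have hsub : ({y, z} : Finset V) ⊆ e := by
    intro u hu
    rcases mem_insert.1 hu with rfl | hu
    · exact hy
    · rw [mem_singleton.1 hu]; exact hz
  obtain ⟨x, hx⟩ := card_eq_one.1
    (show (e \ {y, z}).card = 1 by rw [card_sdiff_of_subset hsub, h3, card_pair hne])
  refine ⟨x, y, z, ?_, hyz⟩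
  rw [← sdiff_union_of_subset hsub, hx]
  rfl

theorem exists_card_le_rpow_of_monoBoxFree (t : ℕ) {s : ℕ} (hs : 1 ≤ s) :
    ∃ C : ℝ, 0 < C ∧ ∀ {V : Type} [DecidableEq V] [Fintype V] (G : Finset (Finset V))
      (col : V → Fin 3), (∀ e ∈ G, e.card = 3) → (∀ e ∈ G, (e.image col).card ≠ 3) →
      1 ≤ t → MonoBoxFree G col t s →
      (G.card : ℝ) ≤ C * (Fintype.card V : ℝ) ^ ((3 : ℝ) - 1 / (s : ℝ) ^ 2) := by
  obtain ⟨C, hC, h⟩ := exists_card_le_rpow_of_no_box t hs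
  refine ⟨C, hC, ?_⟩
  intro V _ _ G col h3 hr ht hG
  set R := (univ : Finset (V × V × V)).filter
    (fun p => ({p.1, p.2.1, p.2.2} : Finset V) ∈ G ∧ col p.2.1 = col p.2.2) with hR
  refine le_trans ?_ (h R ?_)
  · rw [Nat.cast_le]
    refine (card_le_card (t := R.image (fun p => ({p.1, p.2.1, p.2.2} : Finset V))) ?_).trans
      card_image_le
    intro e he
    obtain ⟨x, y, z, rfl, hyz⟩ := exists_eq_triple_of_not_rainbow (h3 e he) (hr e he)
    exact mem_image.2 ⟨(x, y, z), mem_filter.2 ⟨mem_univ _, he, hyz⟩, rfl⟩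
  · rintro ⟨T, S0, S1, cT, c0, c1, hbox⟩
    obtain ⟨τ, hτ⟩ : T.Nonempty := card_pos.1 (by omega)
    obtain ⟨x, hx⟩ : S0.Nonempty := card_pos.1 (by omega)
    obtain ⟨y, hy⟩ : S1.Nonempty := card_pos.1 (by omega)
    simp only [hR, mem_filter, mem_univ, true_and] at hbox
    refine hG T S0 S1 (col y) cT c0 c1 (fun x' hx' => (hbox τ hτ x' hx' y hy).2)
      (fun y' hy' => ?_) (fun τ hτ x hx y hy => (hbox τ hτ x hx y hy).1)
    rw [← (hbox τ hτ x hx y' hy').2, (hbox τ hτ x hx y hy).2]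

/-- Complete 3-partite subgraphs of an injective image pull back. -/
theorem exists_pullback_box {V W : Type*} [DecidableEq V] [DecidableEq W] {U : Finset V}
    {Φ : V → W} (hΦ : Set.InjOn Φ U) {G : Finset (Finset V)} (hGU : ∀ e ∈ G, e ⊆ U)
    {T S0 S1 : Finset W} (hT : T.Nonempty) (h0 : S0.Nonempty) (h1 : S1.Nonempty)
    (h : ∀ τ ∈ T, ∀ x ∈ S0, ∀ y ∈ S1, ({τ, x, y} : Finset W) ∈ G.image (fun e => e.image Φ)) :
    ∃ T' S0' S1' : Finset V, T' ⊆ U ∧ S0' ⊆ U ∧ S1' ⊆ U ∧ T'.card = T.card ∧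
      S0'.card = S0.card ∧ S1'.card = S1.card ∧ (∀ x ∈ S0', Φ x ∈ S0) ∧ (∀ y ∈ S1', Φ y ∈ S1) ∧
      ∀ τ ∈ T', ∀ x ∈ S0', ∀ y ∈ S1', ({τ, x, y} : Finset V) ∈ G := by
  have key : ∀ A : Finset W, (∀ a ∈ A, ∃ e ∈ G, a ∈ e.image Φ) →
      (U.filter (fun v => Φ v ∈ A)).card = A.card := by
    intro A hA
    rw [← card_image_of_injOn (hΦ.mono (coe_subset.2 (filter_subset (fun v => Φ v ∈ A) U)))]
    congr 1
    ext a
    simp only [mem_image, mem_filter]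
    constructor
    · rintro ⟨v, ⟨-, hv⟩, rfl⟩; exact hv
    · intro ha
      obtain ⟨e, he, hae⟩ := hA a ha
      obtain ⟨v, hv, rfl⟩ := mem_image.1 hae
      exact ⟨v, ⟨hGU e he hv, ha⟩, rfl⟩
  obtain ⟨τ0, hτ0⟩ := hT
  obtain ⟨x0, hx0⟩ := h0
  obtain ⟨y0, hy0⟩ := h1
  refine ⟨U.filter (fun v => Φ v ∈ T), U.filter (fun v => Φ v ∈ S0), U.filter (fun v => Φ v ∈ S1),
    filter_subset _ _, filter_subset _ _, filter_subset _ _, key T ?_, key S0 ?_, key S1 ?_,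
    fun x hx => (mem_filter.1 hx).2, fun y hy => (mem_filter.1 hy).2, ?_⟩
  · intro τ hτ
    obtain ⟨e, he, hee⟩ := mem_image.1 (h τ hτ x0 hx0 y0 hy0)
    exact ⟨e, he, by rw [hee]; simp⟩
  · intro x hx
    obtain ⟨e, he, hee⟩ := mem_image.1 (h τ0 hτ0 x hx y0 hy0)
    exact ⟨e, he, by rw [hee]; simp⟩
  · intro y hy
    obtain ⟨e, he, hee⟩ := mem_image.1 (h τ0 hτ0 x0 hx0 y hy)
    exact ⟨e, he, by rw [hee]; simp⟩
  · intro τ hτ x hx y hy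
    obtain ⟨uτ, hτ⟩ := mem_filter.1 hτ
    obtain ⟨ux, hx⟩ := mem_filter.1 hx
    obtain ⟨uy, hy⟩ := mem_filter.1 hy
    obtain ⟨e, he, hee⟩ := mem_image.1 (h _ hτ _ hx _ hy)
    have himg : e.image Φ = ({τ, x, y} : Finset V).image Φ := by
      rw [hee]; simp [image_insert]
    have hsub : ({τ, x, y} : Finset V) ⊆ U := by
      intro u hu
      simp only [mem_insert, mem_singleton] at hu
      rcases hu with rfl | rfl | rfl <;> assumption
    have : e = {τ, x, y} := by
      apply coe_injective
      refine (hΦ.image_eq_image_iff (coe_subset.2 (hGU e he)) (coe_subset.2 hsub)).1 ?_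
      rw [← coe_image, ← coe_image, himg]
    exact this ▸ he

theorem exists_injOn_fin {V : Type*} [DecidableEq V] {U : Finset V} {q : ℕ} (hq : 0 < q)
    (h : U.card ≤ q) : ∃ φ : V → Fin q, Set.InjOn φ U := by
  refine ⟨fun v => if hv : v ∈ U then Fin.castLE h (U.equivFin ⟨v, hv⟩) else ⟨0, hq⟩, ?_⟩
  intro x hx y hy hxy
  rw [mem_coe] at hx hy
  simp only [hx, hy, dif_pos] at hxy
  have := U.equivFin.injective (Fin.castLE_injective h hxy)
  exact congrArg Subtype.val this

theorem card_image_image_of_injOn {V W : Type*} [DecidableEq V] [DecidableEq W] {U : Finset V}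
    {Φ : V → W} (hΦ : Set.InjOn Φ U) {G : Finset (Finset V)} (hGU : ∀ e ∈ G, e ⊆ U) :
    (G.image (fun e => e.image Φ)).card = G.card := by
  apply card_image_of_injOn
  intro e he e' he' hee
  apply coe_injective
  refine (hΦ.image_eq_image_iff (coe_subset.2 (hGU e he)) (coe_subset.2 (hGU e' he'))).1 ?_
  rw [← coe_image, ← coe_image]
  exact congrArg _ hee

theorem card_le_exThree_Ktss {V : Type*} [DecidableEq V] {G : Finset (Finset V)}
    {col : V → Fin 3} {t s : ℕ} (ht : 1 ≤ t) (hs : 1 ≤ s) (h3 : ∀ e ∈ G, e.card = 3)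
    (hG : MonoBoxFree G col t s) {U : Finset V} {q : ℕ} (hq : 0 < q) (hU : U.card ≤ q)
    {i : Fin 3} (hUi : ∀ v ∈ U, col v = i) (hGU : ∀ e ∈ G, e ⊆ U) :
    G.card ≤ exThree q (Ktss t s) := by
  obtain ⟨φ, hφ⟩ := exists_injOn_fin hq hU
  refine le_csSup ⟨(univ : Finset (Finset (Fin q))).card, ?_⟩
    ⟨G.image (fun e => e.image φ), ?_, ?_, card_image_image_of_injOn hφ hGU⟩
  · rintro k ⟨H, -, -, rfl⟩
    exact card_le_card (subset_univ _)
  · intro e he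
    obtain ⟨e', he', rfl⟩ := mem_image.1 he
    rw [card_image_of_injOn (hφ.mono (coe_subset.2 (hGU e' he'))), h3 e' he']
  · rintro ⟨f, hf⟩
    have cT : (univ.image (fun a : Fin t => f (Sum.inl a))).card = t :=
      (card_image_of_injective _ fun a b h => Sum.inl_injective (f.injective h)).trans (by simp)
    have c0 : (univ.image (fun a : Fin s => f (Sum.inr (Sum.inl a)))).card = s :=
      (card_image_of_injective _ fun a b h =>
        Sum.inl_injective (Sum.inr_injective (f.injective h))).trans (by simp)
    have c1 : (univ.image (fun a : Fin s => f (Sum.inr (Sum.inr a)))).card = s :=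
      (card_image_of_injective _ fun a b h =>
        Sum.inr_injective (Sum.inr_injective (f.injective h))).trans (by simp)
    obtain ⟨T, S0, S1, hT, h0, h1, dT, d0, d1, -, -, hbox⟩ := exists_pullback_box hφ hGU
      (T := univ.image (fun a : Fin t => f (Sum.inl a)))
      (S0 := univ.image (fun a : Fin s => f (Sum.inr (Sum.inl a))))
      (S1 := univ.image (fun a : Fin s => f (Sum.inr (Sum.inr a))))
      (card_pos.1 (by omega)) (card_pos.1 (by omega)) (card_pos.1 (by omega)) (by
        intro τ hτ x hx y hy
        obtain ⟨a, -, rfl⟩ := mem_image.1 hτ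
        obtain ⟨b, -, rfl⟩ := mem_image.1 hx
        obtain ⟨c, -, rfl⟩ := mem_image.1 hy
        have := hf {Sum.inl a, Sum.inr (Sum.inl b), Sum.inr (Sum.inr c)}
          (mem_image.2 ⟨(a, b, c), mem_univ _, rfl⟩)
        simpa [image_insert] using this)
    exact hG T S0 S1 i (dT.trans cT) (d0.trans c0) (d1.trans c1) (fun x hx => hUi x (h0 hx))
      (fun y hy => hUi y (h1 hy)) hbox

theorem card_le_exBip {V : Type*} [DecidableEq V] {G : Finset (Finset V)}
    {col : V → Fin 3} {t s : ℕ} (ht : 1 ≤ t) (hs : 1 ≤ s) (h3 : ∀ e ∈ G, e.card = 3)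
    (hG : MonoBoxFree G col t s) {A B : Finset V} {q : ℕ} (hq : 0 < q) (hA : A.card ≤ q)
    (hB : B.card ≤ q) {i j : Fin 3} (hij : i ≠ j) (hAj : ∀ v ∈ A, col v = j)
    (hBi : ∀ v ∈ B, col v = i)
    (hGU : ∀ e ∈ G, ∃ x ∈ A, ∃ y ∈ B, ∃ z ∈ B, e = {x, y, z}) :
    G.card ≤ exBip q q t s := by
  obtain ⟨φ, hφ⟩ := exists_injOn_fin hq hA
  obtain ⟨ψ, hψ⟩ := exists_injOn_fin hq hB
  let Φ : V → Fin q ⊕ Fin q := fun v => if col v = j then Sum.inl (φ v) else Sum.inr (ψ v)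
  have ΦA : ∀ v ∈ A, Φ v = Sum.inl (φ v) := fun v hv => if_pos (hAj v hv)
  have ΦB : ∀ v ∈ B, Φ v = Sum.inr (ψ v) := fun v hv => if_neg (by rw [hBi v hv]; exact hij)
  have hΦ : Set.InjOn Φ (A ∪ B : Finset V) := by
    intro x hx y hy hxy
    rw [mem_coe, mem_union] at hx hy
    rcases hx with hx | hx <;> rcases hy with hy | hy
    · rw [ΦA x hx, ΦA y hy] at hxy
      exact hφ hx hy (Sum.inl_injective hxy)
    · rw [ΦA x hx, ΦB y hy] at hxy
      cases hxy
    · rw [ΦB x hx, ΦA y hy] at hxy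
      cases hxy
    · rw [ΦB x hx, ΦB y hy] at hxy
      exact hψ hx hy (Sum.inr_injective hxy)
  have hGU' : ∀ e ∈ G, e ⊆ A ∪ B := by
    intro e he
    obtain ⟨x, hx, y, hy, z, hz, rfl⟩ := hGU e he
    intro u hu
    simp only [mem_insert, mem_singleton] at hu
    rw [mem_union]
    rcases hu with rfl | rfl | rfl
    exacts [Or.inl hx, Or.inr hy, Or.inr hz]
  refine le_csSup ⟨(univ : Finset (Finset (Fin q ⊕ Fin q))).card, ?_⟩
    ⟨G.image (fun e => e.image Φ), ?_, ?_, card_image_image_of_injOn hΦ hGU'⟩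
  · rintro k ⟨H, -, -, rfl⟩
    exact card_le_card (subset_univ _)
  · intro e he
    obtain ⟨e', he', rfl⟩ := mem_image.1 he
    obtain ⟨x, hx, y, hy, z, hz, rfl⟩ := hGU e' he'
    refine ⟨φ x, ψ y, ψ z, fun h => ?_, ?_⟩
    · exact (pairwise_ne_of_card_three (h3 _ he')).2.2 (hψ hy hz h)
    · rw [image_insert, image_insert, image_singleton, ΦA x hx, ΦB y hy, ΦB z hz]
  · rintro ⟨T, S0, S1, cT, c0, c1, -, hf⟩
    obtain ⟨T', S0', S1', hT, h0, h1, dT, d0, d1, i0, i1, hbox⟩ := exists_pullback_box hΦ hGU'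
      (T := T.image Sum.inl) (S0 := S0.image Sum.inr) (S1 := S1.image Sum.inr)
      ((card_pos.1 (by omega)).image _) ((card_pos.1 (by omega)).image _)
      ((card_pos.1 (by omega)).image _) (by
        intro τ hτ x hx y hy
        obtain ⟨a, ha, rfl⟩ := mem_image.1 hτ
        obtain ⟨b, hb, rfl⟩ := mem_image.1 hx
        obtain ⟨c, hc, rfl⟩ := mem_image.1 hy
        exact hf a ha b hb c hc)
    have hcol : ∀ (S : Finset (Fin q)) (v : V), v ∈ A ∪ B → Φ v ∈ S.image Sum.inr → col v = i := by
      intro S v hv hS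
      rcases mem_union.1 hv with h | h
      · rw [ΦA v h] at hS
        obtain ⟨b, -, hb⟩ := mem_image.1 hS
        cases hb
      · exact hBi v h
    rw [card_image_of_injective _ Sum.inl_injective] at dT
    rw [card_image_of_injective _ Sum.inr_injective] at d0 d1
    exact hG T' S0' S1' i (dT.trans cT) (d0.trans c0) (d1.trans c1)
      (fun x hx => hcol S0 x (h0 hx) (i0 x hx)) (fun y hy => hcol S1 y (h1 hy) (i1 y hy)) hbox

/-- Among the `h`-subsets of `P` some one carries at most the average weight. -/
theorem exists_subset_card_mul_sum_le {V : Type*} [DecidableEq V] (P : Finset V) (f : V → ℕ)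
    {h : ℕ} (hP : h ≤ P.card) :
    ∃ Y ⊆ P, Y.card = h ∧ P.card * ∑ v ∈ Y, f v ≤ h * ∑ v ∈ P, f v := by
  induction hk : P.card generalizing P with
  | zero => exact ⟨P, Subset.rfl, by omega, by simp⟩
  | succ k ih =>
    rcases hP.eq_or_lt with rfl | hlt
    · exact ⟨P, Subset.rfl, rfl, by rw [hk]⟩
    obtain ⟨v, hv, hmax⟩ := exists_max_image P f (card_pos.1 (by omega))
    have hc : (P.erase v).card = k := by rw [card_erase_of_mem hv, hk]; rfl
    obtain ⟨Y, hY, hYc, hYs⟩ := ih (P.erase v) (by omega) hc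
    refine ⟨Y, hY.trans (erase_subset _ _), hYc, ?_⟩
    have h1 : ∑ u ∈ Y, f u ≤ h * f v := by
      rw [← hYc, ← smul_eq_mul]
      exact sum_le_card_nsmul _ _ _ fun u hu => hmax u (mem_of_mem_erase (hY hu))
    rw [← add_sum_erase P f hv]
    calc (k + 1) * ∑ u ∈ Y, f u = k * ∑ u ∈ Y, f u + ∑ u ∈ Y, f u := by ring
      _ ≤ h * ∑ u ∈ P.erase v, f u + h * f v := add_le_add hYs h1
      _ = _ := by ring

theorem card_image_triple_eq_three {V : Type*} [DecidableEq V] {col : V → Fin 3} {x y z : V} :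
    (({x, y, z} : Finset V).image col).card = 3 ↔
      col x ≠ col y ∧ col x ≠ col z ∧ col y ≠ col z := by
  rw [image_insert, image_insert, image_singleton]
  exact ⟨pairwise_ne_of_card_three, fun h => card_eq_three.2 ⟨_, _, _, h.1, h.2.1, h.2.2, rfl⟩⟩

theorem card_triple_of_col_ne {V : Type*} [DecidableEq V] {col : V → Fin 3} {x y z : V}
    (h : col x ≠ col y ∧ col x ≠ col z ∧ col y ≠ col z) : ({x, y, z} : Finset V).card = 3 :=
  card_eq_three.2 ⟨x, y, z, fun e => h.1 (by rw [e]), fun e => h.2.1 (by rw [e]),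
    fun e => h.2.2 (by rw [e]), rfl⟩

/-- The balanced complete 3-partite 3-graph on `3 q` vertices has at least `q ^ 3` edges. -/
theorem pow_three_le_card_T3 (q : ℕ) : q ^ 3 ≤ (T3 (3 * q)).card := by
  have hc : (univ : Finset (Fin q × Fin q × Fin q)).card = q ^ 3 := by
    simp [Fintype.card_prod]; ring
  rw [← hc]
  let g : Fin q × Fin q × Fin q → Finset (Fin (3 * q)) := fun p =>
    {⟨3 * p.1, by omega⟩, ⟨3 * p.2.1 + 1, by omega⟩, ⟨3 * p.2.2 + 2, by omega⟩}
  refine card_le_card_of_injOn g ?_ ?_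
  · rintro ⟨a, b, c⟩ -
    rw [mem_coe, T3, mem_filter]
    refine ⟨mem_univ _, card_eq_three.2 ⟨_, _, _, ?_, ?_, ?_, rfl⟩, ?_⟩
    · intro h; rw [Fin.mk.injEq] at h; omega
    · intro h; rw [Fin.mk.injEq] at h; omega
    · intro h; rw [Fin.mk.injEq] at h; omega
    · intro i
      have hi : g (a, b, c) ∩ turanPart (3 * q) i =
          (g (a, b, c)).filter (fun v : Fin (3 * q) => (v : ℕ) % 3 = i) := by
        ext v; simp [turanPart]
      have h0 : (3 * (a : ℕ)) % 3 = 0 := by omega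
      have h1 : (3 * (b : ℕ) + 1) % 3 = 1 := by omega
      have h2 : (3 * (c : ℕ) + 2) % 3 = 2 := by omega
      refine (congrArg card hi).trans ?_
      simp only [g]
      fin_cases i <;> simp [filter_insert, filter_singleton, h0, h1, h2]
  · rintro ⟨a, b, c⟩ - ⟨a', b', c'⟩ - h
    have m0 : (⟨3 * a, by omega⟩ : Fin (3 * q)) ∈ g (a', b', c') := by rw [← h]; simp [g]
    have m1 : (⟨3 * b + 1, by omega⟩ : Fin (3 * q)) ∈ g (a', b', c') := by rw [← h]; simp [g]
    have m2 : (⟨3 * c + 2, by omega⟩ : Fin (3 * q)) ∈ g (a', b', c') := by rw [← h]; simp [g]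
    simp only [g, mem_insert, mem_singleton, Fin.mk.injEq] at m0 m1 m2
    simp only [Prod.mk.injEq, Fin.ext_iff]
    omega

theorem mul_mul_le_pow_three {a b c q : ℕ} (h : a + b + c = 3 * q) : a * b * c ≤ q ^ 3 := by
  zify at h ⊢
  have hq : (q : ℤ) = (a + b + c) / 3 := by omega
  have h27 : 27 * ((a : ℤ) * b * c) ≤ (a + b + c) ^ 3 := by
    have ha : (0 : ℤ) ≤ a := by positivity
    have hb : (0 : ℤ) ≤ b := by positivity
    have hc : (0 : ℤ) ≤ c := by positivity
    nlinarith [mul_nonneg ha (sq_nonneg ((b : ℤ) - c)), mul_nonneg hb (sq_nonneg ((a : ℤ) - c)),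
      mul_nonneg hc (sq_nonneg ((a : ℤ) - b)), mul_nonneg ha (sq_nonneg ((a : ℤ) - c)),
      mul_nonneg ha (sq_nonneg ((a : ℤ) - b)), mul_nonneg hb (sq_nonneg ((a : ℤ) - b)),
      mul_nonneg hb (sq_nonneg ((b : ℤ) - c)), mul_nonneg hc (sq_nonneg ((a : ℤ) - c)),
      mul_nonneg hc (sq_nonneg ((b : ℤ) - c))]
  rw [h] at h27
  linarith [mul_pow (3 : ℤ) q 3]

/-- A non-rainbow 3-graph without monochromatic boxes and with small colour classes decomposes
into six bipartite pieces and three pieces inside the classes. -/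
theorem card_le_of_monoBoxFree {V : Type*} [DecidableEq V] {G : Finset (Finset V)}
    {col : V → Fin 3} {t s : ℕ} (ht : 1 ≤ t) (hs : 1 ≤ s) (h3 : ∀ e ∈ G, e.card = 3)
    (hr : ∀ e ∈ G, (e.image col).card ≠ 3)
    (hG : MonoBoxFree G col t s) {U : Fin 3 → Finset V} {q : ℕ} (hq : 0 < q)
    (hU : ∀ i, (U i).card ≤ q) (hUi : ∀ i, ∀ v ∈ U i, col v = i)
    (hGU : ∀ e ∈ G, ∀ v ∈ e, v ∈ U (col v)) :
    G.card ≤ 6 * exBip q q t s + 3 * exThree q (Ktss t s) := by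
  classical
  let P : Fin 3 × Fin 3 → Finset (Finset V) := fun p => G.filter (fun e =>
    ∃ x ∈ U p.1, ∃ y ∈ U p.2, ∃ z ∈ U p.2, e = {x, y, z})
  have hsub : G ⊆ univ.biUnion P := by
    intro e he
    obtain ⟨x, y, z, rfl, hyz⟩ := exists_eq_triple_of_not_rainbow (h3 e he) (hr e he)
    refine mem_biUnion.2 ⟨(col x, col y), mem_univ _, mem_filter.2 ⟨he, x, ?_, y, ?_, z, ?_, rfl⟩⟩
    · exact hGU _ he x (by simp)
    · exact hGU _ he y (by simp)
    · exact hyz ▸ hGU _ he z (by simp)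
  have hb : ∀ p : Fin 3 × Fin 3, (P p).card ≤
      if p.1 = p.2 then exThree q (Ktss t s) else exBip q q t s := by
    rintro ⟨j, i⟩
    have h3' : ∀ e ∈ P (j, i), e.card = 3 := fun e he => h3 e (mem_filter.1 he).1
    have hG' : MonoBoxFree (P (j, i)) col t s := fun T S0 S1 k hT h0 h1 c0 c1 hbox =>
      hG T S0 S1 k hT h0 h1 c0 c1 fun τ hτ x hx y hy => (mem_filter.1 (hbox τ hτ x hx y hy)).1
    split_ifs with hji
    · simp only at hji
      subst hji
      refine card_le_exThree_Ktss ht hs h3' hG' hq (hU j) (hUi j) ?_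
      intro e he
      obtain ⟨-, x, hx, y, hy, z, hz, rfl⟩ := mem_filter.1 he
      intro u hu
      simp only [mem_insert, mem_singleton] at hu
      rcases hu with rfl | rfl | rfl <;> assumption
    · exact card_le_exBip ht hs h3' hG' hq (hU j) (hU i) (Ne.symm hji) (hUi j) (hUi i)
        fun e he => (mem_filter.1 he).2
  calc G.card ≤ ∑ p, (P p).card := (card_le_card hsub).trans card_biUnion_le
    _ ≤ ∑ p : Fin 3 × Fin 3, if p.1 = p.2 then exThree q (Ktss t s) else exBip q q t s :=
        sum_le_sum fun p _ => hb p
    _ = _ := by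
        simp [Fintype.sum_prod_type, Fin.sum_univ_three]
        ring

/-- The vertices of colour `i`. -/
def colClass {V : Type*} [Fintype V] (col : V → Fin 3) (i : Fin 3) : Finset V :=
  univ.filter (fun v => col v = i)

/-- The ordered rainbow triples that are not edges of `H`. -/
def missing {V : Type*} [DecidableEq V] [Fintype V] (H : Finset (Finset V)) (col : V → Fin 3) :
    Finset (V × V × V) :=
  univ.filter (fun p => (col p.1 ≠ col p.2.1 ∧ col p.1 ≠ col p.2.2 ∧ col p.2.1 ≠ col p.2.2) ∧
    ({p.1, p.2.1, p.2.2} : Finset V) ∉ H)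

/-- The rainbow triples that are not edges of `H`. -/
def missingEdges {V : Type*} [DecidableEq V] [Fintype V] (H : Finset (Finset V))
    (col : V → Fin 3) : Finset (Finset V) :=
  univ.filter (fun e => e.card = 3 ∧ (e.image col).card = 3 ∧ e ∉ H)

/-- The ordered pairs completing `v` to a missing rainbow triple. -/
def missingLink {V : Type*} [DecidableEq V] [Fintype V] (H : Finset (Finset V)) (col : V → Fin 3)
    (v : V) : Finset (V × V) :=
  univ.filter (fun p => (v, p) ∈ missing H col)

/-- The pairs in the link of `v` with prescribed colours. -/
def colLink {V : Type*} [DecidableEq V] [Fintype V] (H : Finset (Finset V)) (col : V → Fin 3)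
    (v : V) (i j : Fin 3) : Finset (V × V) :=
  univ.filter (fun p => ({v, p.1, p.2} : Finset V) ∈ H ∧ col p.1 = i ∧ col p.2 = j)

/-- The pairs in the link of `v` whose first vertex has the colour of `v`. -/
def monoLink {V : Type*} [DecidableEq V] [Fintype V] (H : Finset (Finset V)) (col : V → Fin 3)
    (v : V) : Finset (V × V) :=
  univ.filter (fun p => ({v, p.1, p.2} : Finset V) ∈ H ∧ col p.1 = col v)

theorem sum_card_missingLink {V : Type*} [DecidableEq V] [Fintype V] (H : Finset (Finset V))
    (col : V → Fin 3) : ∑ v, (missingLink H col v).card = (missing H col).card := by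
  simp only [missingLink, card_filter]
  rw [← Fintype.sum_prod_type' (fun v p => if (v, p) ∈ missing H col then 1 else 0),
    ← card_filter]
  congr 1
  ext p
  simp

theorem card_missing_le {V : Type*} [DecidableEq V] [Fintype V] (H : Finset (Finset V))
    (col : V → Fin 3) : (missing H col).card ≤ 6 * (missingEdges H col).card := by
  rw [← card_ordered_triples (missingEdges H col) fun e he => (mem_filter.1 he).2.1]
  refine card_le_card fun p hp => ?_
  obtain ⟨-, hc, hn⟩ := mem_filter.1 hp
  exact mem_filter.2 ⟨mem_univ _, mem_filter.2 ⟨mem_univ _, card_triple_of_col_ne hc,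
    card_image_triple_eq_three.2 hc, hn⟩⟩

theorem card_rainbow_add_card_missingEdges_le {V : Type*} [DecidableEq V] [Fintype V]
    {H : Finset (Finset V)} (h3 : ∀ e ∈ H, e.card = 3) (col : V → Fin 3) :
    (H.filter (fun e => (e.image col).card = 3)).card + (missingEdges H col).card ≤
      (colClass col 0).card * (colClass col 1).card * (colClass col 2).card := by
  rw [← card_union_of_disjoint (disjoint_left.2 fun e he he' =>
    (mem_filter.1 he').2.2.2 (mem_filter.1 he).1), mul_assoc, ← card_product, ← card_product]
  refine (card_le_card (t := (colClass col 0 ×ˢ colClass col 1 ×ˢ colClass col 2).image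
    (fun p => ({p.1, p.2.1, p.2.2} : Finset V))) ?_).trans card_image_le
  intro e he
  obtain ⟨he3, her⟩ : e.card = 3 ∧ (e.image col).card = 3 := by
    rcases mem_union.1 he with he | he
    · exact ⟨h3 e (mem_filter.1 he).1, (mem_filter.1 he).2⟩
    · exact ⟨(mem_filter.1 he).2.1, (mem_filter.1 he).2.2.1⟩
  have hall : e.image col = univ := by
    rw [← card_eq_iff_eq_univ, her, Fintype.card_fin]
  have hcol : ∀ i : Fin 3, ∃ x ∈ e, col x = i := fun i =>
    mem_image.1 (by rw [hall]; exact mem_univ i)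
  obtain ⟨x, hxe, hx⟩ := hcol 0
  obtain ⟨y, hye, hy⟩ := hcol 1
  obtain ⟨z, hze, hz⟩ := hcol 2
  have hc : col x ≠ col y ∧ col x ≠ col z ∧ col y ≠ col z := by
    rw [hx, hy, hz]; decide
  refine mem_image.2 ⟨(x, y, z), ?_, ?_⟩
  · simp [colClass, hx, hy, hz]
  · refine eq_of_subset_of_card_le ?_ (by rw [he3, card_triple_of_col_ne hc])
    intro u hu
    simp only [mem_insert, mem_singleton] at hu
    rcases hu with rfl | rfl | rfl <;> assumption

theorem fin_three_eq_of_ne {i j k l : Fin 3} (hij : i ≠ j) (hik : i ≠ k) (hjk : j ≠ k)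
    (hi : l ≠ i) (hj : l ≠ j) : l = k := by
  omega

/-- In a colouring with the most rainbow edges no vertex gains by changing its colour. -/
theorem card_colLink_le {V : Type*} [DecidableEq V] [Fintype V] {H : Finset (Finset V)}
    (h3 : ∀ e ∈ H, e.card = 3) {col : V → Fin 3}
    (hmax : ∀ col' : V → Fin 3, (H.filter (fun e => (e.image col').card = 3)).card ≤
      (H.filter (fun e => (e.image col).card = 3)).card) (v : V) {j k : Fin 3}
    (hj : col v ≠ j) (hk : col v ≠ k) (hjk : j ≠ k) :
    (colLink H col v (col v) j).card ≤ (colLink H col v k j).card := by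
  set col' := Function.update col v k with hcol'
  have hv' : col' v = k := Function.update_self _ _ _
  have hne' : ∀ u, u ≠ v → col' u = col u := fun u hu => Function.update_of_ne hu _ _
  have h1 : (colLink H col v (col v) j).card ≤
      (H.filter (fun e => (e.image col').card = 3 ∧ v ∈ e)).card := by
    refine card_le_card_of_injOn (fun p => ({v, p.1, p.2} : Finset V)) ?_ ?_
    · rintro ⟨y, z⟩ hp
      obtain ⟨-, he, hy, hz⟩ := mem_filter.1 (mem_coe.1 hp)
      dsimp only at he hy hz
      obtain ⟨hvy, hvz, hyz⟩ := pairwise_ne_of_card_three (h3 _ he)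
      refine mem_coe.2 (mem_filter.2 ⟨he, card_image_triple_eq_three.2 ?_, by simp⟩)
      rw [hv', hne' y hvy.symm, hne' z hvz.symm, hy, hz]
      exact ⟨hk.symm, hjk.symm, hj⟩
    · rintro ⟨y, z⟩ hp ⟨y', z'⟩ hp' hee
      obtain ⟨-, he, hy, hz⟩ := mem_filter.1 (mem_coe.1 hp)
      obtain ⟨-, he', hy', hz'⟩ := mem_filter.1 (mem_coe.1 hp')
      dsimp only at he hy hz he' hy' hz' hee
      obtain ⟨hvy, hvz, hyz⟩ := pairwise_ne_of_card_three (h3 _ he)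
      have my : y ∈ ({v, y', z'} : Finset V) := by rw [← hee]; simp
      have mz : z ∈ ({v, y', z'} : Finset V) := by rw [← hee]; simp
      simp only [mem_insert, mem_singleton] at my mz
      have ey : y = y' := by
        rcases my with h | h | h
        · exact absurd h hvy.symm
        · exact h
        · exact absurd (hy.symm.trans ((congrArg col h).trans hz')) hj
      have ez : z = z' := by
        rcases mz with h | h | h
        · exact absurd h hvz.symm
        · exact absurd (hy'.symm.trans ((congrArg col h).symm.trans hz)) hj
        · exact h
      rw [ey, ez]
  have h2 : (H.filter (fun e => (e.image col).card = 3 ∧ v ∈ e)).card ≤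
      (colLink H col v k j).card := by
    refine (card_le_card (t := (colLink H col v k j).image
      (fun p => ({v, p.1, p.2} : Finset V))) ?_).trans card_image_le
    intro e he
    obtain ⟨heH, her, hve⟩ := mem_filter.1 he
    have hcard : (e.erase v).card = 2 := by rw [card_erase_of_mem hve, h3 e heH]
    obtain ⟨y, z, hyz, hez⟩ := card_eq_two.1 hcard
    have hee : e = {v, y, z} := by rw [← insert_erase hve, hez]
    subst hee
    obtain ⟨cvy, cvz, cyz⟩ := card_image_triple_eq_three.1 her
    by_cases hy : col y = k
    · refine mem_image.2 ⟨(y, z), mem_filter.2 ⟨mem_univ _, heH, hy, ?_⟩, rfl⟩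
      exact fin_three_eq_of_ne hk hj hjk.symm cvz.symm (fun h => cyz (hy.trans h.symm))
    · have hyj : col y = j := fin_three_eq_of_ne hk hj hjk.symm cvy.symm hy
      refine mem_image.2 ⟨(z, y), mem_filter.2 ⟨mem_univ _, ?_, ?_, hyj⟩, (triple_swap v z y)⟩
      · dsimp only; rw [triple_swap]; exact heH
      · exact fin_three_eq_of_ne hj hk hjk cvz.symm (fun h => cyz (hyj.trans h.symm))
  have hsplit : ∀ c : V → Fin 3, (H.filter (fun e => (e.image c).card = 3)).card =
      (H.filter (fun e => (e.image c).card = 3 ∧ v ∈ e)).card +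
        (H.filter (fun e => (e.image c).card = 3 ∧ v ∉ e)).card := fun c => by
    rw [← card_filter_add_card_filter_not (s := H.filter (fun e => (e.image c).card = 3))
      (fun e => v ∈ e), filter_filter, filter_filter]
  have hrest : H.filter (fun e => (e.image col').card = 3 ∧ v ∉ e) =
      H.filter (fun e => (e.image col).card = 3 ∧ v ∉ e) := by
    refine filter_congr fun e _ => and_congr_left fun hve => ?_
    rw [image_congr (g := col) fun u hu => hne' u fun h => hve (h ▸ mem_coe.1 hu)]
  have := hmax col'
  rw [hsplit, hsplit col, hrest] at this
  omega

theorem card_colLink_mul_le_card_homsApex {V : Type*} [DecidableEq V] [Fintype V]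
    (H : Finset (Finset V)) (col : V → Fin 3) (v : V) {i j k : Fin 3}
    (hij : i ≠ j) (hik : i ≠ k) (hjk : j ≠ k) :
    (colLink H col v i i).card * ((colClass col j).card * (colClass col k).card) ≤
      (homsApex H v).card + 2 * ((missing H col).card * Fintype.card V) := by
  set B1 := (univ : Finset (V × V × V × V)).filter (fun p => (p.1, p.2.2) ∈ missing H col) with hB1
  set B2 := (univ : Finset (V × V × V × V)).filter (fun p => p.2 ∈ missing H col) with hB2
  have b1 : B1.card ≤ (missing H col).card * Fintype.card V := by
    rw [← card_univ (α := V), ← card_product]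
    refine card_le_card_of_injOn (fun p => ((p.1, p.2.2), p.2.1)) ?_ ?_
    · intro p hp
      exact mem_coe.2 (mem_product.2 ⟨(mem_filter.1 (mem_coe.1 hp)).2, mem_univ _⟩)
    · rintro ⟨a, b, c, d⟩ - ⟨a', b', c', d'⟩ - h
      simp only [Prod.mk.injEq] at h ⊢
      tauto
  have b2 : B2.card ≤ (missing H col).card * Fintype.card V := by
    rw [← card_univ (α := V), ← card_product]
    refine card_le_card_of_injOn (fun p => (p.2, p.1)) ?_ ?_
    · intro p hp
      exact mem_coe.2 (mem_product.2 ⟨(mem_filter.1 (mem_coe.1 hp)).2, mem_univ _⟩)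
    · rintro ⟨a, b, c, d⟩ - ⟨a', b', c', d'⟩ - h
      simp only [Prod.mk.injEq] at h ⊢
      tauto
  have hle : (colLink H col v i i).card * ((colClass col j).card * (colClass col k).card) ≤
      (homsApex H v ∪ B1 ∪ B2).card := by
    rw [← card_product, ← card_product]
    refine card_le_card_of_injOn (fun x => (x.1.1, x.1.2, x.2.1, x.2.2)) ?_ ?_
    · rintro ⟨⟨y, z⟩, p, r⟩ hx
      obtain ⟨h1, h2⟩ := mem_product.1 (mem_coe.1 hx)
      obtain ⟨hp, hr⟩ := mem_product.1 h2
      obtain ⟨-, hv, hy, hz⟩ := mem_filter.1 h1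
      obtain ⟨-, hp⟩ := mem_filter.1 hp
      obtain ⟨-, hr⟩ := mem_filter.1 hr
      dsimp only at hv hy hz hp hr
      rw [mem_coe, mem_union, mem_union]
      by_cases m1 : ({y, p, r} : Finset V) ∈ H
      · by_cases m2 : ({z, p, r} : Finset V) ∈ H
        · exact Or.inl (Or.inl (mem_filter.2 ⟨mem_univ _, hv, m1, m2⟩))
        · refine Or.inr (mem_filter.2 ⟨mem_univ _, mem_filter.2 ⟨mem_univ _, ?_, m2⟩⟩)
          dsimp only; rw [hz, hp, hr]; exact ⟨hij, hik, hjk⟩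
      · refine Or.inl (Or.inr (mem_filter.2 ⟨mem_univ _, mem_filter.2 ⟨mem_univ _, ?_, m1⟩⟩))
        dsimp only; rw [hy, hp, hr]; exact ⟨hij, hik, hjk⟩
    · rintro ⟨⟨a, b⟩, c, d⟩ - ⟨⟨a', b'⟩, c', d'⟩ - h
      simp only [Prod.mk.injEq] at h ⊢
      tauto
  have := card_union_le (homsApex H v ∪ B1) B2
  have := card_union_le (homsApex H v) B1
  omega

theorem card_colLink_mul_le_card_homsBase {V : Type*} [DecidableEq V] [Fintype V]
    (H : Finset (Finset V)) (col : V → Fin 3) (v : V) {i j k : Fin 3}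
    (hij : i ≠ j) (hik : i ≠ k) (hjk : j ≠ k) :
    (colLink H col v i j).card * (colLink H col v k j).card ≤
      (homsBase H v).card + (missing H col).card * Fintype.card V := by
  set B := (univ : Finset (V × V × V × V)).filter
    (fun p => (p.1, p.2.1, p.2.2.1) ∈ missing H col) with hB
  have b : B.card ≤ (missing H col).card * Fintype.card V := by
    rw [← card_univ (α := V), ← card_product]
    refine card_le_card_of_injOn (fun p => ((p.1, p.2.1, p.2.2.1), p.2.2.2)) ?_ ?_
    · intro p hp
      exact mem_coe.2 (mem_product.2 ⟨(mem_filter.1 (mem_coe.1 hp)).2, mem_univ _⟩)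
    · rintro ⟨a, b, c, d⟩ - ⟨a', b', c', d'⟩ - h
      simp only [Prod.mk.injEq] at h ⊢
      tauto
  have hle : (colLink H col v i j).card * (colLink H col v k j).card ≤
      (homsBase H v ∪ B).card := by
    rw [← card_product]
    refine card_le_card_of_injOn (fun x => (x.1.1, x.1.2, x.2.1, x.2.2)) ?_ ?_
    · rintro ⟨⟨y, z⟩, p, r⟩ hx
      obtain ⟨h1, h2⟩ := mem_product.1 (mem_coe.1 hx)
      obtain ⟨-, hv, hy, hz⟩ := mem_filter.1 h1
      obtain ⟨-, hw, hp, hr⟩ := mem_filter.1 h2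
      dsimp only at hv hy hz hw hp hr
      rw [mem_coe, mem_union]
      by_cases m : ({y, z, p} : Finset V) ∈ H
      · exact Or.inl (mem_filter.2 ⟨mem_univ _, hv, hw, m⟩)
      · refine Or.inr (mem_filter.2 ⟨mem_univ _, mem_filter.2 ⟨mem_univ _, ?_, m⟩⟩)
        dsimp only; rw [hy, hz, hp]; exact ⟨hij, hik, hjk⟩
    · rintro ⟨⟨a, b⟩, c, d⟩ - ⟨⟨a', b'⟩, c', d'⟩ - h
      simp only [Prod.mk.injEq] at h ⊢
      tauto
  have := card_union_le (homsBase H v) B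
  omega

theorem card_monoLink_le_sum {V : Type*} [DecidableEq V] [Fintype V] (H : Finset (Finset V))
    (col : V → Fin 3) (v : V) :
    (monoLink H col v).card ≤ ∑ j, (colLink H col v (col v) j).card := by
  refine (card_le_card fun p hp => ?_).trans card_biUnion_le
  obtain ⟨-, h1, h2⟩ := mem_filter.1 hp
  exact mem_biUnion.2 ⟨col p.2, mem_univ _, mem_filter.2 ⟨mem_univ _, h1, h2, rfl⟩⟩

theorem exists_fin_three_ne (i : Fin 3) : ∃ j k : Fin 3, i ≠ j ∧ i ≠ k ∧ j ≠ k := by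
  revert i; decide

theorem exists_fin_three_ne_of_ne {i j : Fin 3} (h : i ≠ j) : ∃ k : Fin 3, i ≠ k ∧ j ≠ k := by
  revert i j; decide

/-- Apart from vertices in many homomorphic copies of `F_5`, few pairs in a link have a vertex
of the colour of the centre. -/
theorem card_monoLink_le {V : Type*} [DecidableEq V] [Fintype V] {H : Finset (Finset V)}
    (h3 : ∀ e ∈ H, e.card = 3) {col : V → Fin 3}
    (hmax : ∀ col' : V → Fin 3, (H.filter (fun e => (e.image col').card = 3)).card ≤
      (H.filter (fun e => (e.image col).card = 3)).card) {c γ : ℝ} (hc : 0 < c)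
    (hγc : γ ≤ c / 720) (hγc2 : γ ≤ c ^ 2 / 12)
    (hmiss : ((missing H col).card : ℝ) ≤ 6 * γ * (Fintype.card V : ℝ) ^ 3)
    (hP : ∀ j k, j ≠ k → (Fintype.card V : ℝ) ^ 2 / 30 ≤
      (colClass col j).card * (colClass col k).card) {v : V}
    (hA : ((homsApex H v).card : ℝ) < c / 60 * (Fintype.card V : ℝ) ^ 4)
    (hB : ((homsBase H v).card : ℝ) < c ^ 2 / 2 * (Fintype.card V : ℝ) ^ 4) :
    ((monoLink H col v).card : ℝ) ≤ 3 * c * (Fintype.card V : ℝ) ^ 2 := by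
  set n : ℝ := (Fintype.card V : ℝ) with hn
  have hn0 : 0 ≤ n := by positivity
  have hmn : ((missing H col).card : ℝ) * n ≤ 6 * γ * n ^ 4 := by
    calc ((missing H col).card : ℝ) * n ≤ 6 * γ * n ^ 3 * n := by gcongr
      _ = _ := by ring
  suffices h : ∀ j, ((colLink H col v (col v) j).card : ℝ) ≤ c * n ^ 2 by
    calc ((monoLink H col v).card : ℝ) ≤ ∑ j, ((colLink H col v (col v) j).card : ℝ) := by
          exact_mod_cast card_monoLink_le_sum H col v
      _ ≤ ∑ _j : Fin 3, c * n ^ 2 := sum_le_sum fun j _ => h j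
      _ = _ := by simp; ring
  intro j
  by_contra! hcon
  by_cases hj : col v = j
  · subst hj
    obtain ⟨j, k, hij, hik, hjk⟩ := exists_fin_three_ne (col v)
    have h1 : ((colLink H col v (col v) (col v)).card : ℝ) *
        ((colClass col j).card * (colClass col k).card) ≤
        (homsApex H v).card + 2 * ((missing H col).card * n) := by
      rw [hn]
      exact_mod_cast card_colLink_mul_le_card_homsApex H col v hij hik hjk
    have h2 : c * n ^ 2 * (n ^ 2 / 30) ≤ ((colLink H col v (col v) (col v)).card : ℝ) *
        ((colClass col j).card * (colClass col k).card) :=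
      mul_le_mul hcon.le (hP j k hjk) (by positivity) (by positivity)
    nlinarith [mul_le_mul_of_nonneg_right hγc (show 0 ≤ n ^ 4 by positivity)]
  · obtain ⟨k, hik, hjk⟩ := exists_fin_three_ne_of_ne hj
    have h1 : ((colLink H col v (col v) j).card : ℝ) * (colLink H col v k j).card ≤
        (homsBase H v).card + (missing H col).card * n := by
      rw [hn]
      exact_mod_cast card_colLink_mul_le_card_homsBase H col v hj hik hjk
    have h2 : ((colLink H col v (col v) j).card : ℝ) ≤ (colLink H col v k j).card := by
      exact_mod_cast card_colLink_le h3 hmax v hj hik hjk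
    have h3 : c * n ^ 2 * (c * n ^ 2) ≤
        ((colLink H col v (col v) j).card : ℝ) * (colLink H col v k j).card :=
      mul_le_mul hcon.le (hcon.le.trans h2) (by positivity) (by positivity)
    nlinarith [mul_le_mul_of_nonneg_right hγc2 (show 0 ≤ n ^ 4 by positivity)]

/-- The edges that are not rainbow and in which no vertex of `X` shares its colour. -/
def typicalEdges {V : Type*} [DecidableEq V] (H : Finset (Finset V)) (col : V → Fin 3)
    (X : Finset V) : Finset (Finset V) :=
  H.filter (fun e => (e.image col).card ≠ 3 ∧ ∀ v ∈ e, v ∈ X → ∀ y ∈ e, y ≠ v → col y ≠ col v)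

theorem mem_typicalEdges {V : Type*} [DecidableEq V] {H : Finset (Finset V)} {col : V → Fin 3}
    {X : Finset V} {e : Finset V} : e ∈ typicalEdges H col X ↔ e ∈ H ∧ (e.image col).card ≠ 3 ∧
      ∀ v ∈ e, v ∈ X → ∀ y ∈ e, y ≠ v → col y ≠ col v :=
  mem_filter

theorem card_le_card_typicalEdges_add {V : Type*} [DecidableEq V] [Fintype V]
    {H : Finset (Finset V)} (h3 : ∀ e ∈ H, e.card = 3) (col : V → Fin 3) (X : Finset V) :
    H.card ≤ (H.filter (fun e => (e.image col).card = 3)).card + (typicalEdges H col X).card +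
      ∑ v ∈ X, (monoLink H col v).card := by
  have hsub : H ⊆ (H.filter (fun e => (e.image col).card = 3) ∪ typicalEdges H col X) ∪
      X.biUnion (fun v => (monoLink H col v).image (fun p => ({v, p.1, p.2} : Finset V))) := by
    intro e he
    rw [mem_union, mem_union]
    by_cases hr : (e.image col).card = 3
    · exact Or.inl (Or.inl (mem_filter.2 ⟨he, hr⟩))
    by_cases ht : ∀ v ∈ e, v ∈ X → ∀ y ∈ e, y ≠ v → col y ≠ col v
    · exact Or.inl (Or.inr (mem_typicalEdges.2 ⟨he, hr, ht⟩))
    push Not at ht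
    obtain ⟨v, hve, hvX, y, hye, hyv, hc⟩ := ht
    have hye' : y ∈ e.erase v := mem_erase.2 ⟨hyv, hye⟩
    obtain ⟨z, hz⟩ := card_eq_one.1 (show ((e.erase v).erase y).card = 1 by
      rw [card_erase_of_mem hye', card_erase_of_mem hve, h3 e he])
    have hee : ({v, y, z} : Finset V) = e := by
      rw [← hz, insert_erase hye', insert_erase hve]
    refine Or.inr (mem_biUnion.2 ⟨v, hvX, mem_image.2 ⟨(y, z), ?_, hee⟩⟩)
    exact mem_filter.2 ⟨mem_univ _, by rw [hee]; exact he, hc⟩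
  refine (card_le_card hsub).trans ((card_union_le _ _).trans ?_)
  exact add_le_add (card_union_le _ _) (card_biUnion_le.trans (sum_le_sum fun v _ => card_image_le))

/-- Vertices with few missing pairs do not form monochromatic boxes. -/
theorem monoBoxFree_typicalEdges {V : Type*} [DecidableEq V] [Fintype V]
    {H : Finset (Finset V)} (h3 : ∀ e ∈ H, e.card = 3) {col : V → Fin 3} {t s : ℕ} (ht : 1 ≤ t)
    (hs : 1 ≤ s) {X : Finset V} {μ γ δ : ℝ} (hμ : 0 ≤ μ)
    (hX : ∀ v, v ∉ X → ((missingLink H col v).card : ℝ) ≤ μ * (Fintype.card V : ℝ) ^ 2)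
    (hmiss : ((missing H col).card : ℝ) ≤ 6 * γ * (Fintype.card V : ℝ) ^ 3)
    (hlink : ∀ T S0 S1 : Finset V, T.card = t → S0.card = s → S1.card = s →
      (∀ τ ∈ T, ∀ x ∈ S0, ∀ y ∈ S1, ({τ, x, y} : Finset V) ∈ H) →
      (((univ : Finset (V × V × V)).filter (fun p =>
        ({p.1, p.2.1, p.2.2} : Finset V) ∈ H ∧
        ∀ x ∈ S0 ∪ S1, ({x, p.2.1, p.2.2} : Finset V) ∈ H)).card : ℝ) <
          δ * (Fintype.card V : ℝ) ^ 3)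
    (hP : ∀ i j k, i ≠ j → i ≠ k → j ≠ k →
      (δ + 6 * γ + 2 * s * μ) * (Fintype.card V : ℝ) ^ 3 ≤
      (colClass col i).card * ((colClass col j).card * (colClass col k).card)) :
    MonoBoxFree (typicalEdges H col X) col t s := by
  intro T S0 S1 i hT h0 h1 c0 c1 hbox
  have hboxH : ∀ τ ∈ T, ∀ x ∈ S0, ∀ y ∈ S1, ({τ, x, y} : Finset V) ∈ H :=
    fun τ hτ x hx y hy => (mem_typicalEdges.1 (hbox τ hτ x hx y hy)).1
  obtain ⟨τ, hτ⟩ : T.Nonempty := card_pos.1 (by omega)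
  have hne : ∀ x ∈ S0, ∀ y ∈ S1, x ≠ y := fun x hx y hy =>
    (pairwise_ne_of_card_three (h3 _ (hboxH τ hτ x hx y hy))).2.2
  have hSX : ∀ x ∈ S0 ∪ S1, x ∉ X ∧ col x = i := by
    intro x hx
    rcases mem_union.1 hx with hx | hx
    · obtain ⟨y, hy⟩ : S1.Nonempty := card_pos.1 (by omega)
      refine ⟨fun hxX => ?_, c0 x hx⟩
      exact (mem_typicalEdges.1 (hbox τ hτ x hx y hy)).2.2 x (by simp) hxX y (by simp)
        (hne x hx y hy).symm (by rw [c0 x hx, c1 y hy])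
    · obtain ⟨y, hy⟩ : S0.Nonempty := card_pos.1 (by omega)
      refine ⟨fun hxX => ?_, c1 x hx⟩
      exact (mem_typicalEdges.1 (hbox τ hτ y hy x hx)).2.2 x (by simp) hxX y (by simp)
        (hne y hy x hx) (by rw [c1 x hx, c0 y hy])
  obtain ⟨j, k, hij, hik, hjk⟩ := exists_fin_three_ne i
  set L := (univ : Finset (V × V × V)).filter (fun p =>
    ({p.1, p.2.1, p.2.2} : Finset V) ∈ H ∧
      ∀ x ∈ S0 ∪ S1, ({x, p.2.1, p.2.2} : Finset V) ∈ H) with hL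
  have hsub : colClass col i ×ˢ (colClass col j ×ˢ colClass col k) ⊆
      (L ∪ missing H col) ∪ (S0 ∪ S1).biUnion (fun x => univ ×ˢ missingLink H col x) := by
    rintro ⟨a, p, r⟩ hx
    obtain ⟨ha, h2⟩ := mem_product.1 hx
    obtain ⟨hp, hr⟩ := mem_product.1 h2
    obtain ⟨-, ha⟩ := mem_filter.1 ha
    obtain ⟨-, hp⟩ := mem_filter.1 hp
    obtain ⟨-, hr⟩ := mem_filter.1 hr
    dsimp only at ha hp hr
    rw [mem_union, mem_union]
    by_cases m1 : ({a, p, r} : Finset V) ∈ H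
    · by_cases m2 : ∀ x ∈ S0 ∪ S1, ({x, p, r} : Finset V) ∈ H
      · exact Or.inl (Or.inl (mem_filter.2 ⟨mem_univ _, m1, m2⟩))
      · push Not at m2
        obtain ⟨x, hxS, hxH⟩ := m2
        refine Or.inr (mem_biUnion.2 ⟨x, hxS, mem_product.2 ⟨mem_univ _, mem_filter.2
          ⟨mem_univ _, mem_filter.2 ⟨mem_univ _, ?_, hxH⟩⟩⟩⟩)
        dsimp only; rw [(hSX x hxS).2, hp, hr]; exact ⟨hij, hik, hjk⟩
    · refine Or.inl (Or.inr (mem_filter.2 ⟨mem_univ _, ?_, m1⟩))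
      dsimp only; rw [ha, hp, hr]; exact ⟨hij, hik, hjk⟩
  have hLc := hlink T S0 S1 hT h0 h1 hboxH
  rw [← hL] at hLc
  have hcount : ((colClass col i).card : ℝ) * ((colClass col j).card * (colClass col k).card) ≤
      L.card + (missing H col).card +
        ∑ x ∈ S0 ∪ S1, (Fintype.card V : ℝ) * (missingLink H col x).card := by
    have h := (card_le_card hsub).trans ((card_union_le _ _).trans
      (add_le_add (card_union_le _ _) card_biUnion_le))
    simp only [card_product, card_univ] at h
    exact_mod_cast h
  have hsum : ∑ x ∈ S0 ∪ S1, (Fintype.card V : ℝ) * (missingLink H col x).card ≤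
      2 * s * μ * (Fintype.card V : ℝ) ^ 3 := by
    calc ∑ x ∈ S0 ∪ S1, (Fintype.card V : ℝ) * (missingLink H col x).card
        ≤ ∑ x ∈ S0 ∪ S1, (Fintype.card V : ℝ) * (μ * (Fintype.card V : ℝ) ^ 2) :=
          sum_le_sum fun x hx => mul_le_mul_of_nonneg_left (hX x (hSX x hx).1) (by positivity)
      _ = ((S0 ∪ S1).card : ℝ) * (μ * (Fintype.card V : ℝ) ^ 3) := by
          rw [sum_const, nsmul_eq_mul]; ring
      _ ≤ ((2 * s : ℕ) : ℝ) * (μ * (Fintype.card V : ℝ) ^ 3) := by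
          gcongr
          exact (card_union_le _ _).trans (by omega)
      _ = _ := by push_cast; ring
  linarith [hP i j k hij hik hjk]

/-- Trimming the larger colour classes to size `q` loses a small proportion of the edges. -/
theorem card_le_of_monoBoxFree_of_colClass {V : Type*} [DecidableEq V] [Fintype V]
    {G : Finset (Finset V)} {col : V → Fin 3} {t s : ℕ} (ht : 1 ≤ t) (hs : 1 ≤ s)
    (h3 : ∀ e ∈ G, e.card = 3) (hr : ∀ e ∈ G, (e.image col).card ≠ 3)
    (hG : MonoBoxFree G col t s) {q : ℕ} (hq : 0 < q) {β : ℝ} (hβ : 0 ≤ β)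
    (hP : ∀ i, ((colClass col i).card : ℝ) ≤ q + β * (3 * q)) :
    (G.card : ℝ) ≤ 6 * exBip q q t s + 3 * exThree q (Ktss t s) + 9 * β * G.card := by
  classical
  obtain ⟨f, hfG⟩ : ∃ f : V → ℕ, ∀ v, (G.filter (fun e => v ∈ e)).card = f v :=
    ⟨_, fun v => rfl⟩
  have hf : ∑ v, f v = 3 * G.card := by
    simp only [← hfG, card_filter]
    rw [sum_comm]
    simp only [← card_filter]
    rw [mul_comm, ← smul_eq_mul, ← sum_const]
    refine sum_congr rfl fun e he => ?_
    rw [filter_mem_eq_inter, univ_inter, h3 e he]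
  have hf' : ∑ i, ∑ v ∈ colClass col i, f v = 3 * G.card := by
    rw [← hf]
    exact sum_fiberwise univ col f
  choose Y hYP hYc hYs using fun i => exists_subset_card_mul_sum_le (colClass col i) f
    (Nat.sub_le (colClass col i).card q)
  have hY : ∀ i, ((∑ v ∈ Y i, f v : ℕ) : ℝ) ≤ 3 * β * (∑ v ∈ colClass col i, f v : ℕ) := by
    intro i
    rcases le_or_gt (colClass col i).card q with hle | hlt
    · have : Y i = ∅ := card_eq_zero.1 (by rw [hYc]; omega)
      rw [this, sum_empty, Nat.cast_zero]
      exact mul_nonneg (by positivity) (Nat.cast_nonneg _)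
    · have h1 : ((colClass col i).card : ℝ) * (∑ v ∈ Y i, f v : ℕ) ≤
          (((colClass col i).card : ℝ) - q) * (∑ v ∈ colClass col i, f v : ℕ) := by
        rw [← Nat.cast_sub hlt.le]
        exact_mod_cast hYs i
      have h2 : (q : ℝ) ≤ (colClass col i).card := by exact_mod_cast hlt.le
      have hq' : (0 : ℝ) < q := by exact_mod_cast hq
      refine le_of_mul_le_mul_left ?_ hq'
      calc (q : ℝ) * (∑ v ∈ Y i, f v : ℕ) ≤ (colClass col i).card * (∑ v ∈ Y i, f v : ℕ) := by
            gcongr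
        _ ≤ (((colClass col i).card : ℝ) - q) * (∑ v ∈ colClass col i, f v : ℕ) := h1
        _ ≤ (β * (3 * q)) * (∑ v ∈ colClass col i, f v : ℕ) := by
            gcongr
            linarith [hP i]
        _ = _ := by ring
  let U : Fin 3 → Finset V := fun i => colClass col i \ Y i
  let G' := G.filter (fun e => ∀ v ∈ e, v ∈ U (col v))
  have hG' : G'.card ≤ 6 * exBip q q t s + 3 * exThree q (Ktss t s) := by
    refine card_le_of_monoBoxFree (U := U) ht hs (fun e he => h3 e (mem_filter.1 he).1)
      (fun e he => hr e (mem_filter.1 he).1) ?_ hq ?_ ?_ (fun e he => (mem_filter.1 he).2)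
    · exact fun T S0 S1 k hT h0 h1 c0 c1 hbox => hG T S0 S1 k hT h0 h1 c0 c1
        fun τ hτ x hx y hy => (mem_filter.1 (hbox τ hτ x hx y hy)).1
    · intro i
      rw [card_sdiff_of_subset (hYP i), hYc]
      omega
    · exact fun i v hv => (mem_filter.1 (mem_sdiff.1 hv).1).2
  have hloss : G.card ≤ G'.card + ∑ i, ∑ v ∈ Y i, f v := by
    have hsub : G ⊆ G' ∪ univ.biUnion (fun i => (Y i).biUnion
        (fun v => G.filter (fun e => v ∈ e))) := by
      intro e he
      by_cases h : ∀ v ∈ e, v ∈ U (col v)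
      · exact mem_union_left _ (mem_filter.2 ⟨he, h⟩)
      · push Not at h
        obtain ⟨v, hv, hvU⟩ := h
        have hvY : v ∈ Y (col v) := by
          by_contra hn
          exact hvU (mem_sdiff.2 ⟨mem_filter.2 ⟨mem_univ _, rfl⟩, hn⟩)
        exact mem_union_right _ (mem_biUnion.2 ⟨col v, mem_univ _, mem_biUnion.2
          ⟨v, hvY, mem_filter.2 ⟨he, hv⟩⟩⟩)
    refine (card_le_card hsub).trans ((card_union_le _ _).trans (Nat.add_le_add_left ?_ _))
    exact card_biUnion_le.trans (sum_le_sum fun i _ => card_biUnion_le.trans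
      (sum_le_sum fun v _ => (hfG v).le))
  have hsum : ((∑ i, ∑ v ∈ Y i, f v : ℕ) : ℝ) ≤ 9 * β * G.card := by
    calc ((∑ i, ∑ v ∈ Y i, f v : ℕ) : ℝ) = ∑ i, ((∑ v ∈ Y i, f v : ℕ) : ℝ) := by push_cast; rfl
      _ ≤ ∑ i, 3 * β * ((∑ v ∈ colClass col i, f v : ℕ) : ℝ) := sum_le_sum fun i _ => hY i
      _ = 3 * β * ((∑ i, ∑ v ∈ colClass col i, f v : ℕ) : ℝ) := by rw [← mul_sum]; push_cast; rfl
      _ = _ := by rw [hf']; push_cast; ring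
  have h1 : (G.card : ℝ) ≤ G'.card + (∑ i, ∑ v ∈ Y i, f v : ℕ) := by exact_mod_cast hloss
  have h2 : (G'.card : ℝ) ≤ 6 * exBip q q t s + 3 * exThree q (Ktss t s) := by exact_mod_cast hG'
  linarith

/-- Three numbers whose product is nearly maximal are nearly equal. -/
theorem le_of_mul_mul_ge {a b c q β γ : ℝ} (ha : 0 ≤ a) (hb : 0 ≤ b) (hc : 0 ≤ c) (hq : 0 < q)
    (hβ : 0 ≤ β) (hsum : a + b + c = 3 * q) (hγ : 12 * γ ≤ β ^ 2)
    (h : q ^ 3 - γ * (3 * q) ^ 3 ≤ a * b * c) : a ≤ q + β * (3 * q) := by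
  by_contra! hcon
  obtain ⟨x, rfl⟩ : ∃ x, a = q + x := ⟨a - q, by ring⟩
  have hx : β * (3 * q) < x := by linarith
  have hx0 : 0 ≤ β * (3 * q) := by positivity
  have hx2 : x ≤ 2 * q := by linarith
  have hbc : b * c ≤ (q - x / 2) ^ 2 := by
    have : q - x / 2 = (b + c) / 2 := by linarith
    rw [this]
    nlinarith [sq_nonneg (b - c)]
  have h1 : (q + x) * b * c ≤ (q + x) * (q - x / 2) ^ 2 := by
    rw [mul_assoc]
    exact mul_le_mul_of_nonneg_left hbc ha
  have h2 : (q + x) * (q - x / 2) ^ 2 ≤ q ^ 3 - q * x ^ 2 / 4 := by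
    have : 0 ≤ x ^ 2 * (2 * q - x) := mul_nonneg (sq_nonneg x) (by linarith)
    nlinarith
  have h3 : (β * (3 * q)) ^ 2 < x ^ 2 := pow_lt_pow_left₀ hx hx0 (by norm_num)
  have h4 : q * (β * (3 * q)) ^ 2 < q * x ^ 2 := mul_lt_mul_of_pos_left h3 hq
  have h5 : 12 * γ * q ^ 3 ≤ β ^ 2 * q ^ 3 := mul_le_mul_of_nonneg_right hγ (by positivity)
  nlinarith

theorem card_filter_not_rainbow_le {V : Type*} [DecidableEq V] [Fintype V]
    {H : Finset (Finset V)} (h3 : ∀ e ∈ H, e.card = 3) (col : V → Fin 3) :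
    (H.filter (fun e => (e.image col).card ≠ 3)).card ≤
      ((univ : Finset (V × V × V)).filter (fun p =>
        ({p.1, p.2.1, p.2.2} : Finset V) ∈ H ∧ col p.1 = col p.2.1)).card := by
  set S := (univ : Finset (V × V × V)).filter (fun p =>
    ({p.1, p.2.1, p.2.2} : Finset V) ∈ H ∧ col p.1 = col p.2.1) with hS
  have hsub : H.filter (fun e => (e.image col).card ≠ 3) ⊆
      S.image (fun p => ({p.1, p.2.1, p.2.2} : Finset V)) := by
    intro e he
    obtain ⟨heH, her⟩ := mem_filter.1 he
    obtain ⟨x, y, z, rfl, hyz⟩ := exists_eq_triple_of_not_rainbow (h3 e heH) her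
    have hrot := triple_rotate x y z
    refine mem_image.2 ⟨(y, z, x), mem_filter.2 ⟨mem_univ _, ?_, hyz⟩, hrot.symm⟩
    rwa [hrot] at heH
  exact (card_le_card hsub).trans card_image_le

/-- The contribution of the vertices with many missing pairs is dominated by the missing edges. -/
theorem sum_card_monoLink_le {V : Type*} [DecidableEq V] [Fintype V] {H : Finset (Finset V)}
    {col : V → Fin 3} {c : ℝ} (hc : 0 < c) {X E : Finset V}
    (hX : ∀ v ∈ X, 36 * c * (Fintype.card V : ℝ) ^ 2 ≤ (missingLink H col v).card)
    (hE : ∀ v, v ∉ E → ((monoLink H col v).card : ℝ) ≤ 3 * c * (Fintype.card V : ℝ) ^ 2) :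
    ((∑ v ∈ X, (monoLink H col v).card : ℕ) : ℝ) ≤
      E.card * (Fintype.card V : ℝ) ^ 2 + (missingEdges H col).card := by
  set n : ℝ := (Fintype.card V : ℝ) with hn
  have hall : ∀ v, ((monoLink H col v).card : ℝ) ≤ n ^ 2 := by
    intro v
    have : (monoLink H col v).card ≤ Fintype.card V ^ 2 := by
      rw [sq, ← Fintype.card_prod]
      exact card_le_univ _
    rw [hn]
    exact_mod_cast this
  have h1 : ∑ _v ∈ X, 36 * c * n ^ 2 ≤ 6 * ((missingEdges H col).card : ℝ) := by
    have h := (sum_le_univ_sum_of_nonneg (s := X) fun v =>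
      Nat.zero_le (missingLink H col v).card).trans
        ((sum_card_missingLink H col).le.trans (card_missing_le H col))
    refine (sum_le_sum hX).trans ?_
    exact_mod_cast h
  have h2 : ∀ v, ((monoLink H col v).card : ℝ) ≤
      3 * c * n ^ 2 + if v ∈ E then n ^ 2 else 0 := by
    intro v
    split_ifs with hv
    · exact (hall v).trans (le_add_of_nonneg_left (by positivity))
    · rw [add_zero]; exact hE v hv
  have h3 : ∑ v ∈ X, (if v ∈ E then n ^ 2 else 0) ≤ E.card * n ^ 2 := by
    rw [← sum_filter, sum_const, nsmul_eq_mul]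
    gcongr
    exact fun v hv => (mem_filter.1 hv).2
  calc ((∑ v ∈ X, (monoLink H col v).card : ℕ) : ℝ)
      = ∑ v ∈ X, ((monoLink H col v).card : ℝ) := by push_cast; rfl
    _ ≤ ∑ v ∈ X, (3 * c * n ^ 2 + if v ∈ E then n ^ 2 else 0) := sum_le_sum fun v _ => h2 v
    _ = ∑ v ∈ X, 3 * c * n ^ 2 + ∑ v ∈ X, (if v ∈ E then n ^ 2 else 0) := sum_add_distrib
    _ = (∑ v ∈ X, 36 * c * n ^ 2) / 12 + ∑ v ∈ X, (if v ∈ E then n ^ 2 else 0) := by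
        rw [sum_const, sum_const, nsmul_eq_mul, nsmul_eq_mul]; ring
    _ ≤ E.card * n ^ 2 + (missingEdges H col).card := by
        have : (0 : ℝ) ≤ (missingEdges H col).card := Nat.cast_nonneg _
        linarith

theorem exists_forall_mul_sq_le_rpow {s : ℕ} (hs : 2 ≤ s) (K : ℝ) {ε : ℝ} (hε : 0 < ε) :
    ∃ n0 : ℕ, ∀ n : ℕ, n0 ≤ n → K * (n : ℝ) ^ 2 ≤ ε * (n : ℝ) ^ ((3 : ℝ) - 1 / (s : ℝ) ^ 2) := by
  have hlim := (tendsto_rpow_atTop (show (0 : ℝ) < 1 / 2 by norm_num)).comp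
    tendsto_natCast_atTop_atTop
  obtain ⟨n0, hn0⟩ := Filter.eventually_atTop.1 (hlim.eventually_ge_atTop (K / ε))
  refine ⟨max n0 1, fun n hn => ?_⟩
  have hn1 : (1 : ℝ) ≤ n := by exact_mod_cast (le_max_right n0 1).trans hn
  have hK : K / ε ≤ (n : ℝ) ^ (1 / 2 : ℝ) := hn0 n ((le_max_left n0 1).trans hn)
  have hs' : (2 : ℝ) ≤ s := by exact_mod_cast hs
  have hexp : (1 : ℝ) / (s : ℝ) ^ 2 ≤ 1 / 2 :=
    one_div_le_one_div_of_le (by norm_num) (by nlinarith)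
  calc K * (n : ℝ) ^ 2 ≤ ε * (n : ℝ) ^ (1 / 2 : ℝ) * (n : ℝ) ^ 2 := by
        gcongr
        rwa [div_le_iff₀' hε] at hK
    _ = ε * (n : ℝ) ^ ((1 / 2 : ℝ) + 2) := by
        rw [Real.rpow_add (by linarith), Real.rpow_two]; ring
    _ ≤ _ := by
        gcongr
        linarith

/-- The upper bound on the number of edges, with `q ^ 3` in place of `e(T_3(3q,3))`. -/
theorem exists_card_le_of_free {m t s : ℕ} (ht : 1 ≤ t) (hs : 2 ≤ s) (hm : 2 * s ≤ m)
    {ε : ℝ} (hε : 0 < ε) :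
    ∃ n0 : ℕ, ∀ {V : Type} [DecidableEq V] [Fintype V] (H : Finset (Finset V)) (q : ℕ),
      (∀ e ∈ H, e.card = 3) → ¬ HasCopy H (F5Stss m t s hm) → Fintype.card V = 3 * q →
      n0 ≤ Fintype.card V →
      (H.card : ℝ) ≤ (q : ℝ) ^ 3 + 6 * exBip q q t s + 3 * exThree q (Ktss t s) +
        ε * (Fintype.card V : ℝ) ^ ((3 : ℝ) - 1 / (s : ℝ) ^ 2) := by
  have hs1 : 1 ≤ s := by omega
  have hs0 : (0 : ℝ) < s := by exact_mod_cast hs1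
  obtain ⟨C, hC, hbound⟩ := exists_card_le_rpow_of_monoBoxFree t hs1
  obtain ⟨β, hβ, hβ1, hβC⟩ : ∃ β : ℝ, 0 < β ∧ β ≤ 1 / 100 ∧ 9 * β * C ≤ ε / 2 := by
    refine ⟨min (1 / 100) (ε / (18 * C)), by positivity, min_le_left _ _, ?_⟩
    calc 9 * min (1 / 100) (ε / (18 * C)) * C ≤ 9 * (ε / (18 * C)) * C := by
          gcongr; exact min_le_right _ _
      _ = ε / 2 := by field_simp; norm_num
  obtain ⟨c, hc, hcs⟩ : ∃ c : ℝ, 0 < c ∧ 36 * c * s = 1 / 1000 :=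
    ⟨1 / (36000 * s), by positivity, by field_simp; norm_num⟩
  obtain ⟨γ, hγ, hγβ, hγ1, hγc, hγc2⟩ : ∃ γ : ℝ, 0 < γ ∧ 12 * γ ≤ β ^ 2 ∧ γ ≤ 1 / 1000 ∧
      γ ≤ c / 720 ∧ γ ≤ c ^ 2 / 12 := by
    refine ⟨min (min (β ^ 2 / 12) (1 / 1000)) (min (c / 720) (c ^ 2 / 12)), by positivity,
      ?_, (min_le_left _ _).trans (min_le_right _ _), (min_le_right _ _).trans (min_le_left _ _),
      (min_le_right _ _).trans (min_le_right _ _)⟩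
    have := (min_le_left (min (β ^ 2 / 12) (1 / 1000)) (min (c / 720) (c ^ 2 / 12))).trans
      (min_le_left _ _)
    linarith
  obtain ⟨K1, hK1⟩ := card_homsApex_lt ht hs hm (show 0 < c / 60 by positivity)
  obtain ⟨K2, hK2⟩ := card_homsBase_lt ht hs hm (show 0 < c ^ 2 / 2 by positivity)
  obtain ⟨n1, hn1⟩ := exists_coloring ht hs hm hγ
  obtain ⟨n2, hn2⟩ := card_common_link_lt ht hs hm (show (0 : ℝ) < 1 / 100 by norm_num)
  obtain ⟨n3, hn3⟩ := exists_forall_mul_sq_le_rpow hs (K1 + K2 : ℝ) (half_pos hε)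
  refine ⟨max (max n1 n2) (max n3 1), ?_⟩
  intro V _ _ H q h3 hF hV hn
  rw [max_le_iff, max_le_iff, max_le_iff] at hn
  obtain ⟨⟨hN1, hN2⟩, hN3, hN4⟩ := hn
  have hq : 0 < q := by omega
  have hq' : (0 : ℝ) < q := by exact_mod_cast hq
  have hnq : (Fintype.card V : ℝ) = 3 * q := by rw [hV]; push_cast; rfl
  rcases le_or_gt ((q : ℝ) ^ 3) H.card with hHq | hHq
  swap
  · have : 0 ≤ ε * (Fintype.card V : ℝ) ^ ((3 : ℝ) - 1 / (s : ℝ) ^ 2) := by positivity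
    have h1 : (0 : ℝ) ≤ exBip q q t s := Nat.cast_nonneg _
    have h2 : (0 : ℝ) ≤ exThree q (Ktss t s) := Nat.cast_nonneg _
    linarith
  obtain ⟨col0, hcol0⟩ := hn1 H h3 hF hN1 (by rw [hnq]; linarith [mul_pow (3 : ℝ) q 3])
  obtain ⟨col, hmax⟩ : ∃ col : V → Fin 3, ∀ col' : V → Fin 3,
      (H.filter (fun e => (e.image col').card = 3)).card ≤
        (H.filter (fun e => (e.image col).card = 3)).card :=
    Finite.exists_max (fun col : V → Fin 3 => (H.filter (fun e => (e.image col).card = 3)).card)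
  set R : ℝ := ((H.filter (fun e => (e.image col).card = 3)).card : ℝ) with hR
  set M : ℝ := ((missingEdges H col).card : ℝ) with hM
  have hR0 : (H.card : ℝ) - γ * (3 * q) ^ 3 ≤ R := by
    have h1 : ((H.filter (fun e => (e.image col0).card ≠ 3)).card : ℝ) ≤ γ * (3 * q) ^ 3 := by
      rw [← hnq]
      exact le_trans (by exact_mod_cast card_filter_not_rainbow_le h3 col0) hcol0
    have h2 : (H.card : ℝ) = (H.filter (fun e => (e.image col0).card = 3)).card +
        (H.filter (fun e => (e.image col0).card ≠ 3)).card := by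
      exact_mod_cast (card_filter_add_card_filter_not (s := H)
        (fun e => (e.image col0).card = 3)).symm
    have h3 : ((H.filter (fun e => (e.image col0).card = 3)).card : ℝ) ≤ R := by
      rw [hR]
      exact_mod_cast hmax col0
    linarith
  set a : Fin 3 → ℝ := fun i => ((colClass col i).card : ℝ) with ha
  have ha0 : ∀ i, 0 ≤ a i := fun i => Nat.cast_nonneg _
  have hsumN : (colClass col 0).card + (colClass col 1).card + (colClass col 2).card = 3 * q := by
    have h := card_eq_sum_card_fiberwise (s := univ) (f := col) (t := univ)
      (fun _ _ => mem_coe.2 (mem_univ _))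
    rw [Fin.sum_univ_three, card_univ, hV] at h
    exact h.symm
  have hsum : a 0 + a 1 + a 2 = 3 * q := by
    simp only [ha]
    exact_mod_cast hsumN
  have hprod : R + M ≤ a 0 * a 1 * a 2 := by
    simp only [ha, hR, hM]
    exact_mod_cast card_rainbow_add_card_missingEdges_le h3 col
  have hprodq : a 0 * a 1 * a 2 ≤ (q : ℝ) ^ 3 := by
    simp only [ha]
    exact_mod_cast mul_mul_le_pow_three hsumN
  have hM0 : 0 ≤ M := Nat.cast_nonneg _
  have hprod0 : (q : ℝ) ^ 3 - γ * (3 * q) ^ 3 ≤ a 0 * a 1 * a 2 := by linarith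
  have hmiss : ((missing H col).card : ℝ) ≤ 6 * γ * (Fintype.card V : ℝ) ^ 3 := by
    have h : ((missing H col).card : ℝ) ≤ 6 * M := by
      rw [hM]
      exact_mod_cast card_missing_le H col
    rw [hnq]
    linarith
  have hup : ∀ i, a i ≤ q + β * (3 * q) := by
    have h0 := le_of_mul_mul_ge (ha0 0) (ha0 1) (ha0 2) hq' hβ.le hsum hγβ hprod0
    have h1 := le_of_mul_mul_ge (ha0 1) (ha0 2) (ha0 0) hq' hβ.le (by linarith) hγβ
      (hprod0.trans (by linarith))
    have h2 := le_of_mul_mul_ge (ha0 2) (ha0 0) (ha0 1) hq' hβ.le (by linarith) hγβ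
      (hprod0.trans (by linarith))
    intro i
    fin_cases i
    exacts [h0, h1, h2]
  have hlow : ∀ i, 9 / 10 * q ≤ a i := by
    have hβq : β * (3 * q) ≤ 1 / 100 * (3 * q) := by gcongr
    have h0 := hup 0
    have h1 := hup 1
    have h2 := hup 2
    intro i
    fin_cases i
    · change 9 / 10 * (q : ℝ) ≤ a 0; linarith
    · change 9 / 10 * (q : ℝ) ≤ a 1; linarith
    · change 9 / 10 * (q : ℝ) ≤ a 2; linarith
  have hpair : ∀ j k, 81 / 100 * (q : ℝ) ^ 2 ≤ a j * a k := fun j k =>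
    calc 81 / 100 * (q : ℝ) ^ 2 = (9 / 10 * q) * (9 / 10 * q) := by ring
      _ ≤ a j * a k := mul_le_mul (hlow j) (hlow k) (by positivity) (ha0 j)
  set X := univ.filter (fun v => 36 * c * (Fintype.card V : ℝ) ^ 2 ≤ (missingLink H col v).card)
    with hX
  have hfree : MonoBoxFree (typicalEdges H col X) col t s := by
    refine monoBoxFree_typicalEdges (μ := 36 * c) (γ := γ) (δ := 1 / 100) h3 ht hs1 (by positivity)
      (fun v hv => ?_) hmiss (fun T S0 S1 hT h0 h1 hbox => hn2 H h3 hF hN2 T S0 S1 hT h0 h1 hbox)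
      fun i j k _ _ _ => ?_
    · by_contra! hcon
      exact hv (mem_filter.2 ⟨mem_univ _, hcon.le⟩)
    · have h1 : 9 / 10 * (q : ℝ) * (81 / 100 * (q : ℝ) ^ 2) ≤ a i * (a j * a k) :=
        mul_le_mul (hlow i) (hpair j k) (by positivity) (ha0 i)
      have h2 : (1 / 100 + 6 * γ + 2 * s * (36 * c)) ≤ 18 / 1000 := by linarith
      rw [hnq]
      calc (1 / 100 + 6 * γ + 2 * s * (36 * c)) * (3 * (q : ℝ)) ^ 3
          ≤ 18 / 1000 * (3 * (q : ℝ)) ^ 3 := by gcongr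
        _ ≤ 9 / 10 * (q : ℝ) * (81 / 100 * (q : ℝ) ^ 2) := by
            nlinarith [show (0 : ℝ) < (q : ℝ) ^ 3 by positivity]
        _ ≤ _ := h1
  set G := typicalEdges H col X with hG
  have hGH : ∀ e ∈ G, e.card = 3 := fun e he => h3 e (mem_typicalEdges.1 he).1
  have hGr : ∀ e ∈ G, (e.image col).card ≠ 3 := fun e he => (mem_typicalEdges.1 he).2.1
  have hG1 := card_le_of_monoBoxFree_of_colClass ht hs1 hGH hGr hfree hq hβ.le hup
  have hG2 := hbound G col hGH hGr ht hfree
  set N : ℝ := (Fintype.card V : ℝ) ^ ((3 : ℝ) - 1 / (s : ℝ) ^ 2) with hN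
  have hN0 : 0 ≤ N := by positivity
  set E := univ.filter (fun v => c / 60 * (Fintype.card V : ℝ) ^ 4 ≤ (homsApex H v).card) ∪
    univ.filter (fun v => c ^ 2 / 2 * (Fintype.card V : ℝ) ^ 4 ≤ (homsBase H v).card) with hE
  have hEc : (E.card : ℝ) ≤ K1 + K2 := by
    have h := (card_union_le _ _).trans (add_le_add (hK1 H h3 hF).le (hK2 H h3 hF).le)
    exact (Nat.cast_le.2 h).trans (Nat.cast_add K1 K2).le
  have hmono : ((∑ v ∈ X, (monoLink H col v).card : ℕ) : ℝ) ≤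
      E.card * (Fintype.card V : ℝ) ^ 2 + M := by
    refine sum_card_monoLink_le hc (fun v hv => (mem_filter.1 hv).2) fun v hv => ?_
    rw [hE, mem_union, not_or] at hv
    refine card_monoLink_le h3 hmax hc hγc hγc2 hmiss (fun j k _ => ?_) ?_ ?_
    · refine le_trans ?_ (hpair j k)
      rw [hnq]
      nlinarith [show (0 : ℝ) < (q : ℝ) ^ 2 by positivity]
    · by_contra! hcon
      exact hv.1 (mem_filter.2 ⟨mem_univ _, hcon⟩)
    · by_contra! hcon
      exact hv.2 (mem_filter.2 ⟨mem_univ _, hcon⟩)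
  have hH : (H.card : ℝ) ≤ R + G.card + (∑ v ∈ X, (monoLink H col v).card : ℕ) := by
    rw [hR, hG]
    exact_mod_cast card_le_card_typicalEdges_add h3 col X
  have hEN : (E.card : ℝ) * (Fintype.card V : ℝ) ^ 2 ≤ ε / 2 * N :=
    (mul_le_mul_of_nonneg_right hEc (by positivity)).trans (hn3 _ hN3)
  have hGN : 9 * β * (G.card : ℝ) ≤ ε / 2 * N := by
    calc 9 * β * (G.card : ℝ) ≤ 9 * β * (C * N) := by gcongr
      _ = 9 * β * C * N := by ring
      _ ≤ ε / 2 * N := by gcongr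
  linarith

theorem statement2 (m t s : ℕ) (ht : 1 ≤ t) (hs : 2 ≤ s) (hm : 2*s ≤ m)
    (ε : ℝ) (hε : 0 < ε) :
    ∃ n0 : ℕ, ∀ n : ℕ, n ≥ n0 → 3 ∣ n →
    (exThree n (F5Stss m t s hm) : ℝ) ≤
      ((T3 n).card : ℝ) + 6 * (exBip (n/3) (n/3) t s : ℝ) + 3 * (exThree (n/3) (Ktss t s) : ℝ)
        + ε * (n : ℝ) ^ ((3 : ℝ) - 1/((s : ℝ)^2)) := by
  obtain ⟨n0, hn0⟩ := exists_card_le_of_free ht hs hm hε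
  refine ⟨n0, ?_⟩
  rintro n hn ⟨q, rfl⟩
  rw [Nat.mul_div_cancel_left q (by norm_num)]
  refine le_trans (Nat.cast_le.2 (csSup_le' ?_)) (Nat.floor_le (by positivity))
  rintro k ⟨H, h3, hF, rfl⟩
  refine Nat.le_floor ?_
  have h := hn0 H q h3 hF (Fintype.card_fin _) (by rwa [Fintype.card_fin])
  have hT : (q : ℝ) ^ 3 ≤ (T3 (3 * q)).card := by exact_mod_cast pow_three_le_card_T3 q
  rw [Fintype.card_fin] at h
  linarith
end

section
/- For all positive integers m, t, s with m ≥ 2s ≥ 4 there exists n_0 such that for all n ≥ n_0: ex_3(n, F_5^S(m,t,K_{s,s})) ≥ e(T_3(n,3)) + 3·ex_3(⌊n/3⌋, K_{t,s,s}). -/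
open Finset

lemma bddAbove_card_finset {α : Type*} [Fintype α] (P : Finset α → Prop) :
    BddAbove {k | ∃ H : Finset α, P H ∧ H.card = k} := by
  refine ⟨Fintype.card α, ?_⟩
  rintro k ⟨H, -, rfl⟩
  exact H.card_le_univ

lemma exists_card_eq_exThree {W : Type*} [DecidableEq W] (n : ℕ) {F : Finset (Finset W)}
    (hF : F.Nonempty) :
    ∃ H : Finset (Finset (Fin n)),
      (∀ e ∈ H, e.card = 3) ∧ ¬ HasCopy H F ∧ H.card = exThree n F := by
  refine Nat.sSup_mem (s := {k | ∃ H : Finset (Finset (Fin n)),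
    (∀ e ∈ H, e.card = 3) ∧ ¬ HasCopy H F ∧ H.card = k}) ⟨0, ∅, by simp, ?_, rfl⟩ ?_
  · rintro ⟨f, hf⟩
    obtain ⟨e, he⟩ := hF
    simpa using hf e he
  · simpa only [and_assoc] using bddAbove_card_finset
      (fun H : Finset (Finset (Fin n)) => (∀ e ∈ H, e.card = 3) ∧ ¬ HasCopy H F)

lemma card_le_exThree {W : Type*} [DecidableEq W] {n : ℕ} {F : Finset (Finset W)}
    {H : Finset (Finset (Fin n))} (h3 : ∀ e ∈ H, e.card = 3) (hH : ¬ HasCopy H F) :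
    H.card ≤ exThree n F := by
  refine le_csSup ?_ ⟨H, h3, hH, rfl⟩
  simpa only [and_assoc] using bddAbove_card_finset
    (fun H : Finset (Finset (Fin n)) => (∀ e ∈ H, e.card = 3) ∧ ¬ HasCopy H F)

/-- The embedding of `Fin (n / 3)` into the `i`-th part of the balanced tripartition. -/
def partEmb (n : ℕ) (i : Fin 3) : Fin (n / 3) ↪ Fin n where
  toFun k := ⟨3 * k + i, by omega⟩
  inj' a b h := by
    simp only [Fin.mk.injEq] at h
    omega

@[simp]
lemma partEmb_val (n : ℕ) (i : Fin 3) (k : Fin (n / 3)) :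
    (partEmb n i k : ℕ) = 3 * k + i := rfl

/-- `T_3(n,3)` with a copy of `G` placed inside each part. -/
def T3With (n : ℕ) (G : Finset (Finset (Fin (n / 3)))) : Finset (Finset (Fin n)) :=
  T3 n ∪ Finset.univ.biUnion (fun i : Fin 3 => G.image (fun e => e.image (partEmb n i)))

lemma eq_of_mod_eq_of_mem_T3 {n : ℕ} {e : Finset (Fin n)} (he : e ∈ T3 n) {x y : Fin n}
    (hx : x ∈ e) (hy : y ∈ e) (hxy : (x : ℕ) % 3 = (y : ℕ) % 3) : x = y := by
  simp only [T3, mem_filter, mem_univ, true_and] at he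
  have h := he.2 ⟨(x : ℕ) % 3, Nat.mod_lt _ (by norm_num)⟩
  refine Finset.card_le_one.1 h.le x ?_ y ?_ <;> simp [turanPart, hx, hy, hxy]

lemma triple_mem_T3 {n : ℕ} {x y z : Fin n} (hx : (x : ℕ) % 3 = 0) (hy : (y : ℕ) % 3 = 1)
    (hz : (z : ℕ) % 3 = 2) : ({x, y, z} : Finset (Fin n)) ∈ T3 n := by
  have hxy : x ≠ y := by rintro rfl; omega
  have hxz : x ≠ z := by rintro rfl; omega
  have hyz : y ≠ z := by rintro rfl; omega
  simp only [T3, mem_filter, mem_univ, true_and]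
  refine ⟨Finset.card_eq_three.2 ⟨x, y, z, hxy, hxz, hyz, rfl⟩, fun i => Finset.card_eq_one.2 ?_⟩
  fin_cases i
  · refine ⟨x, ?_⟩
    ext v
    simp only [turanPart, mem_inter, mem_insert, mem_singleton, mem_filter, mem_univ, true_and]
    grind
  · refine ⟨y, ?_⟩
    ext v
    simp only [turanPart, mem_inter, mem_insert, mem_singleton, mem_filter, mem_univ, true_and]
    grind
  · refine ⟨z, ?_⟩
    ext v
    simp only [turanPart, mem_inter, mem_insert, mem_singleton, mem_filter, mem_univ, true_and]
    grind

lemma mem_T3With {n : ℕ} {G : Finset (Finset (Fin (n / 3)))} {e : Finset (Fin n)} :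
    e ∈ T3With n G ↔ e ∈ T3 n ∨ ∃ i : Fin 3, ∃ d ∈ G, d.image (partEmb n i) = e := by
  simp [T3With]

lemma card_eq_three_of_mem_T3With {n : ℕ} {G : Finset (Finset (Fin (n / 3)))}
    (hG : ∀ e ∈ G, e.card = 3) {e : Finset (Fin n)} (he : e ∈ T3With n G) : e.card = 3 := by
  rcases mem_T3With.1 he with h | ⟨i, d, hd, rfl⟩
  · exact (Finset.mem_filter.1 h).2.1
  · rw [Finset.card_image_of_injective _ (partEmb n i).injective, hG d hd]

lemma card_T3With {n : ℕ} {G : Finset (Finset (Fin (n / 3)))} (hG : ∀ e ∈ G, e.card = 3) :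
    (T3With n G).card = (T3 n).card + 3 * G.card := by
  rw [T3With, Finset.card_union_of_disjoint, Finset.card_biUnion]
  · simp [Finset.card_image_of_injective _
      (Finset.image_injective (partEmb n _).injective)]
  · intro i _ j _ hij
    simp only [Function.onFun, Finset.disjoint_left, mem_image, not_exists, not_and]
    rintro _ ⟨d, hd, rfl⟩ c hc h
    obtain ⟨a, ha⟩ : d.Nonempty := Finset.card_pos.1 (by rw [hG d hd]; norm_num)
    have hm : partEmb n i a ∈ c.image (partEmb n j) := by
      rw [h]; exact Finset.mem_image_of_mem _ ha
    obtain ⟨b, -, hb⟩ := Finset.mem_image.1 hm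
    have hv := congrArg Fin.val hb
    simp only [partEmb_val] at hv
    omega
  · rw [Finset.disjoint_left]
    intro e he h
    simp only [mem_biUnion, mem_univ, true_and, mem_image] at h
    obtain ⟨i, d, hd, rfl⟩ := h
    obtain ⟨a, ha, b, hb, hab⟩ := Finset.one_lt_card.1 (by rw [hG d hd]; norm_num : 1 < d.card)
    refine hab ((partEmb n i).injective (eq_of_mod_eq_of_mem_T3 he
      (Finset.mem_image_of_mem _ ha) (Finset.mem_image_of_mem _ hb) ?_))
    simp only [partEmb_val]
    omega

/-- Every edge of `T3With n G` is either rainbow or monochromatic with respect to residues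
modulo 3, so its residues sum to zero. -/
lemma mod_three_of_mem_T3With {n : ℕ} {G : Finset (Finset (Fin (n / 3)))} {x y z : Fin n}
    (hxy : x ≠ y) (hxz : x ≠ z) (hyz : y ≠ z) (h : ({x, y, z} : Finset (Fin n)) ∈ T3With n G) :
    ((x : ℕ) + y + z) % 3 = 0 := by
  rcases mem_T3With.1 h with h | ⟨i, d, -, hd⟩
  · have h1 := mt (eq_of_mod_eq_of_mem_T3 h (x := x) (y := y) (by simp) (by simp)) hxy
    have h2 := mt (eq_of_mod_eq_of_mem_T3 h (x := x) (y := z) (by simp) (by simp)) hxz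
    have h3 := mt (eq_of_mod_eq_of_mem_T3 h (x := y) (y := z) (by simp) (by simp)) hyz
    have hx : (x : ℕ) % 3 = 0 ∨ (x : ℕ) % 3 = 1 ∨ (x : ℕ) % 3 = 2 := by omega
    have hy : (y : ℕ) % 3 = 0 ∨ (y : ℕ) % 3 = 1 ∨ (y : ℕ) % 3 = 2 := by omega
    omega
  · have hi : ∀ v ∈ ({x, y, z} : Finset (Fin n)), (v : ℕ) % 3 = i := by
      intro v hv
      rw [← hd] at hv
      obtain ⟨k, -, rfl⟩ := Finset.mem_image.1 hv
      simp only [partEmb_val]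
      omega
    have h1 := hi x (by simp)
    have h2 := hi y (by simp)
    have h3 := hi z (by simp)
    omega

lemma exists_image_of_monochromatic {n : ℕ} {G : Finset (Finset (Fin (n / 3)))}
    {e : Finset (Fin n)} (hG : ∀ d ∈ G, d.card = 3) (he : e ∈ T3With n G) (i : Fin 3)
    (hi : ∀ v ∈ e, (v : ℕ) % 3 = i) : ∃ d ∈ G, d.image (partEmb n i) = e := by
  have h3 := card_eq_three_of_mem_T3With hG he
  rcases mem_T3With.1 he with h | ⟨j, d, hd, rfl⟩
  · obtain ⟨a, ha, b, hb, hab⟩ := Finset.one_lt_card.1 (by omega : 1 < e.card)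
    exact absurd (eq_of_mod_eq_of_mem_T3 h ha hb (by rw [hi a ha, hi b hb])) hab
  · obtain ⟨v, hv⟩ := Finset.card_pos.1 (by omega : 0 < (d.image (partEmb n j)).card)
    have hvi := hi v hv
    obtain ⟨k, -, rfl⟩ := Finset.mem_image.1 hv
    simp only [partEmb_val] at hvi
    obtain rfl : j = i := by omega
    exact ⟨d, hd, rfl⟩

/-- A monochromatic copy of a 3-graph without isolated vertices in `T3With n G` comes from a
copy in `G`. -/
lemma hasCopy_of_monochromatic {W : Type*} [DecidableEq W] {F : Finset (Finset W)} {n : ℕ}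
    {G : Finset (Finset (Fin (n / 3)))} (hG : ∀ d ∈ G, d.card = 3)
    (hF : ∀ w, ∃ e ∈ F, w ∈ e) (f : W ↪ Fin n) (hf : ∀ e ∈ F, e.image f ∈ T3With n G)
    (i : Fin 3) (hi : ∀ w, (f w : ℕ) % 3 = i) : HasCopy G F := by
  have key : ∀ e ∈ F, ∃ d ∈ G, d.image (partEmb n i) = e.image f := fun e he =>
    exists_image_of_monochromatic hG (hf e he) i (by simp [hi])
  have hk : ∀ w, ∃ k, partEmb n i k = f w := by
    intro w
    obtain ⟨e, he, hw⟩ := hF w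
    obtain ⟨d, -, hd⟩ := key e he
    have hm : f w ∈ d.image (partEmb n i) := hd ▸ Finset.mem_image_of_mem _ hw
    obtain ⟨k, -, hk⟩ := Finset.mem_image.1 hm
    exact ⟨k, hk⟩
  choose g hg using hk
  refine ⟨⟨g, fun a b h => f.injective (by rw [← hg a, ← hg b, h])⟩, fun e he => ?_⟩
  obtain ⟨d, hd, hde⟩ := key e he
  have h : e.image g = d := by
    apply Finset.image_injective (partEmb n i).injective
    rw [hde, Finset.image_image]
    exact Finset.image_congr fun w _ => hg w
  exact h ▸ hd

lemma Ktss_edge_mem {t s : ℕ} (a : Fin t) (b c : Fin s) :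
    ({Sum.inl a, Sum.inr (Sum.inl b), Sum.inr (Sum.inr c)} :
      Finset (Fin t ⊕ Fin s ⊕ Fin s)) ∈ Ktss t s :=
  Finset.mem_image.2 ⟨(a, b, c), Finset.mem_univ _, rfl⟩

lemma Ktss_nonempty {t s : ℕ} (ht : 1 ≤ t) (hs : 1 ≤ s) : (Ktss t s).Nonempty :=
  ⟨_, Ktss_edge_mem ⟨0, ht⟩ ⟨0, hs⟩ ⟨0, hs⟩⟩

lemma exists_mem_Ktss {t s : ℕ} (ht : 1 ≤ t) (hs : 1 ≤ s) (w : Fin t ⊕ Fin s ⊕ Fin s) :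
    ∃ e ∈ Ktss t s, w ∈ e := by
  rcases w with a | b | c
  · exact ⟨_, Ktss_edge_mem a ⟨0, hs⟩ ⟨0, hs⟩, by simp⟩
  · exact ⟨_, Ktss_edge_mem ⟨0, ht⟩ b ⟨0, hs⟩, by simp⟩
  · exact ⟨_, Ktss_edge_mem ⟨0, ht⟩ ⟨0, hs⟩ c, by simp⟩

/-- The copy of `K_{t,s,s}` spanned by `T`, `S_0`, `S_1` in `F_5^S(m,t,K_{s,s})`. -/
def KtssEmb (m t s : ℕ) (h : 2 * s ≤ m) : Fin t ⊕ Fin s ⊕ Fin s ↪ Fin (3 * m) ⊕ Fin t where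
  toFun := Sum.elim Sum.inr (Sum.elim
    (fun i => Sum.inl ⟨3 * i, by omega⟩) (fun i => Sum.inl ⟨3 * (s + i), by omega⟩))
  inj' := by
    rintro (a | b | c) (x | y | z) hxy <;> simp at hxy ⊢ <;> omega

@[simp]
lemma KtssEmb_inl {m t s : ℕ} (h : 2 * s ≤ m) (a : Fin t) :
    KtssEmb m t s h (Sum.inl a) = Sum.inr a := rfl

@[simp]
lemma KtssEmb_inr_inl {m t s : ℕ} (h : 2 * s ≤ m) (b : Fin s) :
    KtssEmb m t s h (Sum.inr (Sum.inl b)) = Sum.inl ⟨3 * b, by omega⟩ := rfl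

@[simp]
lemma KtssEmb_inr_inr {m t s : ℕ} (h : 2 * s ≤ m) (c : Fin s) :
    KtssEmb m t s h (Sum.inr (Sum.inr c)) = Sum.inl ⟨3 * (s + c), by omega⟩ := rfl

lemma image_KtssEmb_mem {m t s : ℕ} (h : 2 * s ≤ m) {e : Finset (Fin t ⊕ Fin s ⊕ Fin s)}
    (he : e ∈ Ktss t s) : e.image (KtssEmb m t s h) ∈ F5Stss m t s h := by
  obtain ⟨⟨a, b, c⟩, -, rfl⟩ := Finset.mem_image.1 he
  refine Finset.mem_union_right _ (Finset.mem_biUnion.2 ⟨a, Finset.mem_univ _,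
    Finset.mem_image.2 ⟨(⟨3 * b, by omega⟩, ⟨3 * (s + c), by omega⟩), ?_, ?_⟩⟩)
  · exact Finset.mem_product.2 ⟨Finset.mem_image_of_mem _ (Finset.mem_univ b),
      Finset.mem_image_of_mem _ (Finset.mem_univ c)⟩
  · simp [Finset.image_insert]

lemma not_hasCopy_T3With {m t s n : ℕ} (ht : 1 ≤ t) (hs : 1 ≤ s) (hm : 2 * s ≤ m)
    {G : Finset (Finset (Fin (n / 3)))} (hG : ∀ e ∈ G, e.card = 3)
    (hfree : ¬ HasCopy G (Ktss t s)) : ¬ HasCopy (T3With n G) (F5Stss m t s hm) := by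
  rintro ⟨f, hf⟩
  have hK : ∀ e ∈ Ktss t s, e.image ((KtssEmb m t s hm).trans f) ∈ T3With n G := by
    intro e he
    have := hf _ (image_KtssEmb_mem hm he)
    rwa [Finset.image_image] at this
  have hsum : ∀ x : Fin (3 * m), (x : ℕ) % 3 = 0 →
      ((f (Sum.inl x) : ℕ) + f (Sum.inl ⟨1, by omega⟩) + f (Sum.inl ⟨2, by omega⟩)) % 3 = 0 := by
    intro x hx
    refine mod_three_of_mem_T3With (G := G) ?_ ?_ ?_ ?_
    · simp [Fin.ext_iff]; omega
    · simp [Fin.ext_iff]; omega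
    · simp
    · have := hf _ (Finset.mem_union_left _ (Finset.mem_image_of_mem _
        (triple_mem_T3 (y := ⟨1, by omega⟩) (z := ⟨2, by omega⟩) hx rfl rfl)))
      simpa [Finset.image_insert] using this
  have hS : ∀ x : Fin (3 * m), (x : ℕ) % 3 = 0 →
      (f (Sum.inl x) : ℕ) % 3 = (f (Sum.inl ⟨0, by omega⟩) : ℕ) % 3 := by
    intro x hx
    have h1 := hsum x hx
    have h2 := hsum ⟨0, by omega⟩ rfl
    omega
  have hT : ∀ j : Fin t,
      (f (Sum.inr j) : ℕ) % 3 = (f (Sum.inl ⟨0, by omega⟩) : ℕ) % 3 := by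
    intro j
    have h := hK _ (Ktss_edge_mem j ⟨0, hs⟩ ⟨0, hs⟩)
    simp only [Finset.image_insert, Finset.image_singleton] at h
    have h1 := mod_three_of_mem_T3With (by simp) (by simp) (by simp; omega) h
    have h2 := hS ⟨3 * (s + 0), by omega⟩ (by simp)
    simp only [Function.Embedding.trans_apply, KtssEmb_inl, KtssEmb_inr_inl, KtssEmb_inr_inr,
      mul_zero] at h1
    omega
  refine hfree (hasCopy_of_monochromatic hG (exists_mem_Ktss ht hs) _ hK
    ⟨(f (Sum.inl ⟨0, by omega⟩) : ℕ) % 3, Nat.mod_lt _ (by norm_num)⟩ ?_)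
  rintro (a | b | c)
  · exact hT a
  · exact hS _ (by simp)
  · exact hS _ (by simp)

theorem statement3 (m t s : ℕ) (ht : 1 ≤ t) (hs : 2 ≤ s) (hm : 2*s ≤ m) :
    ∃ n0 : ℕ, ∀ n : ℕ, n ≥ n0 →
    (T3 n).card + 3 * exThree (n/3) (Ktss t s) ≤ exThree n (F5Stss m t s hm) := by
  refine ⟨0, fun n _ => ?_⟩
  have hs1 : 1 ≤ s := by omega
  obtain ⟨G, hG, hfree, hcard⟩ := exists_card_eq_exThree (n / 3) (Ktss_nonempty ht hs1)
  rw [← hcard, ← card_T3With hG]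
  exact card_le_exThree (fun _ => card_eq_three_of_mem_T3With hG)
    (not_hasCopy_T3With ht hs1 hm hG hfree)
end
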